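/- arXiv:2108.11162 — 3 statements merged into one kernel-verified Lean document; each statement's English description precedes it below -/
import Mathlib

section
/- Let A > 10 and 0 < ρ < 1/20, and fix η > 0 and a compact subset ℛ₀ ⊂ ℝ_{>0}. Then, uniformly for N^{−1+η} ≤ Δ ≪ 1, the measure (with respect to dα/α) of the set of α ∈ ℛ₀ such that #(𝒯_α(N,Δ) \ 𝒯^{ρ,A}_α(N,Δ)) ≥ (1/2)·ΔN is ≪ (log N)^{−2.5}, with implied constant depending only on A, ρ, η and ℛ₀. -/
open MeasureTheory

noncomputable section

/-- Membership in `S_ρ(N)`: having a prime divisor in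
`(exp((log N)^ρ), exp((log N)^{1-ρ})]`. -/
def memS (ρ N : ℝ) (t : ℤ) : Prop :=
  ∃ p : ℕ, p.Prime ∧ (p : ℤ) ∣ t ∧
    Real.exp (Real.log N ^ ρ) < (p : ℝ) ∧ (p : ℝ) ≤ Real.exp (Real.log N ^ (1 - ρ))

/-- The set `𝒯_α(N,Δ)` of integer quadruples `(t₁,t₂,t₃,t₄) = (t 0, t 1, t 2, t 3)`. -/
def Tset (α N Δ : ℝ) : Set (Fin 4 → ℤ) :=
  {t | (t 0, t 2) ≠ ((0 : ℤ), (0 : ℤ)) ∧ t 0 % 2 = t 1 % 2 ∧ t 2 % 2 = t 3 % 2 ∧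
    |t 0| < t 1 ∧ |t 2| ≤ t 3 ∧
    α * (((t 0 : ℝ) + (t 1 : ℝ)) / 2) ^ 2 + (((t 2 : ℝ) + (t 3 : ℝ)) / 2) ^ 2 ≤
      4 * Real.sqrt α * N / Real.pi ∧
    α * (((t 0 : ℝ) - (t 1 : ℝ)) / 2) ^ 2 + (((t 2 : ℝ) - (t 3 : ℝ)) / 2) ^ 2 ≤
      4 * Real.sqrt α * N / Real.pi ∧
    0 ≤ α * (t 0 : ℝ) * (t 1 : ℝ) - (t 2 : ℝ) * (t 3 : ℝ) ∧
    α * (t 0 : ℝ) * (t 1 : ℝ) - (t 2 : ℝ) * (t 3 : ℝ) ≤ 4 * Real.sqrt α * Δ / Real.pi}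

/-- The subset `𝒯^{ρ,A}_α(N,Δ) ⊆ 𝒯_α(N,Δ)`: at least one of `t₁, t₂, t₃` lies in
`S_ρ(N)` and all `tⱼ` satisfy `|tⱼ| ≥ N^{1/2}(log N)^{-A}`. -/
def TsetGood (ρ A α N Δ : ℝ) : Set (Fin 4 → ℤ) :=
  {t ∈ Tset α N Δ | (memS ρ N (t 0) ∨ memS ρ N (t 1) ∨ memS ρ N (t 2)) ∧
    ∀ i, N ^ ((1 : ℝ) / 2) * Real.log N ^ (-A) ≤ |(t i : ℝ)|}

/-- The measure `dα/α` on `ℝ_{>0}`. -/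
def Rmeasure : Measure ℝ := volume.withDensity fun α => ENNReal.ofReal (1 / α)

end

/-- Partial Euler product at `1` over the primes in `s`. -/
noncomputable def eulerProd (s : Finset ℕ) : ℝ := ∏ p ∈ s with p.Prime, (1 - (p : ℝ)⁻¹)⁻¹

lemma one_sub_inv_prime_pos {p : ℕ} (hp : p.Prime) : 0 < 1 - (p : ℝ)⁻¹ := by
  have : (2 : ℝ) ≤ p := by exact_mod_cast hp.two_le
  have := inv_anti₀ (by norm_num) this
  linarith

lemma eulerProd_pos (s : Finset ℕ) : 0 < eulerProd s :=
  Finset.prod_pos fun _ hp => inv_pos.2 (one_sub_inv_prime_pos (Finset.mem_filter.1 hp).2)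

lemma sum_inv_le_eulerProd {s F : Finset ℕ} (hF : ∀ n ∈ F, n ∈ Nat.factoredNumbers s) :
    ∑ n ∈ F, (n : ℝ)⁻¹ ≤ eulerProd s := by
  let f : ℕ →* ℝ := (invMonoidWithZeroHom : ℝ →*₀ ℝ).toMonoidHom.comp (Nat.castRingHom ℝ).toMonoidHom
  have hf : ∀ n, f n = (n : ℝ)⁻¹ := fun n => rfl
  have h := (EulerProduct.summable_and_hasSum_factoredNumbers_prod_filter_prime_geometric (f := f)
    (fun hp => by
      rw [hf, Real.norm_of_nonneg (by positivity)]
      linarith [one_sub_inv_prime_pos hp]) s).2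
  have := sum_le_hasSum (F.subtype (· ∈ Nat.factoredNumbers s)) (fun i _ => by
    rw [hf]; positivity) h
  rw [Finset.sum_subtype_eq_sum_filter, Finset.filter_true_of_mem hF] at this
  simpa [hf, eulerProd] using this

lemma sum_log_div_prime_le {n : ℕ} (hn : 0 < n) :
    ∑ p ∈ Finset.Ioc 0 n with Nat.Prime p, Real.log p / p ≤ Real.log n + 6 := by
  have hn' : (0 : ℝ) < n := by exact_mod_cast hn
  have h1 : ∑ d ∈ Finset.Ioc 0 n, ArithmeticFunction.vonMangoldt d * ((n / d : ℕ) : ℝ)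
      ≤ n * Real.log n := by
    rw [← ArithmeticFunction.sum_Ioc_mul_zeta_eq_sum]
    calc _ ≤ ∑ m ∈ Finset.Ioc 0 n, Real.log n := by
          refine Finset.sum_le_sum fun m hm => ?_
          rw [ArithmeticFunction.vonMangoldt_mul_zeta, ArithmeticFunction.log_apply]
          rw [Finset.mem_Ioc] at hm
          exact Real.log_le_log (by exact_mod_cast hm.1) (by exact_mod_cast hm.2)
      _ = _ := by simp
  have h2 : Chebyshev.psi n ≤ 6 * n := by
    refine (Chebyshev.psi_le_const_mul_self hn'.le).trans ?_
    have : Real.log 4 ≤ 2 := by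
      rw [show (4 : ℝ) = 2 ^ 2 by norm_num, Real.log_pow]
      have := Real.log_two_lt_d9
      push_cast; linarith
    nlinarith
  rw [Chebyshev.psi, Nat.floor_natCast] at h2
  have h3 : n * ∑ p ∈ Finset.Ioc 0 n with Nat.Prime p, Real.log p / p
      ≤ ∑ d ∈ Finset.Ioc 0 n, (ArithmeticFunction.vonMangoldt d * ((n / d : ℕ) : ℝ)
        + ArithmeticFunction.vonMangoldt d) := by
    rw [Finset.mul_sum]
    refine (Finset.sum_le_sum fun p hp => ?_).trans
      (Finset.sum_le_sum_of_subset_of_nonneg (Finset.filter_subset Nat.Prime _) ?_)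
    · rw [Finset.mem_filter, Finset.mem_Ioc] at hp
      rw [ArithmeticFunction.vonMangoldt_apply_prime hp.2]
      have hp0 : (0 : ℝ) < p := by exact_mod_cast hp.1.1
      have hlt : (n : ℝ) / p ≤ ((n / p : ℕ) : ℝ) + 1 := by
        rw [div_le_iff₀ hp0]
        have := Nat.lt_div_mul_add hp.1.1 (a := n)
        have : (n : ℝ) < ((n / p : ℕ) : ℝ) * p + p := by exact_mod_cast this
        nlinarith
      have hl : 0 ≤ Real.log p := Real.log_natCast_nonneg p
      calc _ = Real.log p * (n / p) := by ring
        _ ≤ Real.log p * (((n / p : ℕ) : ℝ) + 1) := by gcongr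
        _ = _ := by ring
    · intro i _ _
      have := ArithmeticFunction.vonMangoldt_nonneg (n := i)
      positivity
  rw [Finset.sum_add_distrib] at h3
  have : n * ∑ p ∈ Finset.Ioc 0 n with Nat.Prime p, Real.log p / p ≤ n * (Real.log n + 6) := by
    linarith
  exact le_of_mul_le_mul_left this hn'

lemma tsum_rpow_neg_le {σ : ℝ} (hσ : 1 < σ) :
    ∑' n : ℕ, (n : ℝ) ^ (-σ) ≤ 1 + 1 / (σ - 1) := by
  have hs : Summable fun n : ℕ => (n : ℝ) ^ (-σ) := Real.summable_nat_rpow.2 (by linarith)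
  have h := ZetaAsymptotics.zeta_limit_aux1 hσ
  have h0 : 0 ≤ ZetaAsymptotics.termTSum σ :=
    tsum_nonneg fun n => ZetaAsymptotics.term_nonneg _ _
  rw [hs.tsum_eq_zero_add]
  have e : ∑' n : ℕ, ((n + 1 : ℕ) : ℝ) ^ (-σ) = ∑' n : ℕ, 1 / (n + 1 : ℝ) ^ σ :=
    tsum_congr fun n => by rw [Real.rpow_neg (by positivity), one_div]; push_cast; rfl
  rw [e, Nat.cast_zero, Real.zero_rpow (by linarith)]
  nlinarith

lemma prod_rpow_le_tsum {σ : ℝ} (hσ : 1 < σ) (s : Finset ℕ) :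
    ∏ p ∈ s with p.Prime, (1 - (p : ℝ) ^ (-σ))⁻¹ ≤ ∑' n : ℕ, (n : ℝ) ^ (-σ) := by
  let f : ℕ →* ℝ :=
    { toFun := fun n => (n : ℝ) ^ (-σ)
      map_one' := by simp
      map_mul' := fun m n => by
        push_cast
        exact Real.mul_rpow (by positivity) (by positivity) }
  have hf : ∀ n, f n = (n : ℝ) ^ (-σ) := fun n => rfl
  have hs : Summable f := Real.summable_nat_rpow.2 (by linarith)
  have := EulerProduct.prod_filter_prime_geometric_eq_tsum_factoredNumbers hs s
  simp only [hf] at this hs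
  rw [this]
  exact hs.tsum_subtype_le _ _ fun n => Real.rpow_nonneg (Nat.cast_nonneg n) _

/-- Upper bound in Mertens' third theorem. -/
lemma eulerProd_le_log {n : ℕ} (hn : 3 ≤ n) :
    eulerProd (Finset.Ioc 0 n) ≤ 2 * Real.exp 14 * Real.log n := by
  have hn' : (3 : ℝ) ≤ n := by exact_mod_cast hn
  have hlog : 1 ≤ Real.log n := by
    rw [Real.le_log_iff_exp_le (by linarith)]
    linarith [Real.exp_one_lt_d9]
  set σ : ℝ := 1 + 1 / Real.log n with hσd
  have hσ : 1 < σ := by rw [hσd]; have : 0 < 1 / Real.log n := by positivity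
                        linarith
  have key : ∀ p ∈ (Finset.Ioc 0 n).filter Nat.Prime, (1 - (p : ℝ)⁻¹)⁻¹ ≤
      (1 - (p : ℝ) ^ (-σ))⁻¹ * Real.exp (2 / Real.log n * (Real.log p / p)) := by
    intro p hp
    have hp := (Finset.mem_filter.1 hp).2
    have h2 : (2 : ℝ) ≤ p := by exact_mod_cast hp.two_le
    have hp0 : (0 : ℝ) < p := by linarith
    have hpos := one_sub_inv_prime_pos hp
    have hinv : (p : ℝ)⁻¹ ≤ 2⁻¹ := inv_anti₀ (by norm_num) h2
    have hle : (p : ℝ) ^ (-σ) ≤ (p : ℝ)⁻¹ := by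
      rw [← Real.rpow_neg_one]
      exact Real.rpow_le_rpow_of_exponent_le (by linarith) (by linarith)
    have hpos2 : 0 < 1 - (p : ℝ) ^ (-σ) := by linarith
    have hlp : 0 ≤ Real.log p := Real.log_natCast_nonneg p
    have hdiff : (p : ℝ)⁻¹ - (p : ℝ) ^ (-σ) ≤ 1 / Real.log n * (Real.log p / p) := by
      have e : (p : ℝ) ^ (-σ) = (p : ℝ)⁻¹ * Real.exp (-(Real.log p / Real.log n)) := by
        rw [hσd, neg_add, Real.rpow_add hp0, Real.rpow_neg_one, Real.rpow_def_of_pos hp0]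
        congr 2; ring
      rw [e]
      have := Real.add_one_le_exp (-(Real.log p / Real.log n))
      have h3 : (p : ℝ)⁻¹ * (1 - Real.exp (-(Real.log p / Real.log n)))
          ≤ (p : ℝ)⁻¹ * (Real.log p / Real.log n) := by
        gcongr; linarith
      calc _ = (p : ℝ)⁻¹ * (1 - Real.exp (-(Real.log p / Real.log n))) := by ring
        _ ≤ _ := h3
        _ = _ := by field_simp
    rw [← div_eq_inv_mul, le_div_iff₀ hpos2, ← div_eq_inv_mul, div_le_iff₀ hpos]
    have hE := Real.add_one_le_exp (2 / Real.log n * (Real.log p / p))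
    set u := 1 / Real.log n * (Real.log p / p) with hu
    have hu0 : 0 ≤ u := by positivity
    have e2 : 2 / Real.log n * (Real.log p / p) = 2 * u := by rw [hu]; ring
    rw [e2] at hE ⊢
    calc 1 - (p : ℝ) ^ (-σ) ≤ (2 * u + 1) * (1 - (p : ℝ)⁻¹) := by nlinarith
      _ ≤ _ := by gcongr
  calc eulerProd (Finset.Ioc 0 n) ≤ ∏ p ∈ (Finset.Ioc 0 n).filter Nat.Prime,
        ((1 - (p : ℝ) ^ (-σ))⁻¹ * Real.exp (2 / Real.log n * (Real.log p / p))) :=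
        Finset.prod_le_prod (fun p hp =>
          (inv_pos.2 (one_sub_inv_prime_pos (Finset.mem_filter.1 hp).2)).le) key
    _ = (∏ p ∈ (Finset.Ioc 0 n).filter Nat.Prime, (1 - (p : ℝ) ^ (-σ))⁻¹) *
        Real.exp (2 / Real.log n * ∑ p ∈ (Finset.Ioc 0 n).filter Nat.Prime, Real.log p / p) := by
        rw [Finset.prod_mul_distrib, ← Real.exp_sum, Finset.mul_sum]
    _ ≤ (1 + 1 / (σ - 1)) * Real.exp 14 := by
        have h1 := (prod_rpow_le_tsum hσ (Finset.Ioc 0 n)).trans (tsum_rpow_neg_le hσ)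
        have h2 := sum_log_div_prime_le (show 0 < n by lia)
        have h3 : 2 / Real.log n * ∑ p ∈ (Finset.Ioc 0 n).filter Nat.Prime, Real.log p / p
            ≤ 14 := by
          calc _ ≤ 2 / Real.log n * (7 * Real.log n) := by gcongr; linarith
            _ = 14 := by field_simp; norm_num
        have : 0 < 1 / (σ - 1) := by have : 0 < σ - 1 := by linarith
                                     positivity
        gcongr
    _ = (1 + Real.log n) * Real.exp 14 := by rw [hσd]; simp
    _ ≤ _ := by nlinarith [Real.exp_pos 14]

lemma log_le_eulerProd {x : ℝ} (hx : 0 ≤ x) : Real.log x ≤ eulerProd (Finset.Ioc 0 ⌊x⌋₊) := by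
  have h := log_le_harmonic_floor x hx
  refine h.trans ?_
  rw [harmonic_eq_sum_Icc]
  push_cast
  refine sum_inv_le_eulerProd fun n hn => ?_
  rw [Finset.mem_Icc] at hn
  rw [Nat.mem_factoredNumbers_iff_forall_le]
  refine ⟨by lia, fun p hp hpp _ => ?_⟩
  rw [Finset.mem_Ioc]
  exact ⟨hpp.pos, by lia⟩

/-- Harmonic sum over integers without prime factors in `(P, Q]`. -/
lemma sum_inv_sifted_le {P Q x : ℝ} (hP : 3 ≤ P) (hPQ : P ≤ Q) (hQx : Q ≤ x) {F : Finset ℕ}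
    (hF : ∀ n ∈ F, 0 < n ∧ (n : ℝ) ≤ x ∧ ∀ p : ℕ, p.Prime → p ∣ n → P < p → ¬ (p : ℝ) ≤ Q) :
    ∑ n ∈ F, (n : ℝ)⁻¹ ≤ (2 * Real.exp 14) ^ 2 * (Real.log x * Real.log P / Real.log Q) := by
  set a := ⌊P⌋₊
  set b := ⌊Q⌋₊
  set c := ⌊x⌋₊
  have hab : a ≤ b := Nat.floor_mono hPQ
  have hbc : b ≤ c := Nat.floor_mono hQx
  have h3a : 3 ≤ a := Nat.le_floor (by exact_mod_cast hP)
  have hmul : ∀ {u v : ℕ}, u ≤ v → eulerProd (Finset.Ioc 0 v) =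
      eulerProd (Finset.Ioc 0 u) * eulerProd (Finset.Ioc u v) := by
    intro u v huv
    unfold eulerProd
    rw [← Finset.Ioc_union_Ioc_eq_Ioc (Nat.zero_le u) huv, Finset.filter_union,
      Finset.prod_union]
    refine Finset.disjoint_filter_filter (Finset.disjoint_left.2 fun i hi hj => ?_)
    rw [Finset.mem_Ioc] at hi hj
    lia
  have hsplit : eulerProd (Finset.Ioc 0 a ∪ Finset.Ioc b c) =
      eulerProd (Finset.Ioc 0 a) * eulerProd (Finset.Ioc b c) := by
    unfold eulerProd
    rw [Finset.filter_union, Finset.prod_union]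
    refine Finset.disjoint_filter_filter (Finset.disjoint_left.2 fun i hi hj => ?_)
    rw [Finset.mem_Ioc] at hi hj
    lia
  have h1 : ∑ n ∈ F, (n : ℝ)⁻¹ ≤ eulerProd (Finset.Ioc 0 a ∪ Finset.Ioc b c) := by
    refine sum_inv_le_eulerProd fun n hn => ?_
    obtain ⟨h0, hx, hpr⟩ := hF n hn
    rw [Nat.mem_factoredNumbers_iff_forall_le]
    refine ⟨by lia, fun p hpn hp hd => ?_⟩
    rw [Finset.mem_union, Finset.mem_Ioc, Finset.mem_Ioc]
    by_cases hpP : P < p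
    · right
      refine ⟨?_, Nat.le_floor ((Nat.cast_le.2 hpn).trans hx)⟩
      exact (Nat.floor_lt (by linarith)).2 (not_le.1 (hpr p hp hd hpP))
    · left
      exact ⟨hp.pos, Nat.le_floor (not_lt.1 hpP)⟩
  have hlogfl : ∀ {y : ℝ}, 3 ≤ y → eulerProd (Finset.Ioc 0 ⌊y⌋₊) ≤
      2 * Real.exp 14 * Real.log y := by
    intro y hy
    have h3 : 3 ≤ ⌊y⌋₊ := Nat.le_floor (by exact_mod_cast hy)
    refine (eulerProd_le_log h3).trans ?_
    have : Real.log ⌊y⌋₊ ≤ Real.log y :=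
      Real.log_le_log (by exact_mod_cast (by lia : 0 < ⌊y⌋₊)) (Nat.floor_le (by linarith))
    gcongr
  have hA := hlogfl hP
  have hC := hlogfl (hP.trans (hPQ.trans hQx))
  have hB := log_le_eulerProd (show 0 ≤ Q by linarith)
  have hlQ : 0 < Real.log Q := Real.log_pos (by linarith)
  rw [hmul hbc] at hC
  rw [hsplit] at h1
  refine h1.trans ?_
  rw [← mul_div_assoc, le_div_iff₀ hlQ]
  have pa := eulerProd_pos (Finset.Ioc 0 a)
  have pbc := eulerProd_pos (Finset.Ioc b c)
  calc _ ≤ eulerProd (Finset.Ioc 0 a) * eulerProd (Finset.Ioc b c) * eulerProd (Finset.Ioc 0 b) := by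
        gcongr
    _ = eulerProd (Finset.Ioc 0 a) * (eulerProd (Finset.Ioc 0 b) * eulerProd (Finset.Ioc b c)) := by
        ring
    _ ≤ (2 * Real.exp 14 * Real.log P) * (2 * Real.exp 14 * Real.log x) := by
        refine mul_le_mul hA hC (mul_pos (eulerProd_pos _) pbc).le (mul_nonneg (by positivity) ?_)
        exact Real.log_nonneg (by linarith)
    _ = _ := by ring

/-- Hall's inequality for the indicator function of a divisor-closed set. -/
lemma card_mul_log_le_of_dvd_closed {X : ℝ} (hX : 0 < X) {F : Finset ℕ}
    (hF : ∀ n ∈ F, 0 < n ∧ (n : ℝ) ≤ X) (hd : ∀ n ∈ F, ∀ d, d ∣ n → d ∈ F) :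
    (F.card : ℝ) * Real.log X ≤ 7 * X * ∑ n ∈ F, (n : ℝ)⁻¹ := by
  have h1 : ∑ n ∈ F, Real.log (X / n) ≤ ∑ n ∈ F, X * (n : ℝ)⁻¹ := by
    refine Finset.sum_le_sum fun n hn => ?_
    have : (0 : ℝ) < n := by exact_mod_cast (hF n hn).1
    have := Real.log_le_sub_one_of_pos (show 0 < X / n by positivity)
    rw [div_eq_mul_inv] at *
    linarith
  have h2 : ∑ n ∈ F, Real.log n ≤ ∑ n ∈ F, 6 * X * (n : ℝ)⁻¹ := by
    calc ∑ n ∈ F, Real.log n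
        = ∑ n ∈ F, ∑ m ∈ n.divisors, ArithmeticFunction.vonMangoldt (n / m) := by
          refine Finset.sum_congr rfl fun n _ => ?_
          rw [Nat.sum_div_divisors n (fun d => ArithmeticFunction.vonMangoldt d),
            ArithmeticFunction.vonMangoldt_sum]
      _ = ∑ m ∈ F, ∑ n ∈ F with m ∣ n, ArithmeticFunction.vonMangoldt (n / m) := by
          refine Finset.sum_comm' fun n m => ?_
          rw [Finset.mem_filter, Nat.mem_divisors]
          constructor
          · rintro ⟨hn, hmn, _⟩
            exact ⟨⟨hn, hmn⟩, hd n hn m hmn⟩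
          · rintro ⟨⟨hn, hmn⟩, _⟩
            exact ⟨hn, hmn, (hF n hn).1.ne'⟩
      _ ≤ ∑ m ∈ F, 6 * X * (m : ℝ)⁻¹ := by
          refine Finset.sum_le_sum fun m hm => ?_
          have hm0 := (hF m hm).1
          have hm0' : (0 : ℝ) < m := by exact_mod_cast hm0
          have hinj : Set.InjOn (fun n => n / m) (F.filter (m ∣ ·) : Finset ℕ) := by
            intro a ha b hb hab
            rw [Finset.mem_coe, Finset.mem_filter] at ha hb
            exact (Nat.div_left_inj ha.2 hb.2).1 hab
          rw [← Finset.sum_image (f := fun d => ArithmeticFunction.vonMangoldt d) hinj]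
          have hψ : Chebyshev.psi (X / m) ≤ 6 * (X / m) := by
            refine (Chebyshev.psi_le_const_mul_self (by positivity)).trans ?_
            have : Real.log 4 ≤ 2 := by
              rw [show (4 : ℝ) = 2 ^ 2 by norm_num, Real.log_pow]
              have := Real.log_two_lt_d9
              push_cast; linarith
            gcongr; linarith
          rw [mul_assoc, ← div_eq_mul_inv]
          refine le_trans ?_ hψ
          refine Finset.sum_le_sum_of_subset_of_nonneg ?_
            fun _ _ _ => ArithmeticFunction.vonMangoldt_nonneg
          intro d hdm
          obtain ⟨n, hn, rfl⟩ := Finset.mem_image.1 hdm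
          obtain ⟨hn, k, rfl⟩ := Finset.mem_filter.1 hn
          have hk := hF _ hn
          rw [Nat.mul_div_cancel_left _ hm0, Finset.mem_Ioc]
          refine ⟨Nat.pos_of_mul_pos_left hk.1, Nat.le_floor ?_⟩
          rw [le_div_iff₀ hm0', mul_comm]
          exact_mod_cast hk.2
  calc (F.card : ℝ) * Real.log X = ∑ n ∈ F, (Real.log (X / n) + Real.log n) := by
        rw [Finset.sum_congr rfl (g := fun _ => Real.log X), Finset.sum_const, nsmul_eq_mul]
        intro n hn
        have : (0 : ℝ) < n := by exact_mod_cast (hF n hn).1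
        rw [Real.log_div hX.ne' this.ne']; ring
    _ ≤ ∑ n ∈ F, X * (n : ℝ)⁻¹ + ∑ n ∈ F, 6 * X * (n : ℝ)⁻¹ := by
        rw [Finset.sum_add_distrib]; linarith
    _ = _ := by rw [← Finset.mul_sum, ← Finset.mul_sum]; ring

/-- From linear counting bounds to a bound for a harmonic sum, by splitting into `m` blocks. -/
lemma sum_inv_le_of_count {Y R D : ℝ} (hY : 0 < Y) (hR : 1 ≤ R) (hD : 0 ≤ D) (m : ℕ) :
    ∀ F : Finset ℕ, (∀ n ∈ F, Y ≤ n ∧ (n : ℝ) ≤ Y * R ^ m) →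
      (∀ X : ℝ, 0 < X → ((F.filter fun n : ℕ => (n : ℝ) ≤ X).card : ℝ) ≤ D * X) →
      ∑ n ∈ F, (n : ℝ)⁻¹ ≤ (m + 1) * R * D := by
  have hblock : ∀ (G : Finset ℕ) (T U : ℝ), 0 < T → (∀ n ∈ G, T ≤ n) →
      (G.card : ℝ) ≤ U → ∑ n ∈ G, (n : ℝ)⁻¹ ≤ U / T := by
    intro G T U hT hG hU
    calc ∑ n ∈ G, (n : ℝ)⁻¹ ≤ ∑ n ∈ G, T⁻¹ :=
          Finset.sum_le_sum fun n hn => inv_anti₀ hT (hG n hn)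
      _ = G.card / T := by rw [Finset.sum_const, nsmul_eq_mul, div_eq_mul_inv]
      _ ≤ _ := by gcongr
  induction m with
  | zero =>
    intro F hF hc
    have h := hc Y hY
    rw [Finset.filter_true_of_mem fun n hn => by simpa using (hF n hn).2] at h
    refine (hblock F Y _ hY (fun n hn => (hF n hn).1) h).trans ?_
    rw [mul_div_assoc, div_self hY.ne']
    push_cast
    nlinarith
  | succ m ih =>
    intro F hF hc
    have hT : 0 < Y * R ^ m := by positivity
    rw [← Finset.sum_filter_add_sum_filter_not F (fun n : ℕ => (n : ℝ) ≤ Y * R ^ m)]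
    have h1 := ih (F.filter fun n : ℕ => (n : ℝ) ≤ Y * R ^ m)
      (fun n hn => ⟨(hF n (Finset.mem_filter.1 hn).1).1, (Finset.mem_filter.1 hn).2⟩)
      (fun X hX => le_trans (by
        exact_mod_cast Finset.card_le_card
          (Finset.filter_subset_filter _ (Finset.filter_subset _ _))) (hc X hX))
    have h2 : ∑ n ∈ F.filter (fun n : ℕ => ¬ (n : ℝ) ≤ Y * R ^ m), (n : ℝ)⁻¹ ≤
        (D * (Y * R ^ (m + 1))) / (Y * R ^ m) := by
      refine hblock _ _ _ hT (fun n hn => (not_le.1 (Finset.mem_filter.1 hn).2).le) ?_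
      refine le_trans ?_ (hc (Y * R ^ (m + 1)) (by positivity))
      exact_mod_cast Finset.card_le_card fun n hn => Finset.mem_filter.2
        ⟨(Finset.mem_filter.1 hn).1, (hF n (Finset.mem_filter.1 hn).1).2⟩
    have e : (D * (Y * R ^ (m + 1))) / (Y * R ^ m) = R * D := by
      rw [pow_succ]; field_simp
    rw [e] at h2
    push_cast
    linarith

/-- Weighted count of quadruples with `p q ≤ K u v`. -/
lemma sum_quadruples_le {K : ℝ} (U V W J : Finset ℕ) (hU : ∀ n ∈ U, 0 < n)
    (hV : ∀ n ∈ V, 0 < n) (hW : ∀ n ∈ W, 0 < n) (hJ : ∀ n ∈ J, 0 < n) (hK : 0 ≤ K)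
    (S : Finset (ℕ × ℕ × ℕ × ℕ))
    (hS : ∀ x ∈ S, x.1 ∈ U ∧ x.2.1 ∈ V ∧ x.2.2.1 ∈ W ∧ x.2.2.2 ∈ J ∧
      (x.2.2.1 : ℝ) * x.2.2.2 ≤ K * (x.1 * x.2.1)) :
    ∑ x ∈ S, ((x.1 : ℝ) * x.2.1)⁻¹ ≤ K * (U.card * V.card) * ∑ n ∈ W, (n : ℝ)⁻¹ := by
  classical
  calc ∑ x ∈ S, ((x.1 : ℝ) * x.2.1)⁻¹ ≤ ∑ x ∈ U ×ˢ V ×ˢ W ×ˢ J,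
        if (x.2.2.1 : ℝ) * x.2.2.2 ≤ K * (x.1 * x.2.1) then ((x.1 : ℝ) * x.2.1)⁻¹ else 0 := by
        rw [← Finset.sum_filter]
        refine Finset.sum_le_sum_of_subset_of_nonneg (fun x hx => ?_) fun _ _ _ => by positivity
        obtain ⟨h1, h2, h3, h4, h5⟩ := hS x hx
        simp only [Finset.mem_filter, Finset.mem_product]
        exact ⟨⟨h1, h2, h3, h4⟩, h5⟩
    _ = ∑ u ∈ U, ∑ v ∈ V, ∑ p ∈ W, ∑ q ∈ J,
        if (p : ℝ) * q ≤ K * (u * v) then ((u : ℝ) * v)⁻¹ else 0 := by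
        simp only [Finset.sum_product]
    _ ≤ ∑ u ∈ U, ∑ v ∈ V, ∑ p ∈ W, K * (p : ℝ)⁻¹ := by
        refine Finset.sum_le_sum fun u hu => Finset.sum_le_sum fun v hv =>
          Finset.sum_le_sum fun p hp => ?_
        have hu0 : (0 : ℝ) < u := by exact_mod_cast hU u hu
        have hv0 : (0 : ℝ) < v := by exact_mod_cast hV v hv
        have hp0 : (0 : ℝ) < p := by exact_mod_cast hW p hp
        rw [← Finset.sum_filter, Finset.sum_const, nsmul_eq_mul]
        have hc : ((J.filter fun q : ℕ => (p : ℝ) * q ≤ K * (u * v)).card : ℝ) ≤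
            K * (u * v) / p := by
          refine le_trans ?_ (Nat.floor_le (by positivity))
          have : J.filter (fun q : ℕ => (p : ℝ) * q ≤ K * (u * v)) ⊆
              Finset.Ioc 0 ⌊K * (u * v) / p⌋₊ := by
            intro q hq
            rw [Finset.mem_filter] at hq
            rw [Finset.mem_Ioc]
            refine ⟨hJ q hq.1, Nat.le_floor ?_⟩
            rw [le_div_iff₀ hp0, mul_comm]
            exact hq.2
          have := Finset.card_le_card this
          rw [Nat.card_Ioc] at this
          exact_mod_cast this
        calc _ ≤ K * (u * v) / p * ((u : ℝ) * v)⁻¹ := by gcongr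
          _ = _ := by field_simp
    _ = _ := by
        simp only [Finset.sum_const, nsmul_eq_mul, ← Finset.mul_sum]
        ring

/-- `n` has no prime factor in `(P, Q]`. -/
def Sifted (P Q : ℝ) (n : ℕ) : Prop := ∀ p : ℕ, p.Prime → p ∣ n → P < p → ¬ (p : ℝ) ≤ Q

/-- Conditions on `N` that hold for all large `N`. -/
structure LargeParam (A ρ K N : ℝ) : Prop where
  one_lt : 1 < N
  two_le : 2 ≤ Real.log N ^ ρ
  log_log_le : A * Real.log (Real.log N) ≤ Real.log N / 4
  one_le_log : 1 ≤ Real.log N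
  le_log : K ≤ Real.log N
  mul_sqrt_le : K * N ^ ((1 : ℝ) / 2) ≤ N
  log_rpow_le : Real.log N ^ (2.5 : ℝ) ≤ N ^ ((1 : ℝ) / 2)

lemma eventually_largeParam (A K : ℝ) {ρ : ℝ} (hρ : 0 < ρ) :
    ∀ᶠ N in Filter.atTop, LargeParam A ρ K N := by
  have hlog := Real.tendsto_log_atTop
  have h2 : ∀ᶠ x in Filter.atTop, A * Real.log x ≤ x / 4 := by
    have := (Real.isLittleO_log_id_atTop.const_mul_left A).bound (show (0 : ℝ) < 1 / 4 by norm_num)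
    filter_upwards [this, Filter.eventually_ge_atTop 0] with x hx hx0
    rw [id, Real.norm_of_nonneg hx0] at hx
    linarith [Real.le_norm_self (A * Real.log x)]
  have h3 : ∀ᶠ x : ℝ in Filter.atTop, Real.log x ^ (2.5 : ℝ) ≤ x ^ ((1 : ℝ) / 2) := by
    have := (isLittleO_log_rpow_rpow_atTop (2.5 : ℝ) (show (0 : ℝ) < 1 / 2 by norm_num)).bound
      one_pos
    filter_upwards [this, Filter.eventually_ge_atTop 0] with x hx hx0
    rw [one_mul, Real.norm_of_nonneg (Real.rpow_nonneg hx0 _)] at hx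
    exact (Real.le_norm_self _).trans hx
  filter_upwards [Filter.eventually_gt_atTop 1,
    ((tendsto_rpow_atTop hρ).comp hlog).eventually_ge_atTop 2, hlog.eventually h2,
    hlog.eventually_ge_atTop 1, hlog.eventually_ge_atTop K,
    (tendsto_rpow_atTop (show (0 : ℝ) < 1 / 2 by norm_num)).eventually_ge_atTop K, h3]
    with N h1 h2 h3 h4 h5 h6 h7
  refine ⟨h1, h2, h3, h4, h5, ?_, h7⟩
  calc K * N ^ ((1 : ℝ) / 2) ≤ N ^ ((1 : ℝ) / 2) * N ^ ((1 : ℝ) / 2) := by gcongr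
    _ = N := by
      rw [← Real.rpow_add (by linarith)]; norm_num

section counting

variable {A ρ K N : ℝ}

lemma card_sifted_le (hρ0 : 0 < ρ) (hρ : ρ < 1 / 20) (h : LargeParam A ρ K N)
    {X : ℝ} (hX : N ^ ((1 : ℝ) / 2) * Real.log N ^ (-A) ≤ X) (hXN : X ≤ N) {F : Finset ℕ}
    (hF : ∀ n, n ∈ F ↔ (0 < n ∧ (n : ℝ) ≤ X) ∧
      Sifted (Real.exp (Real.log N ^ ρ)) (Real.exp (Real.log N ^ (1 - ρ))) n) :
    (F.card : ℝ) ≤ 28 * (2 * Real.exp 14) ^ 2 * Real.log N ^ (2 * ρ - 1) * X := by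
  have hN := h.one_lt
  have hL1 := h.one_le_log
  set L := Real.log N with hL
  have hL0 : 0 < L := by linarith
  have hY : 0 < N ^ ((1 : ℝ) / 2) * L ^ (-A) := by positivity
  have hX0 : 0 < X := hY.trans_le hX
  have hlogX : L / 4 ≤ Real.log X := by
    refine le_trans ?_ (Real.log_le_log hY hX)
    rw [Real.log_mul (by positivity) (by positivity), Real.log_rpow (by linarith),
      Real.log_rpow hL0, ← hL]
    linarith [h.log_log_le]
  have h1 := card_mul_log_le_of_dvd_closed hX0 (F := F) (fun n hn => ((hF n).1 hn).1)
    (fun n hn d hd => by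
      obtain ⟨⟨h0, hx⟩, hs⟩ := (hF n).1 hn
      refine (hF d).2 ⟨⟨Nat.pos_of_dvd_of_pos hd h0, le_trans ?_ hx⟩,
        fun p hp hpd => hs p hp (hpd.trans hd)⟩
      exact_mod_cast Nat.le_of_dvd h0 hd)
  have hP : 3 ≤ Real.exp (L ^ ρ) := by
    linarith [Real.add_one_le_exp (L ^ ρ), h.two_le]
  have hPQ : Real.exp (L ^ ρ) ≤ Real.exp (L ^ (1 - ρ)) :=
    Real.exp_le_exp.2 (Real.rpow_le_rpow_of_exponent_le hL1 (by linarith))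
  have hQN : Real.exp (L ^ (1 - ρ)) ≤ N := by
    rw [← Real.le_log_iff_exp_le (by linarith), ← hL]
    calc L ^ (1 - ρ) ≤ L ^ (1 : ℝ) := Real.rpow_le_rpow_of_exponent_le hL1 (by linarith)
      _ = L := Real.rpow_one L
  have h2 := sum_inv_sifted_le hP hPQ hQN (F := F) (fun n hn => by
    obtain ⟨⟨h0, hx⟩, hs⟩ := (hF n).1 hn
    exact ⟨h0, hx.trans hXN, hs⟩)
  rw [Real.log_exp, Real.log_exp, ← hL] at h2
  have e : L * L ^ ρ / L ^ (1 - ρ) = L ^ (2 * ρ - 1) * L := by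
    rw [mul_comm (L ^ (2 * ρ - 1)), mul_div_assoc, ← Real.rpow_sub hL0]
    ring_nf
  rw [e] at h2
  have h3 : (F.card : ℝ) * (L / 4) ≤
      7 * X * ((2 * Real.exp 14) ^ 2 * (L ^ (2 * ρ - 1) * L)) :=
    calc _ ≤ (F.card : ℝ) * Real.log X := by gcongr
      _ ≤ _ := h1
      _ ≤ _ := by gcongr
  refine le_of_mul_le_mul_right ?_ (show 0 < L / 4 by positivity)
  linarith

/-- The constant in the bound for the weighted sum over exceptional quadruples. -/
noncomputable def excConst (A K K' : ℝ) : ℝ :=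
  8 * K' ^ 2 * K + K' * (28 * (2 * Real.exp 14) ^ 2) ^ 3 * K ^ 2 * (⌈20 * (A + 1)⌉₊ + 1)

lemma sum_small_le {Y Z K' : ℝ} (hY : 0 ≤ Y) (hZ : 1 ≤ Z) (hK' : 0 ≤ K')
    (S : Finset (ℕ × ℕ × ℕ × ℕ))
    (hpos : ∀ x ∈ S, 0 < x.1 ∧ 0 < x.2.1 ∧ 0 < x.2.2.1 ∧ 0 < x.2.2.2)
    (hle : ∀ x ∈ S, (x.1 : ℝ) ≤ Z ∧ (x.2.1 : ℝ) ≤ Z ∧ (x.2.2.1 : ℝ) ≤ Z ∧ (x.2.2.2 : ℝ) ≤ Z)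
    (hS : ∀ x ∈ S, (x.2.2.1 : ℝ) * x.2.2.2 ≤ K' * (x.1 * x.2.1))
    (hsm : (∀ x ∈ S, (x.1 : ℝ) ≤ Y) ∨ (∀ x ∈ S, (x.2.1 : ℝ) ≤ Y)) :
    ∑ x ∈ S, ((x.1 : ℝ) * x.2.1)⁻¹ ≤ K' * (Y * Z) * (1 + Real.log Z) := by
  have hI : ∀ T : ℝ, ∀ n ∈ Finset.Ioc 0 ⌊T⌋₊, 0 < n := fun T n hn => (Finset.mem_Ioc.1 hn).1
  have hH : ∑ n ∈ Finset.Ioc 0 ⌊Z⌋₊, (n : ℝ)⁻¹ ≤ 1 + Real.log Z := by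
    have := harmonic_floor_le_one_add_log Z hZ
    rw [harmonic_eq_sum_Icc] at this
    push_cast at this
    rwa [show Finset.Ioc 0 ⌊Z⌋₊ = Finset.Icc 1 ⌊Z⌋₊ from rfl]
  have hc : ∀ T : ℝ, 0 ≤ T → ((Finset.Ioc 0 ⌊T⌋₊).card : ℝ) ≤ T := fun T hT => by
    rw [Nat.card_Ioc, Nat.sub_zero]; exact Nat.floor_le hT
  have hZ0 : 0 ≤ Z := by linarith
  have hlZ : 0 ≤ Real.log Z := Real.log_nonneg hZ
  have mem : ∀ {T : ℝ} {n : ℕ}, 0 < n → (n : ℝ) ≤ T → n ∈ Finset.Ioc 0 ⌊T⌋₊ := fun h1 h2 =>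
    Finset.mem_Ioc.2 ⟨h1, Nat.le_floor h2⟩
  rcases hsm with hsm | hsm
  · refine (sum_quadruples_le (Finset.Ioc 0 ⌊Y⌋₊) (Finset.Ioc 0 ⌊Z⌋₊) (Finset.Ioc 0 ⌊Z⌋₊)
      (Finset.Ioc 0 ⌊Z⌋₊) (hI _) (hI _) (hI _) (hI _) hK' S fun x hx => ?_).trans ?_
    · obtain ⟨p1, p2, p3, p4⟩ := hpos x hx
      obtain ⟨l1, l2, l3, l4⟩ := hle x hx
      exact ⟨mem p1 (hsm x hx), mem p2 l2, mem p3 l3, mem p4 l4, hS x hx⟩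
    · gcongr
      exacts [hc Y hY, hc Z hZ0]
  · refine (sum_quadruples_le (Finset.Ioc 0 ⌊Z⌋₊) (Finset.Ioc 0 ⌊Y⌋₊) (Finset.Ioc 0 ⌊Z⌋₊)
      (Finset.Ioc 0 ⌊Z⌋₊) (hI _) (hI _) (hI _) (hI _) hK' S fun x hx => ?_).trans ?_
    · obtain ⟨p1, p2, p3, p4⟩ := hpos x hx
      obtain ⟨l1, l2, l3, l4⟩ := hle x hx
      exact ⟨mem p1 l1, mem p2 (hsm x hx), mem p3 l3, mem p4 l4, hS x hx⟩
    · rw [mul_comm Y Z]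
      gcongr
      exacts [hc Z hZ0, hc Y hY]

lemma sum_sifted_le (hA : 0 ≤ A) (hρ0 : 0 < ρ) (hρ : ρ < 1 / 20) (hK : 1 ≤ K)
    (h : LargeParam A ρ K N) {K' : ℝ} (hK' : 0 ≤ K')
    (S : Finset (ℕ × ℕ × ℕ × ℕ))
    (hpos : ∀ x ∈ S, 0 < x.1 ∧ 0 < x.2.1 ∧ 0 < x.2.2.1 ∧ 0 < x.2.2.2)
    (hle : ∀ x ∈ S, (x.1 : ℝ) ≤ K * N ^ ((1 : ℝ) / 2) ∧ (x.2.1 : ℝ) ≤ K * N ^ ((1 : ℝ) / 2) ∧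
      (x.2.2.1 : ℝ) ≤ K * N ^ ((1 : ℝ) / 2) ∧ (x.2.2.2 : ℝ) ≤ K * N ^ ((1 : ℝ) / 2))
    (hS : ∀ x ∈ S, (x.2.2.1 : ℝ) * x.2.2.2 ≤ K' * (x.1 * x.2.1))
    (hY : ∀ x ∈ S, N ^ ((1 : ℝ) / 2) * Real.log N ^ (-A) ≤ x.2.2.1)
    (hs : ∀ x ∈ S, ∀ n, n = x.1 ∨ n = x.2.1 ∨ n = x.2.2.1 →
      Sifted (Real.exp (Real.log N ^ ρ)) (Real.exp (Real.log N ^ (1 - ρ))) n) :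
    ∑ x ∈ S, ((x.1 : ℝ) * x.2.1)⁻¹ ≤
      K' * (28 * (2 * Real.exp 14) ^ 2) ^ 3 * K ^ 2 * (⌈20 * (A + 1)⌉₊ + 1) *
        (N * Real.log N ^ (-(2.5 : ℝ))) := by
  classical
  have hN := h.one_lt
  have hL1 := h.one_le_log
  have hKL := h.le_log
  have hZN := h.mul_sqrt_le
  have hcard := fun {X : ℝ} => card_sifted_le (X := X) hρ0 hρ h
  set L := Real.log N with hL
  set P := Real.exp (L ^ ρ)
  set Q := Real.exp (L ^ (1 - ρ))
  set Z := K * N ^ ((1 : ℝ) / 2) with hZd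
  set Y := N ^ ((1 : ℝ) / 2) * L ^ (-A) with hYd
  set c := 28 * (2 * Real.exp 14) ^ 2 with hc
  have hc0 : 0 < c := by positivity
  have hL0 : 0 < L := by linarith
  have hY0 : 0 < Y := by positivity
  have hsqrt : 0 < N ^ ((1 : ℝ) / 2) := by positivity
  have hLA : L ^ (-A) ≤ 1 := Real.rpow_le_one_of_one_le_of_nonpos hL1 (by linarith)
  have hYZ : Y ≤ Z := by
    rw [hYd, hZd, mul_comm]
    gcongr
    linarith
  have hZ0 : 0 < Z := by positivity
  set D := c * L ^ (2 * ρ - 1) with hD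
  have hD0 : 0 < D := by positivity
  let G : ℝ → Finset ℕ := fun X => (Finset.Ioc 0 ⌊X⌋₊).filter (Sifted P Q)
  have hG : ∀ X, 0 < X → ∀ n, n ∈ G X ↔ (0 < n ∧ (n : ℝ) ≤ X) ∧ Sifted P Q n := by
    intro X hX n
    simp only [G, Finset.mem_filter, Finset.mem_Ioc, Nat.le_floor_iff hX.le]
  have hGc : ∀ X, Y ≤ X → X ≤ N → ((G X).card : ℝ) ≤ D * X := fun X h1 h2 =>
    hcard h1 h2 (hG X (hY0.trans_le h1))
  set W := (G Z).filter fun n : ℕ => Y ≤ (n : ℝ) with hW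
  set R := L ^ ((1 : ℝ) / 20) with hR
  have hR1 : 1 ≤ R := Real.one_le_rpow hL1 (by norm_num)
  set m := ⌈20 * (A + 1)⌉₊ with hm
  have hYR : Z ≤ Y * R ^ m := by
    have h1 : L ^ (A + 1) ≤ R ^ m := by
      rw [hR, ← Real.rpow_natCast, ← Real.rpow_mul hL0.le]
      refine Real.rpow_le_rpow_of_exponent_le hL1 ?_
      have := Nat.le_ceil (20 * (A + 1))
      rw [← hm] at this
      linarith
    calc Z ≤ L * N ^ ((1 : ℝ) / 2) := by rw [hZd]; gcongr
      _ = Y * L ^ (A + 1) := by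
        rw [hYd, mul_assoc, ← Real.rpow_add hL0, neg_add_cancel_left, Real.rpow_one, mul_comm]
      _ ≤ _ := by gcongr
  have hsumW : ∑ n ∈ W, (n : ℝ)⁻¹ ≤ (m + 1) * R * D := by
    refine sum_inv_le_of_count hY0 hR1 hD0.le m W (fun n hn => ?_) fun X hX => ?_
    · rw [hW, Finset.mem_filter, hG Z hZ0] at hn
      exact ⟨hn.2, hn.1.1.2.trans hYR⟩
    · rcases lt_or_ge X Y with hXY | hXY
      · rw [Finset.card_eq_zero.2]
        · push_cast; positivity
        · refine Finset.filter_eq_empty_iff.2 fun n hn => ?_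
          rw [hW, Finset.mem_filter] at hn
          exact not_le.2 (hXY.trans_le hn.2)
      · have hmin : Y ≤ min X Z := le_min hXY hYZ
        calc _ ≤ ((G (min X Z)).card : ℝ) := by
              refine Nat.cast_le.2 (Finset.card_le_card fun n hn => ?_)
              rw [hW, Finset.mem_filter, Finset.mem_filter, hG Z hZ0] at hn
              exact (hG _ (hY0.trans_le hmin) n).2
                ⟨⟨hn.1.1.1.1, le_min hn.2 hn.1.1.1.2⟩, hn.1.1.2⟩
          _ ≤ D * min X Z := hGc _ hmin ((min_le_right _ _).trans hZN)
          _ ≤ D * X := by gcongr; exact min_le_left _ _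
  have hposG : ∀ n ∈ G Z, 0 < n := fun n hn => ((hG Z hZ0 n).1 hn).1.1
  refine (sum_quadruples_le (G Z) (G Z) W (Finset.Ioc 0 ⌊Z⌋₊) hposG hposG
    (fun n hn => hposG n (Finset.mem_filter.1 hn).1) (fun n hn => (Finset.mem_Ioc.1 hn).1)
    hK' S fun x hx => ?_).trans ?_
  · obtain ⟨p1, p2, p3, p4⟩ := hpos x hx
    obtain ⟨l1, l2, l3, l4⟩ := hle x hx
    have hs := hs x hx
    exact ⟨(hG Z hZ0 _).2 ⟨⟨p1, l1⟩, hs _ (by simp)⟩, (hG Z hZ0 _).2 ⟨⟨p2, l2⟩, hs _ (by simp)⟩,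
      Finset.mem_filter.2 ⟨(hG Z hZ0 _).2 ⟨⟨p3, l3⟩, hs _ (by simp)⟩, hY x hx⟩,
      Finset.mem_Ioc.2 ⟨p4, Nat.le_floor l4⟩, hS x hx⟩
  · have hGZ := hGc Z hYZ hZN
    calc _ ≤ K' * ((D * Z) * (D * Z)) * ((m + 1) * R * D) := by gcongr
      _ = K' * c ^ 3 * K ^ 2 * (m + 1) * (N * (L ^ (3 * (2 * ρ - 1) + 1 / 20))) := by
        have e1 : L ^ (3 * (2 * ρ - 1) + 1 / 20) = (L ^ (2 * ρ - 1)) ^ 3 * R := by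
          rw [hR, Real.rpow_add hL0, ← Real.rpow_natCast (L ^ (2 * ρ - 1)) 3,
            ← Real.rpow_mul hL0.le]
          push_cast
          ring_nf
        have e2 : N = N ^ ((1 : ℝ) / 2) * N ^ ((1 : ℝ) / 2) := by
          rw [← Real.rpow_add (by linarith)]; norm_num
        rw [e1, hD, hZd]
        nth_rw 3 [e2]
        ring
      _ ≤ _ := by
        gcongr
        linarith

lemma sum_exceptional_le (hA : 10 < A) (hρ0 : 0 < ρ) (hρ : ρ < 1 / 20) (hK : 1 ≤ K)
    (h : LargeParam A ρ K N) {K' : ℝ} (hK' : 1 ≤ K')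
    (S : Finset (ℕ × ℕ × ℕ × ℕ))
    (hpos : ∀ x ∈ S, 0 < x.1 ∧ 0 < x.2.1 ∧ 0 < x.2.2.1 ∧ 0 < x.2.2.2)
    (hle : ∀ x ∈ S, (x.1 : ℝ) ≤ K * N ^ ((1 : ℝ) / 2) ∧ (x.2.1 : ℝ) ≤ K * N ^ ((1 : ℝ) / 2) ∧
      (x.2.2.1 : ℝ) ≤ K * N ^ ((1 : ℝ) / 2) ∧ (x.2.2.2 : ℝ) ≤ K * N ^ ((1 : ℝ) / 2))
    (hS : ∀ x ∈ S, (x.2.2.1 : ℝ) * x.2.2.2 ≤ K' * (x.1 * x.2.1))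
    (hS' : ∀ x ∈ S, (x.1 : ℝ) * x.2.1 ≤ K' * (x.2.2.1 * x.2.2.2))
    (hexc : ∀ x ∈ S, (∀ n, n = x.1 ∨ n = x.2.1 ∨ n = x.2.2.1 →
        Sifted (Real.exp (Real.log N ^ ρ)) (Real.exp (Real.log N ^ (1 - ρ))) n) ∨
      ∃ n, (n = x.1 ∨ n = x.2.1 ∨ n = x.2.2.1 ∨ n = x.2.2.2) ∧
        (n : ℝ) < N ^ ((1 : ℝ) / 2) * Real.log N ^ (-A)) :
    ∑ x ∈ S, ((x.1 : ℝ) * x.2.1)⁻¹ ≤ excConst A K K' * (N * Real.log N ^ (-(2.5 : ℝ))) := by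
  classical
  have hN := h.one_lt
  have hL1 := h.one_le_log
  have hZN := h.mul_sqrt_le
  have hsieve := fun T => sum_sifted_le (S := T) (by linarith) hρ0 hρ hK h (zero_le_one.trans hK')
  set L := Real.log N with hL
  set Z := K * N ^ ((1 : ℝ) / 2) with hZd
  set Y := N ^ ((1 : ℝ) / 2) * L ^ (-A) with hYd
  have hL0 : 0 < L := by linarith
  have hY0 : 0 < Y := by positivity
  have hsqrt1 : 1 ≤ N ^ ((1 : ℝ) / 2) := Real.one_le_rpow hN.le (by norm_num)
  have hZ1 : 1 ≤ Z := one_le_mul_of_one_le_of_one_le hK hsqrt1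
  let w : ℕ × ℕ × ℕ × ℕ → ℝ := fun x => ((x.1 : ℝ) * x.2.1)⁻¹
  have hw : ∀ x, 0 ≤ w x := fun x => by positivity
  set S1 := S.filter fun x => (x.1 : ℝ) ≤ Y with hS1
  set S2 := S.filter fun x => (x.2.1 : ℝ) ≤ Y with hS2
  set S3 := S.filter fun x => (x.2.2.1 : ℝ) ≤ Y with hS3
  set S4 := S.filter fun x => (x.2.2.2 : ℝ) ≤ Y with hS4
  set S5 := S.filter fun x => Y ≤ (x.2.2.1 : ℝ) ∧ ∀ n, n = x.1 ∨ n = x.2.1 ∨ n = x.2.2.1 →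
        Sifted (Real.exp (L ^ ρ)) (Real.exp (L ^ (1 - ρ))) n with hS5
  have hun : ∀ T T' : Finset (ℕ × ℕ × ℕ × ℕ), ∑ x ∈ T ∪ T', w x ≤ ∑ x ∈ T, w x + ∑ x ∈ T', w x := by
    intro T T'
    rw [← Finset.sum_union_inter]
    linarith [Finset.sum_nonneg (s := T ∩ T') fun x _ => hw x]
  have hcover : S ⊆ S1 ∪ (S2 ∪ (S3 ∪ (S4 ∪ S5))) := by
    intro x hx
    simp only [hS1, hS2, hS3, hS4, hS5, Finset.mem_union, Finset.mem_filter, hx, true_and]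
    rcases le_total (x.2.2.1 : ℝ) Y with h3 | h3
    · exact Or.inr (Or.inr (Or.inl h3))
    · rcases hexc x hx with he | ⟨n, rfl | rfl | rfl | rfl, hn⟩
      · exact Or.inr (Or.inr (Or.inr (Or.inr ⟨h3, he⟩)))
      · exact Or.inl hn.le
      · exact Or.inr (Or.inl hn.le)
      · exact Or.inr (Or.inr (Or.inl hn.le))
      · exact Or.inr (Or.inr (Or.inr (Or.inl hn.le)))
  have hsub : ∀ (p : ℕ × ℕ × ℕ × ℕ → Prop), ∀ x ∈ S.filter p, x ∈ S := fun p x hx =>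
    (Finset.mem_filter.1 hx).1
  set B := K' * (Y * Z) * (1 + Real.log Z) with hB
  have b1 : ∑ x ∈ S1, w x ≤ B := sum_small_le hY0.le hZ1 (by linarith) S1
    (fun x hx => hpos x (hsub _ x hx)) (fun x hx => hle x (hsub _ x hx))
    (fun x hx => hS x (hsub _ x hx)) (Or.inl fun x hx => (Finset.mem_filter.1 hx).2)
  have b2 : ∑ x ∈ S2, w x ≤ B := sum_small_le hY0.le hZ1 (by linarith) S2
    (fun x hx => hpos x (hsub _ x hx)) (fun x hx => hle x (hsub _ x hx))
    (fun x hx => hS x (hsub _ x hx)) (Or.inr fun x hx => (Finset.mem_filter.1 hx).2)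
  have swap_bound : ∀ T ⊆ S, ((∀ x ∈ T, (x.2.2.1 : ℝ) ≤ Y) ∨ (∀ x ∈ T, (x.2.2.2 : ℝ) ≤ Y)) →
      ∑ x ∈ T, w x ≤ K' * B := by
    intro T hT hTY
    let σ : ℕ × ℕ × ℕ × ℕ → ℕ × ℕ × ℕ × ℕ := fun x => (x.2.2.1, x.2.2.2, x.1, x.2.1)
    have hσ : Function.Injective σ := by
      rintro ⟨a, b, c, d⟩ ⟨a', b', c', d'⟩ hab
      simp only [σ, Prod.mk.injEq] at hab ⊢
      tauto
    calc ∑ x ∈ T, w x ≤ ∑ x ∈ T, K' * w (σ x) := by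
          refine Finset.sum_le_sum fun x hx => ?_
          obtain ⟨p1, p2, p3, p4⟩ := hpos x (hT hx)
          have q1 : (0 : ℝ) < x.1 := by exact_mod_cast p1
          have q2 : (0 : ℝ) < x.2.1 := by exact_mod_cast p2
          have q3 : (0 : ℝ) < x.2.2.1 := by exact_mod_cast p3
          have q4 : (0 : ℝ) < x.2.2.2 := by exact_mod_cast p4
          change ((x.1 : ℝ) * x.2.1)⁻¹ ≤ K' * ((x.2.2.1 : ℝ) * x.2.2.2)⁻¹
          rw [← div_eq_mul_inv, le_div_iff₀ (by positivity), ← div_eq_inv_mul,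
            div_le_iff₀ (by positivity)]
          exact hS x (hT hx)
      _ = K' * ∑ x ∈ T.image σ, w x := by
          rw [Finset.sum_image hσ.injOn, Finset.mul_sum]
      _ ≤ K' * B := by
          refine mul_le_mul_of_nonneg_left ?_ (by linarith)
          refine sum_small_le hY0.le hZ1 (by linarith) _ ?_ ?_ ?_ ?_
          · intro y hy
            obtain ⟨x, hx, rfl⟩ := Finset.mem_image.1 hy
            obtain ⟨p1, p2, p3, p4⟩ := hpos x (hT hx)
            exact ⟨p3, p4, p1, p2⟩
          · intro y hy
            obtain ⟨x, hx, rfl⟩ := Finset.mem_image.1 hy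
            obtain ⟨p1, p2, p3, p4⟩ := hle x (hT hx)
            exact ⟨p3, p4, p1, p2⟩
          · intro y hy
            obtain ⟨x, hx, rfl⟩ := Finset.mem_image.1 hy
            exact hS' x (hT hx)
          · refine hTY.imp (fun hh y hy => ?_) (fun hh y hy => ?_)
            all_goals
              obtain ⟨x, hx, rfl⟩ := Finset.mem_image.1 hy
              exact hh x hx
  have b3 : ∑ x ∈ S3, w x ≤ K' * B := swap_bound S3 (Finset.filter_subset _ _)
    (Or.inl fun x hx => (Finset.mem_filter.1 hx).2)
  have b4 : ∑ x ∈ S4, w x ≤ K' * B := swap_bound S4 (Finset.filter_subset _ _)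
    (Or.inr fun x hx => (Finset.mem_filter.1 hx).2)
  have b5 : ∑ x ∈ S5, w x ≤ _ := hsieve S5
    (fun x hx => hpos x (Finset.mem_filter.1 hx).1) (fun x hx => hle x (Finset.mem_filter.1 hx).1)
    (fun x hx => hS x (Finset.mem_filter.1 hx).1) (fun x hx => (Finset.mem_filter.1 hx).2.1)
    (fun x hx => (Finset.mem_filter.1 hx).2.2)
  have hB0 : 0 ≤ B := by
    have := Real.log_nonneg hZ1
    positivity
  have hlogZ : Real.log Z ≤ L := Real.log_le_log (by linarith) hZN
  have hBle : B ≤ 2 * K' * K * (N * L ^ (-(2.5 : ℝ))) := by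
    have e2 : N = N ^ ((1 : ℝ) / 2) * N ^ ((1 : ℝ) / 2) := by
      rw [← Real.rpow_add (by linarith)]; norm_num
    calc B ≤ K' * (Y * Z) * (2 * L) := by rw [hB]; gcongr; linarith
      _ = 2 * K' * K * (N * L ^ (1 - A)) := by
        rw [hYd, hZd, sub_eq_add_neg, Real.rpow_add hL0, Real.rpow_one]
        nth_rw 3 [e2]
        ring
      _ ≤ _ := by
        gcongr
        linarith
  have h1 := Finset.sum_le_sum_of_subset_of_nonneg hcover fun x _ _ => hw x
  have h2 := hun S1 (S2 ∪ (S3 ∪ (S4 ∪ S5)))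
  have h3 := hun S2 (S3 ∪ (S4 ∪ S5))
  have h4 := hun S3 (S4 ∪ S5)
  have h5 := hun S4 S5
  have hBB : B ≤ K' * B := by nlinarith
  have hKB : K' * B ≤ K' * (2 * K' * K * (N * L ^ (-(2.5 : ℝ)))) := by gcongr
  calc ∑ x ∈ S, w x ≤ 4 * (K' * (2 * K' * K * (N * L ^ (-(2.5 : ℝ))))) + _ :=
        le_trans (by linarith) (add_le_add_right b5 _)
    _ = _ := by unfold excConst; ring

end counting

section measure

/-- The `α ∈ [a, b]` for which `α x₁ x₂` is within `δ` of `x₃ x₄`. -/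
def hitSet (a b δ : ℝ) (x : ℕ × ℕ × ℕ × ℕ) : Set ℝ :=
  {α ∈ Set.Icc a b | |α * (x.1 * x.2.1) - x.2.2.1 * x.2.2.2| ≤ δ}

lemma measurableSet_hitSet (a b δ : ℝ) (x : ℕ × ℕ × ℕ × ℕ) : MeasurableSet (hitSet a b δ x) := by
  have h : MeasurableSet {α : ℝ | |α * (x.1 * x.2.1) - x.2.2.1 * x.2.2.2| ≤ δ} :=
    measurableSet_le (by fun_prop) measurable_const
  exact measurableSet_Icc.inter h

lemma Rmeasure_le {a b : ℝ} (ha : 0 < a) {s : Set ℝ} (hs : s ⊆ Set.Icc a b)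
    (hm : MeasurableSet s) : Rmeasure s ≤ ENNReal.ofReal (1 / a) * volume s := by
  rw [Rmeasure, withDensity_apply _ hm]
  calc _ ≤ ∫⁻ _ in s, ENNReal.ofReal (1 / a) :=
        setLIntegral_mono' hm fun x hx =>
          ENNReal.ofReal_le_ofReal (one_div_le_one_div_of_le ha (hs hx).1)
    _ = _ := by rw [setLIntegral_const]

lemma Rmeasure_Icc_le {a b : ℝ} (ha : 0 < a) :
    Rmeasure (Set.Icc a b) ≤ ENNReal.ofReal (b / a) := by
  refine (Rmeasure_le ha subset_rfl measurableSet_Icc).trans ?_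
  rw [Real.volume_Icc, ← ENNReal.ofReal_mul (by positivity)]
  refine ENNReal.ofReal_le_ofReal ?_
  rw [div_mul_eq_mul_div, one_mul]
  gcongr
  linarith

lemma Rmeasure_hitSet_le {a b δ : ℝ} (ha : 0 < a) (x : ℕ × ℕ × ℕ × ℕ)
    (h1 : 0 < x.1) (h2 : 0 < x.2.1) :
    Rmeasure (hitSet a b δ x) ≤ ENNReal.ofReal (2 * δ / a * ((x.1 : ℝ) * x.2.1)⁻¹) := by
  have q1 : (0 : ℝ) < x.1 := by exact_mod_cast h1
  have q2 : (0 : ℝ) < x.2.1 := by exact_mod_cast h2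
  set u : ℝ := (x.1 : ℝ) * x.2.1 with hu
  set v : ℝ := (x.2.2.1 : ℝ) * x.2.2.2 with hv
  have hu0 : 0 < u := by positivity
  have hsub : hitSet a b δ x ⊆ Set.Icc ((v - δ) / u) ((v + δ) / u) := by
    rintro α ⟨_, hα⟩
    rw [← hu, ← hv, abs_le] at hα
    rw [Set.mem_Icc, div_le_iff₀ hu0, le_div_iff₀ hu0]
    constructor <;> linarith
  refine (Rmeasure_le ha (fun α hα => hα.1) (measurableSet_hitSet a b δ x)).trans ?_
  refine (mul_le_mul_right (measure_mono hsub) _).trans ?_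
  rw [Real.volume_Icc, ← ENNReal.ofReal_mul (by positivity)]
  refine ENNReal.ofReal_le_ofReal (le_of_eq ?_)
  field_simp
  ring

/-- Markov's inequality for a finite family of events. -/
lemma measure_count_ge_le {ι : Type*} (μ : Measure ℝ) (s : Finset ι) (E : ι → Set ℝ)
    (hE : ∀ i, MeasurableSet (E i)) {c : ℝ} (hc : 0 < c) {B : ℝ}
    (hB : ∑ i ∈ s, μ (E i) ≤ ENNReal.ofReal B) (G : Set ℝ)
    (hG : ∀ α ∈ G, ENNReal.ofReal c ≤ ∑ i ∈ s, (E i).indicator (fun _ => (1 : ENNReal)) α) :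
    μ G ≤ ENNReal.ofReal (B / c) := by
  have hm : ∀ i ∈ s, Measurable ((E i).indicator fun _ => (1 : ENNReal)) := fun i _ =>
    measurable_const.indicator (hE i)
  have h := meas_ge_le_lintegral_div (μ := μ) (Finset.measurable_sum s hm).aemeasurable
    (ENNReal.ofReal_pos.2 hc).ne' ENNReal.ofReal_ne_top
  refine (measure_mono fun α hα => ?_).trans (h.trans ?_)
  · simpa using hG α hα
  · rw [ENNReal.ofReal_div_of_pos hc]
    refine ENNReal.div_le_div_right (le_trans (le_of_eq ?_) hB) _
    rw [lintegral_finsetSum _ hm]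
    refine Finset.sum_congr rfl fun i _ => ?_
    rw [lintegral_indicator (hE i), setLIntegral_const, one_mul]

end measure

section exceptional

/-- Absolute values of the exceptional quadruples, without any condition involving `α`. -/
def Exceptional (ρ A N : ℝ) (x : ℕ × ℕ × ℕ × ℕ) : Prop :=
  (x.1 ≠ 0 ∨ x.2.2.1 ≠ 0) ∧ 0 < x.2.1 ∧ x.2.2.1 ≤ x.2.2.2 ∧
    ((∀ n, n = x.1 ∨ n = x.2.1 ∨ n = x.2.2.1 →
        Sifted (Real.exp (Real.log N ^ ρ)) (Real.exp (Real.log N ^ (1 - ρ))) n) ∨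
      ∃ n, (n = x.1 ∨ n = x.2.1 ∨ n = x.2.2.1 ∨ n = x.2.2.2) ∧
        (n : ℝ) < N ^ ((1 : ℝ) / 2) * Real.log N ^ (-A))

/-- The exceptional quadruples in a box. -/
noncomputable def excFinset (ρ A N Z : ℝ) : Finset (ℕ × ℕ × ℕ × ℕ) := by
  classical
  exact (Finset.range (⌊Z⌋₊ + 1) ×ˢ Finset.range (⌊Z⌋₊ + 1) ×ˢ Finset.range (⌊Z⌋₊ + 1) ×ˢ
    Finset.range (⌊Z⌋₊ + 1)).filter (Exceptional ρ A N)

lemma mem_excFinset {ρ A N Z : ℝ} (hZ : 0 ≤ Z) {x : ℕ × ℕ × ℕ × ℕ} :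
    x ∈ excFinset ρ A N Z ↔ ((x.1 : ℝ) ≤ Z ∧ (x.2.1 : ℝ) ≤ Z ∧ (x.2.2.1 : ℝ) ≤ Z ∧
      (x.2.2.2 : ℝ) ≤ Z) ∧ Exceptional ρ A N x := by
  simp only [excFinset, Finset.mem_filter, Finset.mem_product, Finset.mem_range,
    Nat.lt_succ_iff, Nat.le_floor_iff hZ]

lemma sifted_natAbs_of_not_memS {ρ N : ℝ} {t : ℤ} (h : ¬ memS ρ N t) :
    Sifted (Real.exp (Real.log N ^ ρ)) (Real.exp (Real.log N ^ (1 - ρ))) t.natAbs :=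
  fun p hp hd h1 h2 => h ⟨p, hp, Int.natCast_dvd.2 hd, h1, h2⟩

/-- The quadruple of absolute values. -/
def absQuad (t : Fin 4 → ℤ) : ℕ × ℕ × ℕ × ℕ :=
  ((t 0).natAbs, (t 1).natAbs, (t 2).natAbs, (t 3).natAbs)

lemma natCast_natAbs_real (t : ℤ) : ((t.natAbs : ℕ) : ℝ) = |(t : ℝ)| := by
  rw [Nat.cast_natAbs, Int.cast_abs]

lemma absQuad_mem {A ρ N Δ a b α : ℝ} (ha : 0 < a) (ha1 : a ≤ 1) (hα : α ∈ Set.Icc a b)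
    (hN : 0 ≤ N) (hΔ : 0 ≤ Δ) {t : Fin 4 → ℤ} (ht : t ∈ Tset α N Δ \ TsetGood ρ A α N Δ) :
    absQuad t ∈ excFinset ρ A N (Real.sqrt (16 * Real.sqrt b / a) * N ^ ((1 : ℝ) / 2)) ∧
      α ∈ hitSet a b (4 * Real.sqrt b * Δ) (absQuad t) ∧ 0 ≤ t 1 ∧ 0 ≤ t 3 := by
  obtain ⟨hT, hbad⟩ := ht
  obtain ⟨hne, _, _, h12, h34, hq1, hq2, hl, hu⟩ := id hT
  have hα0 : 0 < α := ha.trans_le hα.1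
  have hsq : Real.sqrt α ≤ Real.sqrt b := Real.sqrt_le_sqrt hα.2
  have hdiv : ∀ y : ℝ, 0 ≤ y → 4 * Real.sqrt α * y / Real.pi ≤ 4 * Real.sqrt b * y := by
    intro y hy
    refine (div_le_self (by positivity) ?_).trans (by gcongr)
    linarith [Real.pi_gt_three]
  have hN' := hdiv N hN
  have hΔ' := hdiv Δ hΔ
  have ht1 : 0 < t 1 := lt_of_le_of_lt (abs_nonneg _) h12
  have ht3 : 0 ≤ t 3 := (abs_nonneg _).trans h34
  set w := 4 * Real.sqrt b * N with hw
  have hw0 : 0 ≤ w := by positivity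
  have hb1 : α * ((t 0 : ℝ) ^ 2 + (t 1 : ℝ) ^ 2) + ((t 2 : ℝ) ^ 2 + (t 3 : ℝ) ^ 2) ≤ 4 * w := by
    nlinarith
  have hb2 : a * ((t 0 : ℝ) ^ 2 + (t 1 : ℝ) ^ 2 + ((t 2 : ℝ) ^ 2 + (t 3 : ℝ) ^ 2)) ≤ 4 * w := by
    have h1 : a * ((t 0 : ℝ) ^ 2 + (t 1 : ℝ) ^ 2) ≤ α * ((t 0 : ℝ) ^ 2 + (t 1 : ℝ) ^ 2) := by
      gcongr; exact hα.1
    have h2 : a * ((t 2 : ℝ) ^ 2 + (t 3 : ℝ) ^ 2) ≤ 1 * ((t 2 : ℝ) ^ 2 + (t 3 : ℝ) ^ 2) := by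
      gcongr
    linarith
  set Z := Real.sqrt (16 * Real.sqrt b / a) * N ^ ((1 : ℝ) / 2) with hZ
  have hZ0 : 0 ≤ Z := by positivity
  have hZ2 : Z ^ 2 = 4 * w / a := by
    rw [hZ, mul_pow, Real.sq_sqrt (by positivity), ← Real.sqrt_eq_rpow, Real.sq_sqrt hN, hw]
    ring
  have hle : ∀ y : ℝ, y ^ 2 ≤
      (t 0 : ℝ) ^ 2 + (t 1 : ℝ) ^ 2 + ((t 2 : ℝ) ^ 2 + (t 3 : ℝ) ^ 2) → |y| ≤ Z := by
    intro y hy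
    refine abs_le_of_sq_le_sq ?_ hZ0
    rw [hZ2, le_div_iff₀ ha]
    nlinarith
  refine ⟨(mem_excFinset hZ0).2 ⟨?_, ?_, ?_, ?_, ?_⟩, ⟨hα, ?_⟩, ht1.le, ht3⟩
  · simp only [absQuad, natCast_natAbs_real]
    refine ⟨hle _ ?_, hle _ ?_, hle _ ?_, hle _ ?_⟩ <;>
    linarith [sq_nonneg (t 0 : ℝ), sq_nonneg (t 1 : ℝ), sq_nonneg (t 2 : ℝ), sq_nonneg (t 3 : ℝ)]
  · simp only [absQuad, ne_eq, Int.natAbs_eq_zero]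
    by_contra! hc
    exact hne (by rw [hc.1, hc.2])
  · simpa only [absQuad, Int.natAbs_pos] using ht1.ne'
  · simp only [absQuad]
    rw [abs_le] at h34
    omega
  · by_cases hS : memS ρ N (t 0) ∨ memS ρ N (t 1) ∨ memS ρ N (t 2)
    · right
      have : ¬ ∀ i, N ^ ((1 : ℝ) / 2) * Real.log N ^ (-A) ≤ |(t i : ℝ)| := fun h =>
        hbad ⟨hT, hS, h⟩
      push Not at this
      obtain ⟨i, hi⟩ := this
      refine ⟨(t i).natAbs, ?_, by rwa [natCast_natAbs_real]⟩
      fin_cases i <;> simp [absQuad]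
    · left
      push Not at hS
      rintro n (rfl | rfl | rfl)
      exacts [sifted_natAbs_of_not_memS hS.1, sifted_natAbs_of_not_memS hS.2.1,
        sifted_natAbs_of_not_memS hS.2.2]
  · simp only [absQuad, natCast_natAbs_real]
    rw [← abs_mul, ← abs_mul]
    have e : α * |(t 0 : ℝ) * t 1| = |α * (t 0 : ℝ) * t 1| := by
      rw [mul_assoc, abs_mul α, abs_of_pos hα0]
    rw [e]
    refine (abs_abs_sub_abs_le_abs_sub _ _).trans ?_
    rw [abs_of_nonneg hl]
    linarith

lemma ncard_exceptional_le {A ρ N Δ a b α : ℝ} (ha : 0 < a) (ha1 : a ≤ 1)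
    (hα : α ∈ Set.Icc a b) (hN : 0 ≤ N) (hΔ : 0 ≤ Δ) :
    ENNReal.ofReal (((Tset α N Δ \ TsetGood ρ A α N Δ).ncard : ℝ) / 4) ≤
      ∑ x ∈ excFinset ρ A N (Real.sqrt (16 * Real.sqrt b / a) * N ^ ((1 : ℝ) / 2)),
        (hitSet a b (4 * Real.sqrt b * Δ) x).indicator (fun _ => (1 : ENNReal)) α := by
  classical
  set 𝓑 := excFinset ρ A N (Real.sqrt (16 * Real.sqrt b / a) * N ^ ((1 : ℝ) / 2))
  set E := hitSet a b (4 * Real.sqrt b * Δ)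
  set G := 𝓑.filter fun x => α ∈ E x with hG
  have hsum : ∑ x ∈ 𝓑, (E x).indicator (fun _ => (1 : ENNReal)) α = (G.card : ENNReal) := by
    rw [hG, Finset.card_filter]
    push_cast
    exact Finset.sum_congr rfl fun x _ => by rw [Set.indicator_apply]
  let Φ : (ℕ × ℕ × ℕ × ℕ) × SignType × SignType → Fin 4 → ℤ := fun y =>
    ![y.2.1 * y.1.1, y.1.2.1, y.2.2 * y.1.2.2.1, y.1.2.2.2]
  let sg : Finset SignType := {1, -1}
  have hsub : Tset α N Δ \ TsetGood ρ A α N Δ ⊆ ((G ×ˢ sg ×ˢ sg).image Φ : Finset _) := by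
    intro t ht
    obtain ⟨h1, h2, h3, h4⟩ := absQuad_mem ha ha1 hα hN hΔ ht
    have hsign : ∀ z : ℤ, ∃ s ∈ sg, (s : ℤ) * (z.natAbs : ℤ) = z := by
      intro z
      rcases le_total 0 z with hz | hz
      · exact ⟨1, by simp [sg], by simp [abs_of_nonneg hz]⟩
      · exact ⟨-1, by simp [sg], by simp [abs_of_nonpos hz]⟩
    obtain ⟨s, hs, hs'⟩ := hsign (t 0)
    obtain ⟨r, hr, hr'⟩ := hsign (t 2)
    rw [Finset.mem_coe, Finset.mem_image]
    refine ⟨(absQuad t, s, r), ?_, ?_⟩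
    · simp only [Finset.mem_product]
      exact ⟨Finset.mem_filter.2 ⟨h1, h2⟩, hs, hr⟩
    · funext i
      fin_cases i
      · exact hs'
      · exact Int.natAbs_of_nonneg h3
      · exact hr'
      · exact Int.natAbs_of_nonneg h4
  have hcard : (Tset α N Δ \ TsetGood ρ A α N Δ).ncard ≤ G.card * 4 := by
    have h1 := Set.ncard_le_ncard hsub (Finset.finite_toSet _)
    rw [Set.ncard_coe_finset] at h1
    refine h1.trans (Finset.card_image_le.trans ?_)
    rw [Finset.card_product, Finset.card_product]
    exact Nat.mul_le_mul_left _ (by decide)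
  rw [hsum, ← ENNReal.ofReal_natCast]
  refine ENNReal.ofReal_le_ofReal ?_
  rw [div_le_iff₀ (by norm_num)]
  exact_mod_cast hcard

end exceptional

section firstMoment

variable {A ρ N Δ a b Cd : ℝ}

lemma hitSet_nonempty_bounds {δ : ℝ} {x : ℕ × ℕ × ℕ × ℕ} (h : (hitSet a b δ x).Nonempty) :
    (x.2.2.1 : ℝ) * x.2.2.2 ≤ b * (x.1 * x.2.1) + δ ∧
      a * ((x.1 : ℝ) * x.2.1) ≤ x.2.2.1 * x.2.2.2 + δ := by
  obtain ⟨α, ⟨h1, h2⟩, h3⟩ := h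
  rw [abs_le] at h3
  have hu : (0 : ℝ) ≤ x.1 * x.2.1 := by positivity
  have := mul_le_mul_of_nonneg_right h1 hu
  have := mul_le_mul_of_nonneg_right h2 hu
  constructor <;> linarith

/-- Contribution of the quadruples with a vanishing coordinate. -/
lemma sum_Rmeasure_degenerate_le {δ D Z : ℝ} (ha : 0 < a) (ha1 : a ≤ 1) (hb : 1 ≤ b)
    (hδ : 0 ≤ δ) (hδD : δ ≤ D) (hZ : 0 ≤ Z) (S : Finset (ℕ × ℕ × ℕ × ℕ))
    (hS : ∀ x ∈ S, x ∈ excFinset ρ A N Z ∧ (hitSet a b δ x).Nonempty ∧ (x.1 = 0 ∨ x.2.2.1 = 0)) :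
    ∑ x ∈ S, Rmeasure (hitSet a b δ x) ≤
      ENNReal.ofReal (2 * (Z + 1) * (D / a + 1) ^ 2 * (b / a * (δ / a))) := by
  classical
  have hD : 0 ≤ D := hδ.trans hδD
  set h := ⌊D / a⌋₊ with hh
  have hfl : ∀ n m : ℕ, 0 < m → a * ((n : ℝ) * m) ≤ δ → n ∈ Finset.range (h + 1) := by
    intro n m hm hnm
    rw [Finset.mem_range, Nat.lt_succ_iff, hh, Nat.le_floor_iff (by positivity), le_div_iff₀ ha]
    have hm1 : (1 : ℝ) ≤ m := by exact_mod_cast hm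
    have : (n : ℝ) * 1 ≤ n * m := by gcongr
    nlinarith
  have hone : ∀ n m : ℕ, 0 < n → 0 < m → a * ((n : ℝ) * m) ≤ δ → 1 ≤ δ / a := by
    intro n m hn hm hnm
    have : (1 : ℝ) ≤ (n : ℝ) * m := by exact_mod_cast Nat.mul_pos hn hm
    rw [le_div_iff₀ ha]
    nlinarith
  set R := Finset.range (h + 1)
  set T := Finset.range (⌊Z⌋₊ + 1)
  have key : ∀ x ∈ S, 1 ≤ δ / a ∧ x ∈ ({0} ×ˢ T ×ˢ R ×ˢ R) ∪ (R ×ˢ R ×ˢ {0} ×ˢ T) := by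
    intro x hx
    obtain ⟨hx1, hx2, hx3⟩ := hS x hx
    obtain ⟨⟨_, hz2, _, hz4⟩, hne, hpos2, h34, _⟩ := (mem_excFinset hZ).1 hx1
    obtain ⟨hb1, hb2⟩ := hitSet_nonempty_bounds hx2
    have hT : ∀ n : ℕ, (n : ℝ) ≤ Z → n ∈ T := fun n hn => by
      rw [Finset.mem_range, Nat.lt_succ_iff, Nat.le_floor_iff hZ]
      exact hn
    by_cases h1 : x.1 = 0
    · have h3 : 0 < x.2.2.1 := by
        rcases hne with h | h
        · exact absurd h1 h
        · exact Nat.pos_of_ne_zero h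
      have h4 : 0 < x.2.2.2 := h3.trans_le h34
      have e : a * ((x.2.2.1 : ℝ) * x.2.2.2) ≤ δ := by
        simp only [h1, Nat.cast_zero, zero_mul, mul_zero, zero_add] at hb1
        have : (0 : ℝ) ≤ (x.2.2.1 : ℝ) * x.2.2.2 := by positivity
        nlinarith
      refine ⟨hone _ _ h3 h4 e, Finset.mem_union_left _ ?_⟩
      simp only [Finset.mem_product, Finset.mem_singleton]
      exact ⟨h1, hT _ hz2, hfl _ _ h4 e, hfl _ _ h3 (by rwa [mul_comm (x.2.2.2 : ℝ)])⟩
    · have h3 : x.2.2.1 = 0 := hx3.resolve_left h1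
      have h1' := Nat.pos_of_ne_zero h1
      simp only [h3, Nat.cast_zero, zero_mul, zero_add] at hb2
      refine ⟨hone _ _ h1' hpos2 hb2, Finset.mem_union_right _ ?_⟩
      simp only [Finset.mem_product, Finset.mem_singleton]
      exact ⟨hfl _ _ hpos2 hb2, hfl _ _ h1' (by rwa [mul_comm (x.2.1 : ℝ)]), h3, hT _ hz4⟩
  have hcard : (S.card : ℝ) ≤ 2 * (Z + 1) * (D / a + 1) ^ 2 := by
    have h1 : S.card ≤ 2 * (⌊Z⌋₊ + 1) * (h + 1) ^ 2 := by
      refine (Finset.card_le_card fun x hx => (key x hx).2).trans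
        ((Finset.card_union_le _ _).trans (le_of_eq ?_))
      simp only [Finset.card_product, Finset.card_singleton, T, R, Finset.card_range]
      ring
    calc (S.card : ℝ) ≤ 2 * ((⌊Z⌋₊ : ℝ) + 1) * ((h : ℝ) + 1) ^ 2 := by exact_mod_cast h1
      _ ≤ _ := by
        gcongr
        · exact Nat.floor_le hZ
        · exact Nat.floor_le (by positivity)
  calc ∑ x ∈ S, Rmeasure (hitSet a b δ x)
      ≤ ∑ _x ∈ S, ENNReal.ofReal (b / a * (δ / a)) := by
        refine Finset.sum_le_sum fun x hx => ?_
        refine (measure_mono fun α hα => hα.1).trans ((Rmeasure_Icc_le ha).trans ?_)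
        exact ENNReal.ofReal_le_ofReal (le_mul_of_one_le_right (by positivity) (key x hx).1)
    _ = ENNReal.ofReal (S.card * (b / a * (δ / a))) := by
        rw [Finset.sum_const, nsmul_eq_mul, ENNReal.ofReal_mul (Nat.cast_nonneg S.card),
          ENNReal.ofReal_natCast]
    _ ≤ _ := by
        refine ENNReal.ofReal_le_ofReal ?_
        gcongr

/-- Contribution of the quadruples without vanishing coordinate. -/
lemma sum_Rmeasure_nondegenerate_le {δ D K : ℝ} (hA : 10 < A) (hρ0 : 0 < ρ) (hρ : ρ < 1 / 20)
    (ha : 0 < a) (ha1 : a ≤ 1) (hb : 1 ≤ b) (hδ : 0 ≤ δ) (hδD : δ ≤ D) (hK : 1 ≤ K)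
    (hN : LargeParam A ρ K N) (S : Finset (ℕ × ℕ × ℕ × ℕ))
    (hS : ∀ x ∈ S, x ∈ excFinset ρ A N (K * N ^ ((1 : ℝ) / 2)) ∧ (hitSet a b δ x).Nonempty ∧
      0 < x.1 ∧ 0 < x.2.2.1) :
    ∑ x ∈ S, Rmeasure (hitSet a b δ x) ≤ ENNReal.ofReal
      (2 * δ / a * (excConst A K ((b + 1 + D) / a) * (N * Real.log N ^ (-(2.5 : ℝ))))) := by
  have hD : 0 ≤ D := hδ.trans hδD
  have hN0 : 0 < N := zero_lt_one.trans hN.one_lt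
  have hZ : 0 ≤ K * N ^ ((1 : ℝ) / 2) := by positivity
  have hpos : ∀ x ∈ S, 0 < x.1 ∧ 0 < x.2.1 ∧ 0 < x.2.2.1 ∧ 0 < x.2.2.2 := by
    intro x hx
    obtain ⟨h1, _, h2, h3⟩ := hS x hx
    obtain ⟨_, _, h4, h5, _⟩ := (mem_excFinset hZ).1 h1
    exact ⟨h2, h4, h3, h3.trans_le h5⟩
  have hge : ∀ x ∈ S, (1 : ℝ) ≤ x.1 * x.2.1 ∧ (1 : ℝ) ≤ x.2.2.1 * x.2.2.2 := by
    intro x hx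
    obtain ⟨h1, h2, h3, h4⟩ := hpos x hx
    exact ⟨by exact_mod_cast Nat.mul_pos h1 h2, by exact_mod_cast Nat.mul_pos h3 h4⟩
  have hmain : ∑ x ∈ S, ((x.1 : ℝ) * x.2.1)⁻¹ ≤
      excConst A K ((b + 1 + D) / a) * (N * Real.log N ^ (-(2.5 : ℝ))) := by
    refine sum_exceptional_le hA hρ0 hρ hK hN ?_ S hpos (fun x hx => ?_) (fun x hx => ?_)
      (fun x hx => ?_) (fun x hx => ?_)
    · rw [le_div_iff₀ ha]
      linarith
    · exact ((mem_excFinset hZ).1 (hS x hx).1).1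
    · obtain ⟨h1, _⟩ := hitSet_nonempty_bounds (hS x hx).2.1
      obtain ⟨h2, _⟩ := hge x hx
      set u : ℝ := (x.1 : ℝ) * x.2.1
      calc _ ≤ b * u + δ := h1
        _ ≤ (b + 1 + D) * u := by nlinarith
        _ ≤ _ := by
          gcongr
          exact le_div_self (by positivity) ha ha1
    · obtain ⟨_, h1⟩ := hitSet_nonempty_bounds (hS x hx).2.1
      obtain ⟨_, h2⟩ := hge x hx
      set v : ℝ := (x.2.2.1 : ℝ) * x.2.2.2
      rw [div_mul_eq_mul_div, le_div_iff₀ ha, mul_comm]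
      nlinarith
    · exact ((mem_excFinset hZ).1 (hS x hx).1).2.2.2.2
  calc ∑ x ∈ S, Rmeasure (hitSet a b δ x)
      ≤ ∑ x ∈ S, ENNReal.ofReal (2 * δ / a * ((x.1 : ℝ) * x.2.1)⁻¹) :=
        Finset.sum_le_sum fun x hx =>
          Rmeasure_hitSet_le ha x (hpos x hx).1 (hpos x hx).2.1
    _ = ENNReal.ofReal (2 * δ / a * ∑ x ∈ S, ((x.1 : ℝ) * x.2.1)⁻¹) := by
        rw [Finset.mul_sum, ENNReal.ofReal_sum_of_nonneg fun x _ => by positivity]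
    _ ≤ _ := by
        refine ENNReal.ofReal_le_ofReal ?_
        gcongr

/-- The constant in the first moment bound. -/
noncomputable def momentConst (A a b K D : ℝ) : ℝ :=
  2 / a * excConst A K ((b + 1 + D) / a) + 4 * K * (D / a + 1) ^ 2 * (b / a / a)

lemma sum_Rmeasure_le {δ D K : ℝ} (hA : 10 < A) (hρ0 : 0 < ρ) (hρ : ρ < 1 / 20)
    (ha : 0 < a) (ha1 : a ≤ 1) (hb : 1 ≤ b) (hδ : 0 ≤ δ) (hδD : δ ≤ D) (hK : 1 ≤ K)
    (hN : LargeParam A ρ K N) :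
    ∑ x ∈ excFinset ρ A N (K * N ^ ((1 : ℝ) / 2)), Rmeasure (hitSet a b δ x) ≤ ENNReal.ofReal
      (momentConst A a b K D * δ * (N * Real.log N ^ (-(2.5 : ℝ)))) := by
  classical
  have hD : 0 ≤ D := hδ.trans hδD
  have hN0 : 0 < N := zero_lt_one.trans hN.one_lt
  have hL : 0 < Real.log N := zero_lt_one.trans_le hN.one_le_log
  set Z := K * N ^ ((1 : ℝ) / 2) with hZ
  set M := N * Real.log N ^ (-(2.5 : ℝ)) with hM
  have hZ0 : 0 ≤ Z := by positivity
  have hZM : Z + 1 ≤ 2 * K * M := by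
    have h1 : 1 ≤ N ^ ((1 : ℝ) / 2) := Real.one_le_rpow hN.one_lt.le (by norm_num)
    have h2 : N ^ ((1 : ℝ) / 2) ≤ M := by
      rw [hM, Real.rpow_neg hL.le, ← div_eq_mul_inv, le_div_iff₀ (by positivity)]
      calc _ ≤ N ^ ((1 : ℝ) / 2) * N ^ ((1 : ℝ) / 2) := by
            gcongr
            exact hN.log_rpow_le
        _ = N := by rw [← Real.rpow_add hN0]; norm_num
    nlinarith
  set S := (excFinset ρ A N Z).filter fun x => (hitSet a b δ x).Nonempty
  have hsplit : ∑ x ∈ excFinset ρ A N Z, Rmeasure (hitSet a b δ x) =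
      ∑ x ∈ S, Rmeasure (hitSet a b δ x) := by
    refine (Finset.sum_filter_of_ne fun x _ hx => ?_).symm
    by_contra hne
    rw [Set.not_nonempty_iff_eq_empty] at hne
    exact hx (by rw [hne, measure_empty])
  rw [hsplit, ← Finset.sum_filter_add_sum_filter_not S fun x => 0 < x.1 ∧ 0 < x.2.2.1]
  have h1 := sum_Rmeasure_nondegenerate_le hA hρ0 hρ ha ha1 hb hδ hδD hK hN
    (S.filter fun x => 0 < x.1 ∧ 0 < x.2.2.1) fun x hx => by
      obtain ⟨h1, h2⟩ := Finset.mem_filter.1 hx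
      obtain ⟨h3, h4⟩ := Finset.mem_filter.1 h1
      exact ⟨h3, h4, h2⟩
  have h2 := sum_Rmeasure_degenerate_le ha ha1 hb hδ hδD hZ0
    (S.filter fun x => ¬ (0 < x.1 ∧ 0 < x.2.2.1)) fun x hx => by
      obtain ⟨h1, h2⟩ := Finset.mem_filter.1 hx
      obtain ⟨h3, h4⟩ := Finset.mem_filter.1 h1
      exact ⟨h3, h4, by omega⟩
  have hE : 0 ≤ excConst A K ((b + 1 + D) / a) := by
    unfold excConst
    positivity
  refine (add_le_add h1 h2).trans ?_
  rw [← ENNReal.ofReal_add (by positivity) (by positivity)]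
  refine ENNReal.ofReal_le_ofReal ?_
  calc _ ≤ 2 * δ / a * (excConst A K ((b + 1 + D) / a) * M) +
        2 * (2 * K * M) * (D / a + 1) ^ 2 * (b / a * (δ / a)) := by gcongr
    _ = _ := by
      rw [momentConst]
      ring

/-- The bound of `prop4` for large `N`. -/
lemma Rmeasure_exceptional_le (hA : 10 < A) (hρ0 : 0 < ρ) (hρ : ρ < 1 / 20)
    (ha : 0 < a) (ha1 : a ≤ 1) (hb : 1 ≤ b) (hΔ : 0 < Δ) (hΔC : Δ ≤ Cd)
    (hN : LargeParam A ρ (Real.sqrt (16 * Real.sqrt b / a)) N) :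
    Rmeasure {α ∈ Set.Icc a b | Δ * N / 2 ≤ ((Tset α N Δ \ TsetGood ρ A α N Δ).ncard : ℝ)} ≤
      ENNReal.ofReal (32 * Real.sqrt b *
        momentConst A a b (Real.sqrt (16 * Real.sqrt b / a)) (4 * Real.sqrt b * Cd) *
          Real.log N ^ (-(2.5 : ℝ))) := by
  have hN0 : 0 < N := zero_lt_one.trans hN.one_lt
  have hb' : 1 ≤ Real.sqrt b := Real.one_le_sqrt.2 hb
  have hK : 1 ≤ Real.sqrt (16 * Real.sqrt b / a) := by
    rw [Real.one_le_sqrt, le_div_iff₀ ha]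
    linarith
  have hδD : 4 * Real.sqrt b * Δ ≤ 4 * Real.sqrt b * Cd := by gcongr
  have h := measure_count_ge_le Rmeasure _ (hitSet a b (4 * Real.sqrt b * Δ))
    (measurableSet_hitSet a b _) (c := Δ * N / 8) (by positivity)
    (sum_Rmeasure_le hA hρ0 hρ ha ha1 hb (by positivity) hδD hK hN)
    {α ∈ Set.Icc a b | Δ * N / 2 ≤ ((Tset α N Δ \ TsetGood ρ A α N Δ).ncard : ℝ)} fun α hα =>
      le_trans (ENNReal.ofReal_le_ofReal ?_) (ncard_exceptional_le ha ha1 hα.1 hN0.le hΔ.le)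
  · refine h.trans (ENNReal.ofReal_le_ofReal (le_of_eq ?_))
    field_simp
    ring
  · linarith [hα.2]

end firstMoment

/-- **Proposition 4.** For `A > 10`, `0 < ρ < 1/20`, compact `ℛ₀ ⊂ ℝ_{>0}`, uniformly for
`N^{-1+η} ≤ Δ ≪ 1`, the measure of the set of `α ∈ ℛ₀` with
`#(𝒯_α(N,Δ) \ 𝒯^{ρ,A}_α(N,Δ)) ≥ ΔN/2` is `≪ (log N)^{-2.5}`. -/
theorem prop4 (A ρ η Cd : ℝ) (hA : 10 < A) (hρ0 : 0 < ρ) (hρ : ρ < 1 / 20) (hη : 0 < η)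
    (hCd : 0 < Cd) (R₀ : Set ℝ) (hR₀c : IsCompact R₀) (hR₀ : R₀ ⊆ Set.Ioi 0) :
    ∃ C : ℝ, 0 < C ∧ ∀ N Δ : ℝ, 3 ≤ N → N ^ (-1 + η) ≤ Δ → Δ ≤ Cd →
      Rmeasure {α ∈ R₀ |
          Δ * N / 2 ≤ ((Tset α N Δ \ TsetGood ρ A α N Δ).ncard : ℝ)}
        ≤ ENNReal.ofReal (C * Real.log N ^ (-(2.5 : ℝ))) := by
  obtain ⟨a, b, ha, ha1, hb, hab⟩ :
      ∃ a b : ℝ, 0 < a ∧ a ≤ 1 ∧ 1 ≤ b ∧ R₀ ⊆ Set.Icc a b := by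
    rcases R₀.eq_empty_or_nonempty with rfl | hne
    · exact ⟨1, 1, one_pos, le_rfl, le_rfl, Set.empty_subset _⟩
    · obtain ⟨l, hl, hl'⟩ := hR₀c.exists_isLeast hne
      obtain ⟨u, _, hu'⟩ := hR₀c.exists_isGreatest hne
      exact ⟨min l 1, max u 1, lt_min (hR₀ hl) one_pos, min_le_right _ _, le_max_right _ _,
        fun x hx => ⟨(min_le_left _ _).trans (hl' hx), (hu' hx).trans (le_max_left _ _)⟩⟩
  obtain ⟨N₀, hN₀⟩ := Filter.eventually_atTop.1
    (eventually_largeParam A (Real.sqrt (16 * Real.sqrt b / a)) hρ0)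
  set C₁ := 32 * Real.sqrt b *
    momentConst A a b (Real.sqrt (16 * Real.sqrt b / a)) (4 * Real.sqrt b * Cd)
  set L₀ := Real.log (max N₀ 3) with hL₀
  have hL₀' : 0 < L₀ := Real.log_pos (by linarith [le_max_right N₀ 3])
  set C₂ := b / a * L₀ ^ (2.5 : ℝ)
  have hC₂ : 0 < C₂ := by positivity
  refine ⟨max C₁ C₂, lt_max_of_lt_right hC₂, fun N Δ hN hΔ hΔC => ?_⟩
  have hN0 : 0 < N := by linarith
  have hL : 0 < Real.log N := Real.log_pos (by linarith)
  refine (measure_mono (t := {α ∈ Set.Icc a b |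
    Δ * N / 2 ≤ ((Tset α N Δ \ TsetGood ρ A α N Δ).ncard : ℝ)})
    fun α hα => ⟨hab hα.1, hα.2⟩).trans ?_
  rcases le_total N₀ N with hlarge | hsmall
  · have hΔ0 : 0 < Δ := (Real.rpow_pos_of_pos hN0 _).trans_le hΔ
    refine (Rmeasure_exceptional_le hA hρ0 hρ ha ha1 hb hΔ0
      hΔC (hN₀ N hlarge)).trans (ENNReal.ofReal_le_ofReal ?_)
    gcongr
    exact le_max_left _ _
  · refine (measure_mono fun α hα => hα.1).trans ((Rmeasure_Icc_le ha).trans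
      (ENNReal.ofReal_le_ofReal ?_))
    have hle : Real.log N ≤ L₀ := Real.log_le_log hN0 (hsmall.trans (le_max_left _ _))
    calc b / a = b / a * (Real.log N ^ (2.5 : ℝ) * Real.log N ^ (-(2.5 : ℝ))) := by
          rw [← Real.rpow_add hL]
          simp
      _ ≤ b / a * (L₀ ^ (2.5 : ℝ) * Real.log N ^ (-(2.5 : ℝ))) := by gcongr
      _ = C₂ * Real.log N ^ (-(2.5 : ℝ)) := by ring
      _ ≤ _ := by
        gcongr
        exact le_max_right _ _
end

section
/- Fix A > 4, η > 0, a constant C ≥ 1, and a compact subset ℛ₀ ⊂ ℝ_{>0}. For α ∈ ℛ₀ let 𝒯₁(α) be the number of integer quadruples (t₁,t₂,t₃,t₄) with (t₁,t₃) ≠ (0,0), t₂ > |t₁|, t₄ ≥ |t₃|, α((t₁±t₂)/2)² + ((t₃±t₄)/2)² ≤ CN for both choices of sign, 0 ≤ αt₁t₂ − t₃t₄ ≤ CΔ, and min(|t₁|,|t₂|,|t₃|,|t₄|) ≤ N^{1/2}(log N)^{−A}. Then, uniformly for N^{−1+η} ≤ Δ ≪ 1, the measure (with respect to dα/α) of the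 set of α ∈ ℛ₀ with 𝒯₁(α) > ΔN/2 is ≪ (log N)^{4−A}, with implied constant depending only on A, η, C and ℛ₀. -/
open MeasureTheory

noncomputable section

/-- The set of integer quadruples counted by `𝒯₁(α)`: `(t₁,t₃) ≠ (0,0)`, `t₂ > |t₁|`,
`t₄ ≥ |t₃|`, `α((t₁±t₂)/2)² + ((t₃±t₄)/2)² ≤ CN` for both signs,
`0 ≤ αt₁t₂ - t₃t₄ ≤ CΔ`, and `min(|t₁|,…,|t₄|) ≤ N^{1/2}(log N)^{-A}`. -/
def T1set (Cc A α N Δ : ℝ) : Set (Fin 4 → ℤ) :=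
  {t | (t 0, t 2) ≠ ((0 : ℤ), (0 : ℤ)) ∧ |t 0| < t 1 ∧ |t 2| ≤ t 3 ∧
    α * (((t 0 : ℝ) + (t 1 : ℝ)) / 2) ^ 2 + (((t 2 : ℝ) + (t 3 : ℝ)) / 2) ^ 2 ≤ Cc * N ∧
    α * (((t 0 : ℝ) - (t 1 : ℝ)) / 2) ^ 2 + (((t 2 : ℝ) - (t 3 : ℝ)) / 2) ^ 2 ≤ Cc * N ∧
    0 ≤ α * (t 0 : ℝ) * (t 1 : ℝ) - (t 2 : ℝ) * (t 3 : ℝ) ∧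
    α * (t 0 : ℝ) * (t 1 : ℝ) - (t 2 : ℝ) * (t 3 : ℝ) ≤ Cc * Δ ∧
    ∃ i, |(t i : ℝ)| ≤ N ^ ((1 : ℝ) / 2) * Real.log N ^ (-A)}

end

/-- A finite set contains at most `2 * D` nonzero integers of absolute value at most `D`. -/
lemma sum_ite_ne_zero_abs_le (s : Finset ℤ) {D : ℝ} (hD : 0 ≤ D) :
    ∑ x ∈ s, (if x ≠ 0 ∧ |(x : ℝ)| ≤ D then (1 : ℝ) else 0) ≤ 2 * D := by
  rw [Finset.sum_boole]
  have hsub : s.filter (fun x : ℤ => x ≠ 0 ∧ |(x : ℝ)| ≤ D) ⊆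
      (Finset.Icc (-(⌊D⌋₊ : ℤ)) ⌊D⌋₊).erase 0 := by
    intro x hx
    obtain ⟨-, h0, hx⟩ := Finset.mem_filter.1 hx
    refine Finset.mem_erase.2 ⟨h0, ?_⟩
    have h1 : ((x.natAbs : ℕ) : ℝ) ≤ D := by rwa [Nat.cast_natAbs, Int.cast_abs]
    have h2 := Nat.le_floor h1
    rw [Finset.mem_Icc]
    omega
  have hcard := Finset.card_le_card hsub
  rw [Finset.card_erase_of_mem (by simp), Int.card_Icc] at hcard
  have hle : (s.filter (fun x : ℤ => x ≠ 0 ∧ |(x : ℝ)| ≤ D)).card ≤ 2 * ⌊D⌋₊ := by omega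
  calc _ ≤ ((2 * ⌊D⌋₊ : ℕ) : ℝ) := by exact_mod_cast hle
    _ ≤ 2 * D := by push_cast; linarith [Nat.floor_le hD]

lemma sum_Icc_inv_abs (n : ℕ) :
    ∑ x ∈ Finset.Icc (-(n : ℤ)) n, |(x : ℝ)|⁻¹ = 2 * (harmonic n : ℝ) := by
  induction n with
  | zero => simp
  | succ n ih =>
    have h : Finset.Icc (-((n + 1 : ℕ) : ℤ)) ((n + 1 : ℕ) : ℤ) =
        insert (-((n : ℤ) + 1)) (insert ((n : ℤ) + 1) (Finset.Icc (-(n : ℤ)) n)) := by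
      ext x
      simp only [Finset.mem_Icc, Finset.mem_insert]
      omega
    rw [h, Finset.sum_insert, Finset.sum_insert, ih, harmonic_succ]
    · have : |(n : ℝ) + 1| = n + 1 := abs_of_nonneg (by positivity)
      push_cast
      rw [abs_neg, this]
      ring
    · simp
    · simp only [Finset.mem_Icc, Finset.mem_insert]
      omega

noncomputable section

/-- Indicator of `p = (0, y)` and `r = (z, w)` with `z`, `w` nonzero of size at most `D`. -/
def axisWeight (D : ℝ) (p r : ℤ × ℤ) : ℝ :=
  if p.1 = 0 ∧ (r.1 ≠ 0 ∧ |(r.1 : ℝ)| ≤ D) ∧ (r.2 ≠ 0 ∧ |(r.2 : ℝ)| ≤ D) then 1 else 0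

/-- The weight `1 / |p.1 * p.2|` on quadruples of nonzero integers with `|p.1| ≤ M` and
`|r.1 * r.2| ≤ Q * |p.1 * p.2|`. -/
def hyperbolaWeight (M Q : ℝ) (p r : ℤ × ℤ) : ℝ :=
  if (p.1 ≠ 0 ∧ |(p.1 : ℝ)| ≤ M) ∧ p.2 ≠ 0 ∧ r.1 ≠ 0 ∧ r.2 ≠ 0 ∧
    |(r.1 : ℝ) * r.2| ≤ Q * |(p.1 : ℝ) * p.2| then |(p.1 : ℝ) * p.2|⁻¹ else 0

/-- The pairs of integers of size at most `n`. -/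
def pairBox (n : ℕ) : Finset (ℤ × ℤ) :=
  Finset.Icc (-(n : ℤ)) n ×ˢ Finset.Icc (-(n : ℤ)) n

/-- A pair of pairs of integers as a quadruple. -/
def quadOfPairs (x : (ℤ × ℤ) × (ℤ × ℤ)) : Fin 4 → ℤ := ![x.1.1, x.1.2, x.2.1, x.2.2]

end

lemma axisWeight_nonneg (D : ℝ) (p r : ℤ × ℤ) : 0 ≤ axisWeight D p r := by
  unfold axisWeight; split_ifs <;> norm_num

lemma hyperbolaWeight_nonneg (M Q : ℝ) (p r : ℤ × ℤ) : 0 ≤ hyperbolaWeight M Q p r := by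
  unfold hyperbolaWeight; split_ifs <;> positivity

lemma sum_axisWeight_le (n : ℕ) {D : ℝ} (hD : 0 ≤ D) :
    ∑ p ∈ pairBox n, ∑ r ∈ pairBox n, axisWeight D p r ≤ (2 * n + 1) * (2 * D) ^ 2 := by
  set I := Finset.Icc (-(n : ℤ)) n with hI
  have hinner (p : ℤ × ℤ) : ∑ r ∈ pairBox n, axisWeight D p r ≤
      (if p.1 = 0 then 1 else 0) * (2 * D) ^ 2 := by
    have h : ∀ r : ℤ × ℤ, axisWeight D p r = (if p.1 = 0 then 1 else 0) *
        ((if r.1 ≠ 0 ∧ |(r.1 : ℝ)| ≤ D then 1 else 0) *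
          (if r.2 ≠ 0 ∧ |(r.2 : ℝ)| ≤ D then 1 else 0)) := by
      intro r
      simp only [axisWeight, ite_and, mul_ite, mul_one, mul_zero]
      split_ifs <;> rfl
    simp_rw [h]
    rw [← Finset.mul_sum, pairBox, Finset.sum_product, sq]
    set g := fun x : ℤ => if x ≠ 0 ∧ |(x : ℝ)| ≤ D then (1 : ℝ) else 0
    refine (congrArg _ (Finset.sum_mul_sum I I g g).symm).trans_le ?_
    have h1 := sum_ite_ne_zero_abs_le I hD
    refine mul_le_mul_of_nonneg_left (mul_le_mul h1 h1 ?_ (by positivity)) ?_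
    · exact Finset.sum_nonneg fun _ _ => by dsimp only [g]; split_ifs <;> norm_num
    · split_ifs <;> norm_num
  refine (Finset.sum_le_sum fun p _ => hinner p).trans ?_
  rw [← Finset.sum_mul]
  refine mul_le_mul_of_nonneg_right (le_of_eq ?_) (by positivity)
  rw [pairBox, Finset.sum_product_right]
  simp
  rw [show ((n : ℤ) + 1 + n).toNat = 2 * n + 1 by omega]
  push_cast
  ring

lemma sum_hyperbolaWeight_le (n : ℕ) {M Q : ℝ} (hM : 0 ≤ M) (hQ : 0 ≤ Q) :
    ∑ p ∈ pairBox n, ∑ r ∈ pairBox n, hyperbolaWeight M Q p r ≤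
      (2 * M) * (2 * n + 1) * (2 * Q * (2 * (1 + Real.log n))) := by
  set I := Finset.Icc (-(n : ℤ)) n with hI
  have hinner (p : ℤ × ℤ) (z : ℤ) : ∑ w ∈ I, hyperbolaWeight M Q p (z, w) ≤
      (if p.1 ≠ 0 ∧ |(p.1 : ℝ)| ≤ M then 1 else 0) * (2 * Q * |(z : ℝ)|⁻¹) := by
    by_cases hp : (p.1 ≠ 0 ∧ |(p.1 : ℝ)| ≤ M) ∧ p.2 ≠ 0 ∧ z ≠ 0
    · obtain ⟨hp1, hp2, hz⟩ := hp
      have hu : 0 < |(p.1 : ℝ) * p.2| := by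
        have := hp1.1
        positivity
      have hz' : 0 < |(z : ℝ)| := by positivity
      rw [if_pos hp1, one_mul]
      have h : ∀ w : ℤ, hyperbolaWeight M Q p (z, w) =
          |(p.1 : ℝ) * p.2|⁻¹ *
            (if w ≠ 0 ∧ |(w : ℝ)| ≤ Q * |(p.1 : ℝ) * p.2| / |(z : ℝ)| then 1 else 0) := by
        intro w
        have : |(z : ℝ) * w| ≤ Q * |(p.1 : ℝ) * p.2| ↔
            |(w : ℝ)| ≤ Q * |(p.1 : ℝ) * p.2| / |(z : ℝ)| := by
          rw [le_div_iff₀ hz', abs_mul, mul_comm]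
        simp only [hyperbolaWeight, hp1, hp2, hz, this, true_and, ne_eq, not_false_eq_true,
          mul_ite, mul_one, mul_zero, and_self]
      simp_rw [h]
      rw [← Finset.mul_sum]
      refine (mul_le_mul_of_nonneg_left (sum_ite_ne_zero_abs_le I (by positivity))
        (by positivity)).trans (le_of_eq ?_)
      field_simp
    · rw [Finset.sum_eq_zero]
      · split_ifs <;> positivity
      · intro w _
        unfold hyperbolaWeight
        rw [if_neg]
        tauto
  have hharm : ∑ z ∈ I, |(z : ℝ)|⁻¹ ≤ 2 * (1 + Real.log n) := by
    rw [sum_Icc_inv_abs]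
    linarith [harmonic_le_one_add_log n]
  have hmid (p : ℤ × ℤ) : ∑ r ∈ pairBox n, hyperbolaWeight M Q p r ≤
      (if p.1 ≠ 0 ∧ |(p.1 : ℝ)| ≤ M then 1 else 0) * (2 * Q * (2 * (1 + Real.log n))) := by
    rw [pairBox, Finset.sum_product]
    refine (Finset.sum_le_sum fun z _ => hinner p z).trans ?_
    rw [← Finset.mul_sum, ← Finset.mul_sum]
    refine mul_le_mul_of_nonneg_left (mul_le_mul_of_nonneg_left hharm (by positivity)) ?_
    split_ifs <;> norm_num
  refine (Finset.sum_le_sum fun p _ => hmid p).trans ?_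
  rw [← Finset.sum_mul]
  have hlog : 0 ≤ Real.log n := Real.log_natCast_nonneg n
  refine mul_le_mul_of_nonneg_right ?_ (by positivity)
  rw [pairBox, Finset.sum_product_right]
  have hc : ((Finset.Icc (-(n : ℤ)) n).card : ℝ) = 2 * n + 1 := by
    rw [Int.card_Icc, show ((n : ℤ) + 1 - -n).toNat = 2 * n + 1 by omega]
    push_cast
    ring
  refine (Finset.sum_le_card_nsmul _ _ (2 * M) fun _ _ => sum_ite_ne_zero_abs_le _ hM).trans ?_
  rw [nsmul_eq_mul, hc, mul_comm]

/-- The members of `T1set` have size `O(√N)`. -/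
lemma abs_le_of_mem_T1set {R Cc A α N Δ : ℝ} (hCc : 1 ≤ Cc) (hR : 1 ≤ R) (hN : 0 ≤ N)
    (hα : α ∈ Set.Icc R⁻¹ R) {t : Fin 4 → ℤ} (ht : t ∈ T1set Cc A α N Δ) (i : Fin 4) :
    |(t i : ℝ)| ≤ 4 * Cc * R * √N := by
  obtain ⟨-, h1, h2, h3, h4, -⟩ := ht
  have h1' : |(t 0 : ℝ)| ≤ t 1 := by exact_mod_cast h1.le
  have h2' : |(t 2 : ℝ)| ≤ t 3 := by exact_mod_cast h2
  have hR0 : 0 < R := by linarith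
  have hαR : 1 ≤ α * R := by
    have := mul_le_mul_of_nonneg_right hα.1 hR0.le
    rwa [inv_mul_cancel₀ hR0.ne'] at this
  have hα0 : 0 < α := lt_of_lt_of_le (by positivity) hα.1
  have hsum : α * ((t 0 : ℝ) ^ 2 + (t 1 : ℝ) ^ 2) + ((t 2 : ℝ) ^ 2 + (t 3 : ℝ) ^ 2)
      ≤ 4 * Cc * N := by linarith
  have hCR : 1 ≤ 4 * Cc * R := by nlinarith
  have hB : (4 * Cc * R * √N) ^ 2 = (4 * Cc * R) ^ 2 * N := by
    rw [mul_pow, Real.sq_sqrt hN]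
  have hbig : 4 * Cc * N * R ≤ (4 * Cc * R * √N) ^ 2 := by
    rw [hB]
    have : 4 * Cc * R * 1 ≤ 4 * Cc * R * (4 * Cc * R) :=
      mul_le_mul_of_nonneg_left hCR (by positivity)
    nlinarith
  have hb1 : |(t 1 : ℝ)| ≤ 4 * Cc * R * √N := by
    refine abs_le_of_sq_le_sq (le_trans ?_ hbig) (by positivity)
    have e1 : α * (t 1 : ℝ) ^ 2 ≤ 4 * Cc * N := by
      nlinarith [sq_nonneg (t 2 : ℝ), sq_nonneg (t 3 : ℝ), mul_nonneg hα0.le (sq_nonneg (t 0 : ℝ))]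
    have e2 := mul_le_mul_of_nonneg_right e1 hR0.le
    have e3 := mul_le_mul_of_nonneg_right hαR (sq_nonneg (t 1 : ℝ))
    linarith
  have hb3 : |(t 3 : ℝ)| ≤ 4 * Cc * R * √N := by
    refine abs_le_of_sq_le_sq (le_trans ?_ hbig) (by positivity)
    have e1 : (t 3 : ℝ) ^ 2 ≤ 4 * Cc * N := by
      nlinarith [sq_nonneg (t 2 : ℝ),
              mul_nonneg hα0.le (sq_nonneg (t 0 : ℝ)), mul_nonneg hα0.le (sq_nonneg (t 1 : ℝ))]
    have e2 := mul_le_mul_of_nonneg_left hR (show 0 ≤ 4 * Cc * N by positivity)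
    linarith
  fin_cases i
  · exact h1'.trans ((le_abs_self _).trans hb1)
  · exact hb1
  · exact h2'.trans ((le_abs_self _).trans hb3)
  · exact hb3

/-- A member of `T1set` with a vanishing coordinate has a pair of coordinates of size `O(Δ)`;
otherwise `|t₁ t₂|` and `|t₃ t₄|` are comparable and one of `t₁`, `t₃` is small. -/
lemma trichotomy_of_mem_T1set {R Cc A α N Δ Cd : ℝ} (hCc : 1 ≤ Cc) (hR : 1 ≤ R) (hΔ : 0 ≤ Δ)
    (hΔd : Δ ≤ Cd) (hα : α ∈ Set.Icc R⁻¹ R) {t : Fin 4 → ℤ} (ht : t ∈ T1set Cc A α N Δ) :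
    (t 0 = 0 ∧ (t 2 ≠ 0 ∧ |(t 2 : ℝ)| ≤ R * Cc * Δ) ∧ (t 3 ≠ 0 ∧ |(t 3 : ℝ)| ≤ R * Cc * Δ)) ∨
    (t 2 = 0 ∧ (t 0 ≠ 0 ∧ |(t 0 : ℝ)| ≤ R * Cc * Δ) ∧ (t 1 ≠ 0 ∧ |(t 1 : ℝ)| ≤ R * Cc * Δ)) ∨
    (t 0 ≠ 0 ∧ t 1 ≠ 0 ∧ t 2 ≠ 0 ∧ t 3 ≠ 0 ∧
      |(t 2 : ℝ) * t 3| ≤ R * (1 + Cc * Cd) * |(t 0 : ℝ) * t 1| ∧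
      |(t 0 : ℝ) * t 1| ≤ R * (1 + Cc * Cd) * |(t 2 : ℝ) * t 3| ∧
      (|(t 0 : ℝ)| ≤ N ^ ((1 : ℝ) / 2) * Real.log N ^ (-A) ∨
        |(t 2 : ℝ)| ≤ N ^ ((1 : ℝ) / 2) * Real.log N ^ (-A))) := by
  obtain ⟨h0, h1, h2, -, -, h5, h6, i, hi⟩ := ht
  have h1' : |(t 0 : ℝ)| ≤ t 1 := by exact_mod_cast h1.le
  have h2' : |(t 2 : ℝ)| ≤ t 3 := by exact_mod_cast h2
  have ht1 : 1 ≤ t 1 := by linarith [abs_nonneg (t 0)]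
  have ht1' : (1 : ℝ) ≤ t 1 := by exact_mod_cast ht1
  have hR0 : 0 < R := by linarith
  have hαR : 1 ≤ α * R := by
    have := mul_le_mul_of_nonneg_right hα.1 hR0.le
    rwa [inv_mul_cancel₀ hR0.ne'] at this
  have hα0 : 0 < α := lt_of_lt_of_le (by positivity) hα.1
  have hone {k : ℤ} (hk : k ≠ 0) : (1 : ℝ) ≤ |(k : ℝ)| := by
    exact_mod_cast Int.one_le_abs hk
  by_cases ht0 : t 0 = 0
  · left
    have ht2 : t 2 ≠ 0 := fun h => h0 (by rw [ht0, h])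
    have e2 := hone ht2
    have ht3 : t 3 ≠ 0 := by
      intro h
      rw [h] at h2'
      norm_num at h2'
      exact ht2 h2'
    rw [ht0] at h6
    have e3 : |(t 2 : ℝ)| * t 3 ≤ R * Cc * Δ := by
      rw [ht0] at h5
      have h7 : |(t 2 : ℝ) * t 3| ≤ Cc * Δ := by
        rw [abs_le]
        push_cast at h5 h6
        constructor <;> nlinarith
      rw [abs_mul, abs_of_nonneg (show (0 : ℝ) ≤ t 3 by linarith)] at h7
      have : 0 ≤ Cc * Δ := by positivity
      nlinarith
    have e4 : |(t 3 : ℝ)| ≤ R * Cc * Δ := by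
      rw [abs_of_nonneg (show (0 : ℝ) ≤ t 3 by linarith)]
      nlinarith
    refine ⟨ht0, ⟨ht2, ?_⟩, ht3, e4⟩
    nlinarith
  have e0 := hone ht0
  by_cases ht2 : t 2 = 0
  · right; left
    rw [ht2] at h5 h6
    push_cast at h5 h6
    have e3 : |(t 0 : ℝ)| * t 1 ≤ R * Cc * Δ := by
      have h7 : |α * t 0 * t 1| ≤ Cc * Δ := by
        rw [abs_le]
        constructor <;> nlinarith
      rw [abs_mul, abs_mul, abs_of_pos hα0, abs_of_nonneg (show (0 : ℝ) ≤ t 1 by linarith)] at h7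
      have h8 := mul_le_mul_of_nonneg_left h7 hR0.le
      have h9 := mul_le_mul_of_nonneg_right hαR
        (show 0 ≤ |(t 0 : ℝ)| * t 1 by positivity)
      linarith
    have e4 : |(t 1 : ℝ)| ≤ R * Cc * Δ := by
      rw [abs_of_nonneg (show (0 : ℝ) ≤ t 1 by linarith)]
      nlinarith
    refine ⟨ht2, ⟨ht0, ?_⟩, by omega, e4⟩
    nlinarith
  right; right
  have e2 := hone ht2
  have ht3 : t 3 ≠ 0 := by
    intro h
    rw [h] at h2'
    norm_num at h2'
    exact ht2 h2'
  have e3 := hone ht3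
  have e1 := hone (show t 1 ≠ 0 by omega)
  have hu : 1 ≤ |(t 0 : ℝ) * t 1| := by rw [abs_mul]; nlinarith
  have hv : 1 ≤ |(t 2 : ℝ) * t 3| := by rw [abs_mul]; nlinarith
  have hCd : 0 ≤ Cd := hΔ.trans hΔd
  have hCCd : 0 ≤ Cc * Cd := by positivity
  have hCΔ : Cc * Δ ≤ Cc * Cd := mul_le_mul_of_nonneg_left hΔd (by linarith)
  have hdiff : |α * ((t 0 : ℝ) * t 1) - (t 2 : ℝ) * t 3| ≤ Cc * Cd := by
    rw [abs_le]
    constructor <;> linarith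
  have habs : |α * ((t 0 : ℝ) * t 1)| = α * |(t 0 : ℝ) * t 1| := by
    rw [abs_mul, abs_of_pos hα0]
  refine ⟨ht0, by omega, ht2, ht3, ?_, ?_, ?_⟩
  · have h7 := abs_sub_abs_le_abs_sub ((t 2 : ℝ) * t 3) (α * ((t 0 : ℝ) * t 1))
    rw [abs_sub_comm, habs] at h7
    have h8 := mul_le_mul_of_nonneg_right hα.2 (abs_nonneg ((t 0 : ℝ) * t 1))
    have h9 := mul_le_mul hR hu zero_le_one hR0.le
    have h10 := mul_le_mul_of_nonneg_left h9 hCCd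
    linarith
  · have h7 := abs_sub_abs_le_abs_sub (α * ((t 0 : ℝ) * t 1)) ((t 2 : ℝ) * t 3)
    rw [habs] at h7
    have h8 := mul_le_mul_of_nonneg_right hαR (abs_nonneg ((t 0 : ℝ) * t 1))
    have h9 := mul_le_mul_of_nonneg_left (h7.trans hdiff) hR0.le
    have h10 := mul_le_mul_of_nonneg_left hv (mul_nonneg hR0.le hCCd)
    linarith
  · fin_cases i
    · exact Or.inl hi
    · exact Or.inl ((h1'.trans (le_abs_self _)).trans hi)
    · exact Or.inr hi
    · exact Or.inr ((h2'.trans (le_abs_self _)).trans hi)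

lemma volume_setOf_mem_T1set_le {R Cc A N Δ Cd : ℝ} (hCc : 1 ≤ Cc) (hR : 1 ≤ R) (hΔ : 0 ≤ Δ)
    (hΔd : Δ ≤ Cd) (p r : ℤ × ℤ) :
    volume {α ∈ Set.Icc R⁻¹ R | quadOfPairs (p, r) ∈ T1set Cc A α N Δ} ≤
      ENNReal.ofReal (R * (axisWeight (R * Cc * Δ) p r + axisWeight (R * Cc * Δ) r p) +
        2 * (Cc * Δ) *
        (hyperbolaWeight (N ^ ((1 : ℝ) / 2) * Real.log N ^ (-A)) (R * (1 + Cc * Cd)) p r +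
          R * (1 + Cc * Cd) *
          hyperbolaWeight (N ^ ((1 : ℝ) / 2) * Real.log N ^ (-A)) (R * (1 + Cc * Cd)) r p)) := by
  set D := R * Cc * Δ with hD
  set M := N ^ ((1 : ℝ) / 2) * Real.log N ^ (-A) with hM
  set Q := R * (1 + Cc * Cd) with hQ
  set S := {α ∈ Set.Icc R⁻¹ R | quadOfPairs (p, r) ∈ T1set Cc A α N Δ} with hS
  have hR0 : 0 < R := by linarith
  have hCd : 0 ≤ Cd := hΔ.trans hΔd
  have hQ0 : 0 < Q := by positivity
  rcases S.eq_empty_or_nonempty with hE | ⟨α₀, hα₀, hmem⟩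
  · rw [hE, measure_empty]
    exact zero_le
  have a1 := axisWeight_nonneg D p r
  have a2 := axisWeight_nonneg D r p
  have b1 := hyperbolaWeight_nonneg M Q p r
  have b2 := mul_nonneg hQ0.le (hyperbolaWeight_nonneg M Q r p)
  have hCΔ : 0 ≤ 2 * (Cc * Δ) := by positivity
  have htriv : 1 ≤ axisWeight D p r + axisWeight D r p → volume S ≤ ENNReal.ofReal
      (R * (axisWeight D p r + axisWeight D r p) + 2 * (Cc * Δ) *
        (hyperbolaWeight M Q p r + Q * hyperbolaWeight M Q r p)) := by
    intro h
    refine (measure_mono (fun α hα => hα.1)).trans ((Real.volume_Icc).trans_le ?_)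
    apply ENNReal.ofReal_le_ofReal
    have : 0 < R⁻¹ := by positivity
    have := mul_le_mul_of_nonneg_left h hR0.le
    have := mul_nonneg hCΔ (add_nonneg b1 b2)
    linarith
  rcases trichotomy_of_mem_T1set hCc hR hΔ hΔd hα₀ hmem with h | h | ⟨h0, h1, h2, h3, h4, h5, h6⟩
  · apply htriv
    have : axisWeight D p r = 1 := if_pos h
    linarith
  · apply htriv
    have : axisWeight D r p = 1 := if_pos h
    linarith
  change p.1 ≠ 0 at h0
  change p.2 ≠ 0 at h1
  change r.1 ≠ 0 at h2
  change r.2 ≠ 0 at h3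
  change |(r.1 : ℝ) * r.2| ≤ Q * |(p.1 : ℝ) * p.2| at h4
  change |(p.1 : ℝ) * p.2| ≤ Q * |(r.1 : ℝ) * r.2| at h5
  change |(p.1 : ℝ)| ≤ M ∨ |(r.1 : ℝ)| ≤ M at h6
  have hu : 0 < |(p.1 : ℝ) * p.2| := by positivity
  have hv : 0 < |(r.1 : ℝ) * r.2| := by positivity
  have hball : S ⊆ Metric.closedBall ((r.1 : ℝ) * r.2 / (p.1 * p.2))
      (Cc * Δ * |(p.1 : ℝ) * p.2|⁻¹) := by
    rintro α ⟨-, -, -, -, -, -, h7, h8, -⟩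
    change 0 ≤ α * (p.1 : ℝ) * p.2 - r.1 * r.2 at h7
    change α * (p.1 : ℝ) * p.2 - r.1 * r.2 ≤ Cc * Δ at h8
    have : α - (r.1 : ℝ) * r.2 / (p.1 * p.2) =
        (α * (p.1 : ℝ) * p.2 - r.1 * r.2) * ((p.1 : ℝ) * p.2)⁻¹ := by
      field_simp
    rw [Metric.mem_closedBall, Real.dist_eq, this, abs_mul, abs_inv, abs_of_nonneg h7]
    exact mul_le_mul_of_nonneg_right h8 (by positivity)
  refine (measure_mono hball).trans ((Real.volume_closedBall _ _).trans_le ?_)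
  apply ENNReal.ofReal_le_ofReal
  have hkey : |(p.1 : ℝ) * p.2|⁻¹ ≤ hyperbolaWeight M Q p r + Q * hyperbolaWeight M Q r p := by
    rcases h6 with h6 | h6
    · have : hyperbolaWeight M Q p r = |(p.1 : ℝ) * p.2|⁻¹ :=
        if_pos ⟨⟨h0, h6⟩, h1, h2, h3, h4⟩
      linarith
    · have : hyperbolaWeight M Q r p = |(r.1 : ℝ) * r.2|⁻¹ :=
        if_pos ⟨⟨h2, h6⟩, h3, h0, h1, h5⟩
      rw [this]
      have : |(p.1 : ℝ) * p.2|⁻¹ ≤ Q * |(r.1 : ℝ) * r.2|⁻¹ := by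
        rw [← div_eq_mul_inv, le_div_iff₀ hv, inv_mul_le_iff₀ hu]
        linarith
      linarith
  have := mul_le_mul_of_nonneg_left hkey hCΔ
  have := mul_nonneg hR0.le (add_nonneg a1 a2)
  linarith

lemma Rmeasure_le_of_subset_Icc {R : ℝ} (hR : 1 ≤ R) {E : Set ℝ} (hE : E ⊆ Set.Icc R⁻¹ R) :
    Rmeasure E ≤ ENNReal.ofReal R * volume E := by
  have hR0 : 0 < R := by linarith
  have hsub : E ⊆ toMeasurable volume E ∩ Set.Icc R⁻¹ R :=
    Set.subset_inter (subset_toMeasurable _ _) hE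
  have hm : MeasurableSet (toMeasurable volume E ∩ Set.Icc R⁻¹ R) :=
    (measurableSet_toMeasurable _ _).inter measurableSet_Icc
  calc Rmeasure E ≤ Rmeasure (toMeasurable volume E ∩ Set.Icc R⁻¹ R) := measure_mono hsub
    _ = ∫⁻ α in toMeasurable volume E ∩ Set.Icc R⁻¹ R, ENNReal.ofReal (1 / α) :=
        withDensity_apply _ hm
    _ ≤ ∫⁻ _ in toMeasurable volume E ∩ Set.Icc R⁻¹ R, ENNReal.ofReal R := by
        refine setLIntegral_mono' hm fun α hα => ENNReal.ofReal_le_ofReal ?_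
        rw [one_div]
        exact inv_le_of_inv_le₀ hR0 hα.2.1
    _ = ENNReal.ofReal R * volume (toMeasurable volume E ∩ Set.Icc R⁻¹ R) :=
        setLIntegral_const _ _
    _ ≤ ENNReal.ofReal R * volume E := by
        refine mul_le_mul_right ?_ _
        exact (measure_mono Set.inter_subset_left).trans (measure_toMeasurable E).le

/-- Markov's inequality for the number of `x ∈ P` with `α ∈ S x`. -/
lemma mul_volume_le_sum {ι : Type*} (P : Finset ι) (S : ι → Set ℝ) (E : Set ℝ)
    (c : ENNReal) (hE : ∀ α ∈ E, c ≤ ∑ x ∈ P, (S x).indicator 1 α) :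
    c * volume E ≤ ∑ x ∈ P, volume (S x) := by
  set U := fun x => toMeasurable volume (S x)
  have hU (x : ι) : MeasurableSet (U x) := measurableSet_toMeasurable _ _
  have hind (x : ι) : Measurable ((U x).indicator (1 : ℝ → ENNReal)) :=
    measurable_one.indicator (hU x)
  calc c * volume E ≤ c * volume {α | c ≤ ∑ x ∈ P, (U x).indicator (1 : ℝ → ENNReal) α} := by
        gcongr
        intro α hα
        refine (hE α hα).trans (Finset.sum_le_sum fun x _ => ?_)
        exact Set.indicator_le_indicator_of_subset (subset_toMeasurable _ _)
          (fun _ => zero_le) α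
    _ ≤ ∫⁻ α, ∑ x ∈ P, (U x).indicator (1 : ℝ → ENNReal) α :=
        mul_meas_ge_le_lintegral (Finset.measurable_fun_sum P fun x _ => hind x) c
    _ = ∑ x ∈ P, volume (S x) := by
        rw [lintegral_finsetSum P fun x _ => hind x]
        refine Finset.sum_congr rfl fun x _ => ?_
        rw [lintegral_indicator_one (hU x)]
        exact measure_toMeasurable _

lemma ncard_T1set_le {R Cc A α N Δ : ℝ} (hCc : 1 ≤ Cc) (hR : 1 ≤ R) (hN : 0 ≤ N)
    (hα : α ∈ Set.Icc R⁻¹ R) :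
    ((T1set Cc A α N Δ).ncard : ENNReal) ≤
      ∑ x ∈ pairBox ⌊4 * Cc * R * √N⌋₊ ×ˢ pairBox ⌊4 * Cc * R * √N⌋₊,
        {β ∈ Set.Icc R⁻¹ R | quadOfPairs x ∈ T1set Cc A β N Δ}.indicator 1 α := by
  classical
  set n := ⌊4 * Cc * R * √N⌋₊
  set P := (pairBox n ×ˢ pairBox n).filter fun x => quadOfPairs x ∈ T1set Cc A α N Δ with hP
  have hsub : T1set Cc A α N Δ ⊆ (P.image quadOfPairs : Finset (Fin 4 → ℤ)) := by
    intro t ht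
    have hb (i : Fin 4) : t i ∈ Finset.Icc (-(n : ℤ)) n := by
      have h1 : (((t i).natAbs : ℕ) : ℝ) ≤ 4 * Cc * R * √N := by
        rw [Nat.cast_natAbs, Int.cast_abs]
        exact abs_le_of_mem_T1set hCc hR hN hα ht i
      have h2 := Nat.le_floor h1
      rw [Finset.mem_Icc]
      omega
    have hq : quadOfPairs ((t 0, t 1), (t 2, t 3)) = t := by
      ext i
      fin_cases i <;> rfl
    rw [Finset.coe_image]
    refine ⟨((t 0, t 1), (t 2, t 3)), ?_, hq⟩
    simp only [hP, Finset.coe_filter, Set.mem_ofPred_eq, pairBox, Finset.mem_product, hb, hq, ht,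
      and_self]
  have hcard : (T1set Cc A α N Δ).ncard ≤ P.card := by
    refine (Set.ncard_le_ncard hsub (Finset.finite_toSet _)).trans ?_
    rw [Set.ncard_coe_finset]
    exact Finset.card_image_le
  calc ((T1set Cc A α N Δ).ncard : ENNReal) ≤ (P.card : ENNReal) := by exact_mod_cast hcard
    _ = _ := by
      rw [hP, Finset.card_filter, Nat.cast_sum]
      refine Finset.sum_congr rfl fun x _ => ?_
      by_cases h : quadOfPairs x ∈ T1set Cc A α N Δ
      · rw [if_pos h, Set.indicator_of_mem (show α ∈ {β ∈ Set.Icc R⁻¹ R |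
          quadOfPairs x ∈ T1set Cc A β N Δ} from ⟨hα, h⟩)]
        simp
      · rw [if_neg h, Set.indicator_of_notMem fun h' => h h'.2]
        simp

lemma exists_subset_Icc_inv {R₀ : Set ℝ} (hc : IsCompact R₀) (hpos : R₀ ⊆ Set.Ioi 0) :
    ∃ R : ℝ, 1 ≤ R ∧ R₀ ⊆ Set.Icc R⁻¹ R := by
  obtain ⟨b, hb⟩ := hc.bddAbove
  have hcont : ContinuousOn (fun x : ℝ => x⁻¹) R₀ :=
    continuousOn_inv₀.mono fun x hx => (hpos hx).ne'
  obtain ⟨c, hc'⟩ := (hc.image_of_continuousOn hcont).bddAbove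
  refine ⟨max 1 (max b c), le_max_left _ _, fun x hx => ⟨?_, ?_⟩⟩
  · refine inv_le_of_inv_le₀ (hpos hx) ?_
    exact (hc' ⟨x, hx, rfl⟩).trans ((le_max_right _ _).trans (le_max_right _ _))
  · exact (hb hx).trans ((le_max_left _ _).trans (le_max_right _ _))

/-- Powers of `log N` are dominated by `√N`. -/
lemma exists_sqrt_le_mul_log_rpow {B : ℝ} (hB : 0 < B) :
    ∃ c : ℝ, 0 < c ∧ ∀ N : ℝ, 3 ≤ N → √N ≤ c * (N * Real.log N ^ (-B)) := by
  refine ⟨(2 * B) ^ B, by positivity, fun N hN => ?_⟩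
  have hN0 : 0 < N := by linarith
  have hL : 0 < Real.log N := Real.log_pos (by linarith)
  have h1 : Real.log N ≤ N ^ (1 / (2 * B)) / (1 / (2 * B)) :=
    Real.log_le_rpow_div hN0.le (by positivity)
  have h2 : Real.log N ^ B ≤ √N * (2 * B) ^ B := by
    refine (Real.rpow_le_rpow hL.le h1 hB.le).trans (le_of_eq ?_)
    rw [div_div_eq_mul_div, div_one, Real.mul_rpow (by positivity) (by positivity),
      ← Real.rpow_mul hN0.le, Real.sqrt_eq_rpow]
    congr 2
    field_simp
  have h3 : √N * √N = N := Real.mul_self_sqrt hN0.le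
  rw [Real.rpow_neg hL.le, ← div_eq_mul_inv, ← mul_div_assoc, le_div_iff₀ (by positivity)]
  calc √N * Real.log N ^ B ≤ √N * (√N * (2 * B) ^ B) :=
        mul_le_mul_of_nonneg_left h2 (Real.sqrt_nonneg N)
    _ = (2 * B) ^ B * N := by rw [← mul_assoc, h3, mul_comm]

/-- **Bound on the degenerate count `𝒯₁`.** For `A > 4`, compact `ℛ₀ ⊂ ℝ_{>0}`, uniformly
for `N^{-1+η} ≤ Δ ≪ 1`, the measure of the set of `α ∈ ℛ₀` with `𝒯₁(α) > ΔN/2` is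
`≪ (log N)^{4-A}`. -/
theorem T1_measure_bound (A η Cc Cd : ℝ) (hA : 4 < A) (hη : 0 < η) (hCc : 1 ≤ Cc)
    (hCd : 0 < Cd) (R₀ : Set ℝ) (hR₀c : IsCompact R₀) (hR₀ : R₀ ⊆ Set.Ioi 0) :
    ∃ C : ℝ, 0 < C ∧ ∀ N Δ : ℝ, 3 ≤ N → N ^ (-1 + η) ≤ Δ → Δ ≤ Cd →
      Rmeasure {α ∈ R₀ | Δ * N / 2 < ((T1set Cc A α N Δ).ncard : ℝ)}
        ≤ ENNReal.ofReal (C * Real.log N ^ (4 - A)) := by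
  obtain ⟨R, hR, hsub⟩ := exists_subset_Icc_inv hR₀c hR₀
  obtain ⟨c, hc, hsqrt⟩ := exists_sqrt_le_mul_log_rpow (sub_pos.2 hA)
  have hR0 : 0 < R := by linarith
  have hCc0 : 0 < Cc := by linarith
  set K := 4 * Cc * R with hK
  have hK1 : 1 ≤ K := by nlinarith
  have hK0 : 0 < K := by linarith
  set Q := R * (1 + Cc * Cd) with hQ
  have hQ0 : 0 < Q := by positivity
  set c₁ := R * (2 * (3 * K * (4 * (R * Cc) ^ 2 * Cd))) with hc₁
  set c₂ := 2 * Cc * ((1 + Q) * (2 * (3 * K) * (2 * Q * (2 * (1 + K))))) with hc₂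
  have hc₁0 : 0 < c₁ := by positivity
  have hc₂0 : 0 < c₂ := by positivity
  refine ⟨R * (2 * (c₁ * c + c₂)), by positivity, fun N Δ hN hΔN hΔd => ?_⟩
  have hN0 : 0 < N := by linarith
  have hΔ : 0 < Δ := lt_of_lt_of_le (by positivity) hΔN
  have hL1 : 1 ≤ Real.log N := by
    rw [Real.le_log_iff_exp_le hN0]
    linarith [Real.exp_one_lt_d9]
  have hL0 : 0 < Real.log N := by linarith
  set M := N ^ ((1 : ℝ) / 2) * Real.log N ^ (-A) with hM
  have hM0 : 0 ≤ M := by positivity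
  set D := R * Cc * Δ with hD
  set n := ⌊K * √N⌋₊ with hn
  set E := {α ∈ R₀ | Δ * N / 2 < ((T1set Cc A α N Δ).ncard : ℝ)} with hE
  have hEsub : E ⊆ Set.Icc R⁻¹ R := fun α hα => hsub hα.1
  have hs1 : 1 ≤ √N := Real.one_le_sqrt.2 (by linarith)
  have hKs : 1 ≤ K * √N := by nlinarith
  have hnle : (n : ℝ) ≤ K * √N := Nat.floor_le (by linarith)
  have hn1 : 1 ≤ n := Nat.le_floor (by simpa using hKs)
  have hbox : 2 * (n : ℝ) + 1 ≤ 3 * K * √N := by linarith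
  have hlog : 1 + Real.log n ≤ (1 + K) * Real.log N := by
    have h1 : Real.log n ≤ Real.log (K * √N) :=
      Real.log_le_log (by exact_mod_cast hn1) hnle
    rw [Real.log_mul hK0.ne' (by positivity), Real.log_sqrt hN0.le] at h1
    have h2 := Real.log_le_sub_one_of_pos hK0
    nlinarith
  have hlog0 : 0 ≤ Real.log n := Real.log_natCast_nonneg n
  set T := ∑ p ∈ pairBox n, ∑ r ∈ pairBox n, (R * (axisWeight D p r + axisWeight D r p) +
    2 * (Cc * Δ) * (hyperbolaWeight M Q p r + Q * hyperbolaWeight M Q r p)) with hT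
  have hTle : T ≤ Δ * N / 2 * (2 * (c₁ * c + c₂) * Real.log N ^ (4 - A)) := by
    have ha := sum_axisWeight_le n (show 0 ≤ D by positivity)
    have hh := sum_hyperbolaWeight_le n hM0 hQ0.le
    have hsplit : T = R * (2 * ∑ p ∈ pairBox n, ∑ r ∈ pairBox n, axisWeight D p r) +
        2 * (Cc * Δ) * ((1 + Q) *
          ∑ p ∈ pairBox n, ∑ r ∈ pairBox n, hyperbolaWeight M Q p r) := by
      have s1 : ∑ p ∈ pairBox n, ∑ r ∈ pairBox n, axisWeight D r p =
          ∑ p ∈ pairBox n, ∑ r ∈ pairBox n, axisWeight D p r := Finset.sum_comm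
      have s2 : ∑ p ∈ pairBox n, ∑ r ∈ pairBox n, hyperbolaWeight M Q r p =
          ∑ p ∈ pairBox n, ∑ r ∈ pairBox n, hyperbolaWeight M Q p r := Finset.sum_comm
      simp only [hT, Finset.sum_add_distrib, ← Finset.mul_sum, s1, s2]
      ring
    have hD2 : (2 * D) ^ 2 ≤ 4 * (R * Cc) ^ 2 * Cd * Δ := by
      have := mul_le_mul_of_nonneg_left hΔd (show 0 ≤ 4 * (R * Cc) ^ 2 * Δ by positivity)
      rw [hD]
      linarith
    have h1 : ∑ p ∈ pairBox n, ∑ r ∈ pairBox n, axisWeight D p r ≤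
        3 * K * √N * (4 * (R * Cc) ^ 2 * Cd * Δ) :=
      ha.trans (mul_le_mul hbox hD2 (by positivity) (by positivity))
    have h2 : ∑ p ∈ pairBox n, ∑ r ∈ pairBox n, hyperbolaWeight M Q p r ≤
        2 * M * (3 * K * √N) * (2 * Q * (2 * ((1 + K) * Real.log N))) :=
      hh.trans (by gcongr)
    have hML : M * √N * Real.log N ≤ N * Real.log N ^ (4 - A) := by
      have e1 : M * √N * Real.log N = N * (Real.log N ^ (-A) * Real.log N ^ (1 : ℝ)) := by
        rw [hM, ← Real.sqrt_eq_rpow, Real.rpow_one]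
        linear_combination (Real.log N ^ (-A) * Real.log N) * Real.mul_self_sqrt hN0.le
      rw [e1, ← Real.rpow_add hL0]
      gcongr
      linarith
    have h3 := hsqrt N hN
    rw [neg_sub] at h3
    calc T ≤ R * (2 * (3 * K * √N * (4 * (R * Cc) ^ 2 * Cd * Δ))) + 2 * (Cc * Δ) * ((1 + Q) *
          (2 * M * (3 * K * √N) * (2 * Q * (2 * ((1 + K) * Real.log N))))) := by
          rw [hsplit]
          gcongr
      _ = Δ * (c₁ * √N + c₂ * (M * √N * Real.log N)) := by
          rw [hc₁, hc₂]
          ring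
      _ ≤ Δ * (c₁ * (c * (N * Real.log N ^ (4 - A))) + c₂ * (N * Real.log N ^ (4 - A))) := by
          gcongr
      _ = Δ * N / 2 * (2 * (c₁ * c + c₂) * Real.log N ^ (4 - A)) := by ring
  have hX : 0 < Δ * N / 2 := by positivity
  have hmarkov : ENNReal.ofReal (Δ * N / 2) * volume E ≤ ENNReal.ofReal T := by
    refine (mul_volume_le_sum (pairBox n ×ˢ pairBox n)
      (fun x => {β ∈ Set.Icc R⁻¹ R | quadOfPairs x ∈ T1set Cc A β N Δ}) E _ ?_).trans ?_
    · intro α hα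
      refine le_trans ?_ (ncard_T1set_le hCc hR hN0.le (hEsub hα))
      rw [← ENNReal.ofReal_natCast]
      exact ENNReal.ofReal_le_ofReal hα.2.le
    · have hw (p r : ℤ × ℤ) : 0 ≤ R * (axisWeight D p r + axisWeight D r p) +
          2 * (Cc * Δ) * (hyperbolaWeight M Q p r + Q * hyperbolaWeight M Q r p) := by
        have := axisWeight_nonneg D p r
        have := axisWeight_nonneg D r p
        have := hyperbolaWeight_nonneg M Q p r
        have := hyperbolaWeight_nonneg M Q r p
        positivity
      rw [hT, ENNReal.ofReal_sum_of_nonneg fun p _ => Finset.sum_nonneg fun r _ => hw p r,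
        Finset.sum_product]
      refine Finset.sum_le_sum fun p _ => ?_
      rw [ENNReal.ofReal_sum_of_nonneg fun r _ => hw p r]
      exact Finset.sum_le_sum fun r _ => volume_setOf_mem_T1set_le hCc hR hΔ.le hΔd p r
  have hvol : volume E ≤ ENNReal.ofReal (2 * (c₁ * c + c₂) * Real.log N ^ (4 - A)) := by
    have h := hmarkov.trans (ENNReal.ofReal_le_ofReal hTle)
    rw [ENNReal.ofReal_mul hX.le] at h
    exact (ENNReal.mul_le_mul_iff_right (ENNReal.ofReal_pos.2 hX).ne' ENNReal.ofReal_ne_top).1 h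
  calc Rmeasure E ≤ ENNReal.ofReal R * volume E := Rmeasure_le_of_subset_Icc hR hEsub
    _ ≤ ENNReal.ofReal R * ENNReal.ofReal (2 * (c₁ * c + c₂) * Real.log N ^ (4 - A)) := by
        gcongr
    _ = ENNReal.ofReal (R * (2 * (c₁ * c + c₂)) * Real.log N ^ (4 - A)) := by
        rw [← ENNReal.ofReal_mul hR0.le, ← mul_assoc R]
end

section
/- Fix A > 10, 0 < ρ < 1/20, η > 0, a constant C ≥ 1 and a compact subset ℛ₀ ⊂ ℝ_{>0}. For α ∈ ℛ₀ let 𝒯₂(α) be the number of integer quadruples (t₁,t₂,t₃,t₄) with (t₁,t₃) ≠ (0,0), t₂ > |t₁|, t₄ ≥ |t₃|, α((t₁±t₂)/2)² + ((t₃±t₄)/2)² ≤ CN for both choices of sign, 0 ≤ αt₁t₂ − t₃t₄ ≤ CΔ, all |tⱼ| ≥ N^{1/2}(log N)^{−A}, and none of t₁, t₂, t₃ belonging to S_ρ(N). Then, uniformly for N^{−1+η} ≤ Δ ≪ 1, the measure (with respect to dα/α) of the set of α ∈ ℛ₀ with 𝒯₂(α) > ΔN/2 is ≪ (log log N)⁴·(log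 N)^{6ρ−3}, with implied constant depending only on A, ρ, η, C and ℛ₀. -/
open MeasureTheory

noncomputable section

/-- The set of integer quadruples counted by `𝒯₂(α)`: `(t₁,t₃) ≠ (0,0)`, `t₂ > |t₁|`,
`t₄ ≥ |t₃|`, `α((t₁±t₂)/2)² + ((t₃±t₄)/2)² ≤ CN` for both signs,
`0 ≤ αt₁t₂ - t₃t₄ ≤ CΔ`, all `|tⱼ| ≥ N^{1/2}(log N)^{-A}`, and none of `t₁, t₂, t₃` in
`S_ρ(N)`. -/
def T2set (Cc ρ A α N Δ : ℝ) : Set (Fin 4 → ℤ) :=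
  {t | (t 0, t 2) ≠ ((0 : ℤ), (0 : ℤ)) ∧ |t 0| < t 1 ∧ |t 2| ≤ t 3 ∧
    α * (((t 0 : ℝ) + (t 1 : ℝ)) / 2) ^ 2 + (((t 2 : ℝ) + (t 3 : ℝ)) / 2) ^ 2 ≤ Cc * N ∧
    α * (((t 0 : ℝ) - (t 1 : ℝ)) / 2) ^ 2 + (((t 2 : ℝ) - (t 3 : ℝ)) / 2) ^ 2 ≤ Cc * N ∧
    0 ≤ α * (t 0 : ℝ) * (t 1 : ℝ) - (t 2 : ℝ) * (t 3 : ℝ) ∧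
    α * (t 0 : ℝ) * (t 1 : ℝ) - (t 2 : ℝ) * (t 3 : ℝ) ≤ Cc * Δ ∧
    (∀ i, N ^ ((1 : ℝ) / 2) * Real.log N ^ (-A) ≤ |(t i : ℝ)|) ∧
    ¬ memS ρ N (t 0) ∧ ¬ memS ρ N (t 1) ∧ ¬ memS ρ N (t 2)}

end

theorem sum_le_sum_of_injOn_of_le {ι κ : Type*} {s : Finset ι} {t : Finset κ} (e : ι → κ)
    {f : ι → ℝ} {g : κ → ℝ} (hmaps : ∀ a ∈ s, e a ∈ t) (hinj : Set.InjOn e s)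
    (hfg : ∀ a ∈ s, f a ≤ g (e a)) (hg : ∀ b ∈ t, 0 ≤ g b) :
    ∑ a ∈ s, f a ≤ ∑ b ∈ t, g b := by
  classical
  calc ∑ a ∈ s, f a ≤ ∑ a ∈ s, g (e a) := Finset.sum_le_sum hfg
    _ = ∑ b ∈ s.image e, g b := (Finset.sum_image hinj).symm
    _ ≤ ∑ b ∈ t, g b := Finset.sum_le_sum_of_subset_of_nonneg
        (Finset.image_subset_iff.2 hmaps) fun b hb _ => hg b hb

open Classical in
/-- The positive integers up to `X` all of whose prime divisors satisfy `Q`. -/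
noncomputable def sifted (Q : ℕ → Prop) (X : ℕ) : Finset ℕ :=
  {n ∈ Finset.Ioc 0 X | ∀ p : ℕ, p.Prime → p ∣ n → Q p}

/-- The sum of the reciprocals of the elements of `sifted Q X`. -/
noncomputable def siftedHarmonic (Q : ℕ → Prop) (X : ℕ) : ℝ :=
  ∑ n ∈ sifted Q X, (n : ℝ)⁻¹

theorem mem_sifted {Q : ℕ → Prop} {X n : ℕ} :
    n ∈ sifted Q X ↔ (0 < n ∧ n ≤ X) ∧ ∀ p : ℕ, p.Prime → p ∣ n → Q p := by
  simp [sifted]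

theorem sifted_true (X : ℕ) : sifted (fun _ => True) X = Finset.Ioc 0 X := by
  ext n; simp [mem_sifted]

theorem siftedHarmonic_nonneg (Q : ℕ → Prop) (X : ℕ) : 0 ≤ siftedHarmonic Q X :=
  Finset.sum_nonneg fun _ _ => by positivity

theorem siftedHarmonic_true (X : ℕ) :
    siftedHarmonic (fun _ => True) X = (harmonic X : ℝ) := by
  rw [siftedHarmonic, sifted_true, harmonic_eq_sum_Icc]
  push_cast
  rfl

theorem siftedHarmonic_mono_of_imp {Q R : ℕ → Prop} {X : ℕ}
    (h : ∀ p, p.Prime → p ≤ X → Q p → R p) : siftedHarmonic Q X ≤ siftedHarmonic R X := by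
  refine Finset.sum_le_sum_of_subset_of_nonneg (fun n hn => ?_) fun _ _ _ => by positivity
  rw [mem_sifted] at hn ⊢
  exact ⟨hn.1, fun p hp hd => h p hp ((Nat.le_of_dvd hn.1.1 hd).trans hn.1.2) (hn.2 p hp hd)⟩

theorem coprime_of_forall_prime {Q R : ℕ → Prop} (hQR : ∀ p, Q p → ¬ R p) {m k : ℕ}
    (hm : ∀ p : ℕ, p.Prime → p ∣ m → Q p) (hk : ∀ p : ℕ, p.Prime → p ∣ k → R p) :
    m.Coprime k :=
  Nat.coprime_of_dvd fun p hp h1 h2 => hQR p (hm p hp h1) (hk p hp h2)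

theorem siftedHarmonic_mul_le {Q R : ℕ → Prop} (hQR : ∀ p, Q p → ¬ R p) (X Y : ℕ) :
    siftedHarmonic Q X * siftedHarmonic R Y ≤ siftedHarmonic (fun _ => True) (X * Y) := by
  simp only [siftedHarmonic]
  rw [Finset.sum_mul_sum, ← Finset.sum_product']
  refine sum_le_sum_of_injOn_of_le (fun x => x.1 * x.2) ?_ ?_ ?_ ?_
  · intro x hx
    simp only [Finset.mem_product, mem_sifted] at hx ⊢
    exact ⟨⟨Nat.mul_pos hx.1.1.1 hx.2.1.1, Nat.mul_le_mul hx.1.1.2 hx.2.1.2⟩, fun _ _ _ => trivial⟩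
  · rintro ⟨a, b⟩ h ⟨c, d⟩ h' heq
    simp only [Finset.coe_product, Set.mem_prod, Finset.mem_coe, mem_sifted] at h h' heq
    have hac : a = c := Nat.dvd_antisymm
      ((coprime_of_forall_prime hQR h.1.2 h'.2.2).dvd_of_dvd_mul_right (heq ▸ dvd_mul_right a b))
      ((coprime_of_forall_prime hQR h'.1.2 h.2.2).dvd_of_dvd_mul_right (heq ▸ dvd_mul_right c d))
    subst hac
    simpa using Nat.eq_of_mul_eq_mul_left h.1.1.1 heq
  · intro x _
    simp [mul_comm]
  · intros
    positivity

theorem exists_mul_of_prime_partition (Q : ℕ → Prop) (n : ℕ) : n ≠ 0 →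
    ∃ m k : ℕ, n = m * k ∧ (∀ p : ℕ, p.Prime → p ∣ m → Q p) ∧
      ∀ p : ℕ, p.Prime → p ∣ k → ¬ Q p := by
  induction n using induction_on_primes with
  | zero => simp
  | one =>
    exact fun _ => ⟨1, 1, rfl, fun p hp h => (hp.one_lt.ne' (Nat.dvd_one.1 h)).elim,
      fun p hp h => (hp.one_lt.ne' (Nat.dvd_one.1 h)).elim⟩
  | prime_mul p a hp ih =>
    intro h
    obtain ⟨m, k, rfl, hm, hk⟩ := ih (right_ne_zero_of_mul h)
    by_cases hQ : Q p
    · refine ⟨p * m, k, by ring, fun q hq hd => ?_, hk⟩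
      rcases hq.dvd_mul.1 hd with h1 | h1
      · rwa [(Nat.prime_dvd_prime_iff_eq hq hp).1 h1]
      · exact hm q hq h1
    · refine ⟨m, p * k, by ring, hm, fun q hq hd => ?_⟩
      rcases hq.dvd_mul.1 hd with h1 | h1
      · rwa [(Nat.prime_dvd_prime_iff_eq hq hp).1 h1]
      · exact hk q hq h1

theorem le_siftedHarmonic_mul (Q : ℕ → Prop) (Y : ℕ) :
    siftedHarmonic (fun _ => True) Y ≤ siftedHarmonic Q Y * siftedHarmonic (fun p => ¬ Q p) Y := by
  choose! m k hmk hm hk using exists_mul_of_prime_partition Q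
  simp only [siftedHarmonic]
  rw [Finset.sum_mul_sum, ← Finset.sum_product']
  refine sum_le_sum_of_injOn_of_le (fun n => (m n, k n)) ?_ ?_ ?_ ?_
  · intro n hn
    rw [mem_sifted] at hn
    have h0 : n ≠ 0 := hn.1.1.ne'
    have h1 := hmk n h0
    have hm0 : m n ≠ 0 := fun h => h0 (by rw [h1, h, zero_mul])
    have hk0 : k n ≠ 0 := fun h => h0 (by rw [h1, h, mul_zero])
    simp only [Finset.mem_product, mem_sifted]
    refine ⟨⟨⟨Nat.pos_of_ne_zero hm0, ?_⟩, hm n h0⟩, ⟨Nat.pos_of_ne_zero hk0, ?_⟩, hk n h0⟩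
    · exact (Nat.le_of_dvd hn.1.1 ⟨k n, h1⟩).trans hn.1.2
    · exact (Nat.le_of_dvd hn.1.1 ⟨m n, by rw [mul_comm]; exact h1⟩).trans hn.1.2
  · intro a ha b hb hab
    rw [Finset.mem_coe, mem_sifted] at ha hb
    simp only [Prod.mk.injEq] at hab
    rw [hmk a ha.1.1.ne', hmk b hb.1.1.ne', hab.1, hab.2]
  · intro n hn
    rw [mem_sifted] at hn
    nth_rewrite 1 [hmk n hn.1.1.ne']
    simp [mul_comm]
  · intros
    positivity

open ArithmeticFunction in
theorem sum_sifted_mul_log_le {Q : ℕ → Prop} {X : ℕ} {w : ℕ → ℝ} (hw : ∀ n, 0 ≤ w n) :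
    ∑ n ∈ sifted Q X, w n * Real.log n ≤ ∑ m ∈ sifted Q X, ∑ d ∈ sifted Q X,
      if m * d ≤ X then w (m * d) * vonMangoldt d else 0 := by
  have h1 : ∀ n ∈ sifted Q X, w n * Real.log n =
      ∑ d ∈ n.divisors, w n * vonMangoldt d := fun n _ => by
    rw [← vonMangoldt_sum, Finset.mul_sum]
  rw [Finset.sum_congr rfl h1, Finset.sum_sigma', ← Finset.sum_product']
  have key : ∀ x ∈ (sifted Q X).sigma fun n => n.divisors, x.1 / x.2 * x.2 = x.1 := by
    intro x hx
    simp only [Finset.mem_sigma, Nat.mem_divisors] at hx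
    exact Nat.div_mul_cancel hx.2.1
  refine sum_le_sum_of_injOn_of_le (fun x => (x.1 / x.2, x.2)) ?_ ?_ ?_ ?_
  · rintro ⟨n, d⟩ h
    simp only [Finset.mem_sigma, Nat.mem_divisors, mem_sifted] at h
    obtain ⟨⟨⟨h0, hX⟩, hQ⟩, hd, -⟩ := h
    obtain ⟨e, rfl⟩ := hd
    have hd0 : 0 < d := Nat.pos_of_mul_pos_right h0
    have he0 : 0 < e := Nat.pos_of_mul_pos_left h0
    simp only [Finset.mem_product, mem_sifted, Nat.mul_div_cancel_left e hd0]
    exact ⟨⟨⟨he0, (Nat.le_mul_of_pos_left e hd0).trans hX⟩, fun p hp h => hQ p hp (h.mul_left d)⟩,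
      ⟨hd0, (Nat.le_mul_of_pos_right d he0).trans hX⟩, fun p hp h => hQ p hp (h.mul_right e)⟩
  · rintro ⟨a, b⟩ h ⟨c, d⟩ h' heq
    have h1 := key _ h
    have h2 := key _ h'
    simp only [Prod.mk.injEq] at heq h1 h2
    obtain ⟨h3, rfl⟩ := heq
    rw [h3] at h1
    obtain rfl : a = c := h1.symm.trans h2
    rfl
  · intro x hx
    have h2 := key x hx
    simp only [Finset.mem_sigma, mem_sifted] at hx
    simp only [h2]
    rw [if_pos hx.1.1.2]
  · intro x _
    split_ifs
    · exact mul_nonneg (hw _) vonMangoldt_nonneg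
    · exact le_rfl

open ArithmeticFunction in
/-- The number of integers up to `X` free of primes outside `Q`, weighted by `log X`, is at
most a constant times `X` times the sum of their reciprocals. -/
theorem card_sifted_mul_log_le (Q : ℕ → Prop) (X : ℕ) :
    ((sifted Q X).card : ℝ) * Real.log X ≤ (Real.log 4 + 5) * X * siftedHarmonic Q X := by
  have h1 : ∑ n ∈ sifted Q X, (1 : ℝ) * Real.log n ≤
      ∑ m ∈ sifted Q X, (Real.log 4 + 4) * (X / m : ℝ) := by
    refine (sum_sifted_mul_log_le fun _ => zero_le_one).trans (Finset.sum_le_sum fun m hm => ?_)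
    rw [mem_sifted] at hm
    refine le_trans ?_ (Chebyshev.psi_le_const_mul_self (by positivity))
    rw [Chebyshev.psi, ← Finset.sum_filter]
    simp only [one_mul]
    refine Finset.sum_le_sum_of_subset_of_nonneg (fun d hd => ?_) fun _ _ _ => vonMangoldt_nonneg
    simp only [Finset.mem_filter, mem_sifted] at hd
    rw [Finset.mem_Ioc, Nat.floor_div_eq_div, Nat.le_div_iff_mul_le hm.1.1, mul_comm]
    exact ⟨hd.1.1.1, hd.2⟩
  have h2 : ∀ n ∈ sifted Q X, Real.log X - Real.log n ≤ (X / n : ℝ) := by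
    intro n hn
    rw [mem_sifted] at hn
    have hn0 : (0 : ℝ) < n := by exact_mod_cast hn.1.1
    have hX0 : (0 : ℝ) < X := by exact_mod_cast hn.1.1.trans_le hn.1.2
    rw [← Real.log_div hX0.ne' hn0.ne']
    exact (Real.log_le_sub_one_of_pos (by positivity)).trans (by linarith)
  have h3 := Finset.sum_le_sum h2
  rw [Finset.sum_sub_distrib, Finset.sum_const, nsmul_eq_mul] at h3
  simp only [one_mul, ← Finset.mul_sum] at h1
  have h4 : ∑ n ∈ sifted Q X, (X / n : ℝ) = X * siftedHarmonic Q X := by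
    rw [siftedHarmonic, Finset.mul_sum]; rfl
  rw [h4] at h1 h3
  linarith

open ArithmeticFunction in
theorem sum_vonMangoldt_div_le (z : ℕ) :
    ∑ d ∈ Finset.Ioc 0 z, vonMangoldt d / d ≤ 2 * Real.log z := by
  rcases Nat.eq_zero_or_pos z with rfl | hz
  · simp
  have hz0 : (0 : ℝ) < z := by exact_mod_cast hz
  have h1 := sum_Ioc_mul_zeta_eq_sum vonMangoldt z
  rw [vonMangoldt_mul_zeta] at h1
  have h2 : ∑ n ∈ Finset.Ioc 0 z, log n ≤ z * Real.log z := by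
    calc ∑ n ∈ Finset.Ioc 0 z, log n ≤ ∑ n ∈ Finset.Ioc 0 z, Real.log z := by
          refine Finset.sum_le_sum fun n hn => ?_
          rw [Finset.mem_Ioc] at hn
          rw [log_apply]
          exact Real.log_le_log (by exact_mod_cast hn.1) (by exact_mod_cast hn.2)
      _ = z * Real.log z := by simp
  have h3 : z * ∑ d ∈ Finset.Ioc 0 z, vonMangoldt d / d ≤
      2 * ∑ d ∈ Finset.Ioc 0 z, vonMangoldt d * ((z / d : ℕ) : ℝ) := by
    rw [Finset.mul_sum, Finset.mul_sum]
    refine Finset.sum_le_sum fun d hd => ?_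
    rw [Finset.mem_Ioc] at hd
    have hd0 : (0 : ℝ) < d := by exact_mod_cast hd.1
    have h5 : z < d * (z / d + 1) := Nat.lt_mul_div_succ z hd.1
    have h6 : 1 ≤ z / d := (Nat.one_le_div_iff hd.1).2 hd.2
    have h7 : (z : ℝ) / d ≤ 2 * ((z / d : ℕ) : ℝ) := by
      rw [div_le_iff₀ hd0]
      have : z ≤ 2 * (z / d) * d := by nlinarith
      exact_mod_cast this
    calc (z : ℝ) * (vonMangoldt d / d) = vonMangoldt d * (z / d) := by ring
      _ ≤ vonMangoldt d * (2 * ((z / d : ℕ) : ℝ)) :=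
        mul_le_mul_of_nonneg_left h7 vonMangoldt_nonneg
      _ = _ := by ring
  rw [← h1] at h3
  refine le_of_mul_le_mul_left ?_ hz0
  linarith

theorem sum_Icc_pow_le {r : ℝ} (hr0 : 0 ≤ r) (hr : 2 * r ≤ 1) (Y : ℕ) :
    ∑ k ∈ Finset.Icc 1 Y, r ^ k ≤ 2 * r := by
  have h : ∑ k ∈ Finset.Icc 1 Y, r ^ k ≤ 2 * r - 2 * r ^ (Y + 1) := by
    induction Y with
    | zero => simp
    | succ n ih =>
      rw [Finset.sum_Icc_succ_top (by omega)]
      have h1 : 0 ≤ r ^ (n + 1) := by positivity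
      have h2 : r ^ (n + 1 + 1) = r ^ (n + 1) * r := pow_succ _ _
      nlinarith
  have : 0 ≤ r ^ (Y + 1) := by positivity
  linarith

open ArithmeticFunction in
theorem sum_sifted_vonMangoldt_div_le (z Y : ℕ) :
    ∑ d ∈ sifted (fun p => p ≤ z) Y, vonMangoldt d / d ≤ 4 * Real.log z := by
  have h1 : ∑ d ∈ sifted (fun p => p ≤ z) Y, vonMangoldt d / d =
      ∑ d ∈ sifted (fun p => p ≤ z) Y with IsPrimePow d, vonMangoldt d / d := by
    rw [Finset.sum_filter]
    refine Finset.sum_congr rfl fun d _ => ?_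
    split_ifs with h
    · rfl
    · rw [vonMangoldt_eq_zero_iff.2 h, zero_div]
  have h2 : ∑ d ∈ sifted (fun p => p ≤ z) Y with IsPrimePow d, vonMangoldt d / d ≤
      ∑ x ∈ {p ∈ Finset.Ioc 0 z | p.Prime} ×ˢ Finset.Icc 1 Y,
        Real.log x.1 * ((x.1 : ℝ)⁻¹) ^ x.2 := by
    refine sum_le_sum_of_injOn_of_le (fun d => (d.minFac, d.factorization d.minFac)) ?_ ?_ ?_ ?_
    · intro d hd
      simp only [Finset.mem_filter, mem_sifted] at hd
      obtain ⟨⟨⟨hd0, hdY⟩, hQ⟩, hpp⟩ := hd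
      have hp : d.minFac.Prime := Nat.minFac_prime hpp.ne_one
      have hpow := hpp.minFac_pow_factorization_eq
      simp only [Finset.mem_product, Finset.mem_filter, Finset.mem_Ioc, Finset.mem_Icc]
      refine ⟨⟨⟨hp.pos, hQ _ hp d.minFac_dvd⟩, hp⟩,
        (hp.dvd_iff_one_le_factorization hd0.ne').1 d.minFac_dvd, ?_⟩
      refine le_trans ?_ hdY
      conv_rhs => rw [← hpow]
      exact (Nat.lt_pow_self hp.one_lt).le
    · intro a ha b hb hab
      simp only [Finset.coe_filter, Set.mem_ofPred_eq] at ha hb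
      simp only [Prod.mk.injEq] at hab
      rw [← ha.2.minFac_pow_factorization_eq, ← hb.2.minFac_pow_factorization_eq, hab.2, hab.1]
    · intro d hd
      rw [Finset.mem_filter] at hd
      rw [vonMangoldt_apply, if_pos hd.2, inv_pow, div_eq_mul_inv]
      refine mul_le_mul_of_nonneg_left (le_of_eq ?_) (by positivity)
      rw [← Nat.cast_pow, hd.2.minFac_pow_factorization_eq]
    · intros
      positivity
  have h3 : ∀ p ∈ {p ∈ Finset.Ioc 0 z | p.Prime},
      ∑ k ∈ Finset.Icc 1 Y, Real.log p * ((p : ℝ)⁻¹) ^ k ≤ 2 * (vonMangoldt p / p) := by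
    intro p hp
    rw [Finset.mem_filter] at hp
    have hp2 : (2 : ℝ) ≤ p := by exact_mod_cast hp.2.two_le
    rw [← Finset.mul_sum, vonMangoldt_apply_prime hp.2]
    calc Real.log p * ∑ k ∈ Finset.Icc 1 Y, ((p : ℝ)⁻¹) ^ k
        ≤ Real.log p * (2 * (p : ℝ)⁻¹) := by
          refine mul_le_mul_of_nonneg_left (sum_Icc_pow_le (by positivity) ?_ Y) (by positivity)
          rw [← div_eq_mul_inv, div_le_one (by linarith)]
          exact hp2
      _ = _ := by ring
  rw [h1]
  refine h2.trans ?_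
  rw [Finset.sum_product]
  refine (Finset.sum_le_sum h3).trans ?_
  rw [← Finset.mul_sum]
  have h4 : ∑ p ∈ Finset.Ioc 0 z with p.Prime, vonMangoldt p / p ≤
      ∑ d ∈ Finset.Ioc 0 z, vonMangoldt d / d :=
    Finset.sum_le_sum_of_subset_of_nonneg (Finset.filter_subset _ _) fun d _ _ =>
      div_nonneg vonMangoldt_nonneg d.cast_nonneg
  linarith [sum_vonMangoldt_div_le z]

/-- The sum of the reciprocals of the `z`-smooth numbers is `O(log z)`. -/
theorem siftedHarmonic_smooth_le {z : ℕ} (hz : 2 ≤ z) (Y : ℕ) :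
    siftedHarmonic (fun p => p ≤ z) Y ≤ 20 * Real.log z := by
  have hlog2 : Real.log 2 ≤ Real.log z :=
    Real.log_le_log two_pos (by exact_mod_cast hz)
  have hl2 := Real.log_two_gt_d9
  have hlog : 0 < Real.log z := by linarith
  set H := siftedHarmonic (fun p => p ≤ z) Y with hH
  have h1 : ∑ n ∈ sifted (fun p => p ≤ z) Y, (n : ℝ)⁻¹ * Real.log n ≤ H * (4 * Real.log z) := by
    refine (sum_sifted_mul_log_le fun n => by positivity).trans ?_
    rw [hH, siftedHarmonic, Finset.sum_mul]
    refine Finset.sum_le_sum fun m _ => ?_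
    refine le_trans ?_ (mul_le_mul_of_nonneg_left (sum_sifted_vonMangoldt_div_le z Y)
      (by positivity))
    rw [Finset.mul_sum]
    refine Finset.sum_le_sum fun d _ => ?_
    have := ArithmeticFunction.vonMangoldt_nonneg (n := d)
    split_ifs
    · refine le_of_eq ?_
      push_cast
      rw [mul_inv]
      ring
    · positivity
  have h2 : H ≤ ∑ n ∈ Finset.Ioc 0 (z ^ 8), (n : ℝ)⁻¹ +
      (∑ n ∈ sifted (fun p => p ≤ z) Y, (n : ℝ)⁻¹ * Real.log n) / (8 * Real.log z) := by
    classical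
    have h3 : ∀ n ∈ sifted (fun p => p ≤ z) Y, (n : ℝ)⁻¹ ≤
        (if n ≤ z ^ 8 then (n : ℝ)⁻¹ else 0) + (n : ℝ)⁻¹ * Real.log n / (8 * Real.log z) := by
      intro n _
      split_ifs with hn
      · have : 0 ≤ (n : ℝ)⁻¹ * Real.log n / (8 * Real.log z) := by positivity
        linarith
      · rw [zero_add, le_div_iff₀ (by positivity)]
        refine mul_le_mul_of_nonneg_left ?_ (by positivity)
        have h4 : Real.log ((z : ℝ) ^ 8) ≤ Real.log n :=
          Real.log_le_log (by positivity) (by exact_mod_cast (not_le.1 hn).le)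
        rw [Real.log_pow] at h4
        exact_mod_cast h4
    refine (Finset.sum_le_sum h3).trans ?_
    rw [Finset.sum_add_distrib, ← Finset.sum_filter, Finset.sum_div]
    gcongr
    intro n hn
    rw [Finset.mem_filter, mem_sifted] at hn
    exact Finset.mem_Ioc.2 ⟨hn.1.1.1, hn.2⟩
  have h5 : ∑ n ∈ Finset.Ioc 0 (z ^ 8), (n : ℝ)⁻¹ ≤ 1 + 8 * Real.log z := by
    have h6 := harmonic_le_one_add_log (z ^ 8)
    rw [← siftedHarmonic_true, siftedHarmonic, sifted_true] at h6
    push_cast at h6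
    rw [Real.log_pow] at h6
    exact_mod_cast h6
  have h7 : (∑ n ∈ sifted (fun p => p ≤ z) Y, (n : ℝ)⁻¹ * Real.log n) / (8 * Real.log z) ≤
      H / 2 := by
    rw [div_le_iff₀ (by positivity)]
    linarith
  linarith

/-- Removing the primes in `(z, y]` saves a factor `log z / log y` in the harmonic sum. -/
theorem siftedHarmonic_gap_mul_log_le {z y : ℝ} (hz : 2 ≤ z) (hy : 1 ≤ y) {X : ℕ} (hX : X ≠ 0) :
    siftedHarmonic (fun p => ¬ (z < p ∧ p ≤ y)) X * Real.log y ≤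
      20 * Real.log z * (1 + Real.log X + Real.log y) := by
  set Q : ℕ → Prop := fun p => ¬ (z < p ∧ p ≤ y) with hQ
  set Y := ⌊y⌋₊ with hY
  have hY1 : 1 ≤ Y := Nat.le_floor (by exact_mod_cast hy)
  have hYy : (Y : ℝ) ≤ y := Nat.floor_le (by linarith)
  have hz2 : 2 ≤ ⌊z⌋₊ := Nat.le_floor (by exact_mod_cast hz)
  have hlogz : 0 ≤ Real.log z := Real.log_nonneg (by linarith)
  have h1 : Real.log y ≤ siftedHarmonic (fun _ => True) Y := by
    rw [siftedHarmonic_true]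
    refine le_trans ?_ (log_add_one_le_harmonic Y)
    exact Real.log_le_log (by linarith) (by exact_mod_cast (Nat.lt_floor_add_one y).le)
  have h2 : siftedHarmonic Q Y ≤ 20 * Real.log z := by
    refine le_trans (siftedHarmonic_mono_of_imp fun p _ hpY hp => ?_)
      ((siftedHarmonic_smooth_le hz2 Y).trans ?_)
    · by_contra h
      refine hp ⟨(Nat.floor_lt (by linarith)).1 (not_le.1 h), ?_⟩
      exact le_trans (by exact_mod_cast hpY) hYy
    · have : Real.log (⌊z⌋₊ : ℝ) ≤ Real.log z :=
        Real.log_le_log (by exact_mod_cast (by omega : 0 < ⌊z⌋₊)) (Nat.floor_le (by linarith))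
      linarith
  have h3 := le_siftedHarmonic_mul Q Y
  have h4 := siftedHarmonic_mul_le (Q := Q) (R := fun p => ¬ Q p) (fun p h h' => h' h) X Y
  have h5 : siftedHarmonic (fun _ => True) (X * Y) ≤ 1 + Real.log X + Real.log y := by
    rw [siftedHarmonic_true]
    refine (harmonic_le_one_add_log _).trans ?_
    have hX0 : (X : ℝ) ≠ 0 := by exact_mod_cast hX
    have hY0 : (0 : ℝ) < Y := by exact_mod_cast hY1
    push_cast
    rw [Real.log_mul hX0 hY0.ne']
    have := Real.log_le_log hY0 hYy
    linarith
  have hH := siftedHarmonic_nonneg Q X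
  have hH' := siftedHarmonic_nonneg (fun p => ¬ Q p) Y
  calc siftedHarmonic Q X * Real.log y
      ≤ siftedHarmonic Q X * (20 * Real.log z * siftedHarmonic (fun p => ¬ Q p) Y) := by
        refine mul_le_mul_of_nonneg_left (h1.trans (h3.trans ?_)) hH
        exact mul_le_mul_of_nonneg_right h2 hH'
    _ = 20 * Real.log z * (siftedHarmonic Q X * siftedHarmonic (fun p => ¬ Q p) Y) := by ring
    _ ≤ 20 * Real.log z * (1 + Real.log X + Real.log y) :=
        mul_le_mul_of_nonneg_left (h4.trans h5) (by positivity)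

/-- The integers up to `X ≥ √N (log N)⁻ᴬ` without a prime divisor in
`(exp((log N)^ρ), exp((log N)^{1-ρ})]` number `O(X (log N)^{2ρ-1})`. -/
theorem exists_card_sifted_le (A ρ : ℝ) (hρ0 : 0 < ρ) (hρ : ρ < 1 / 20) :
    ∃ C : ℝ, 0 < C ∧ ∀ N : ℝ, 3 ≤ N → ∀ X : ℕ,
      N ^ ((1 : ℝ) / 2) * Real.log N ^ (-A) ≤ X →
      ((sifted (fun p => ¬ (Real.exp (Real.log N ^ ρ) < p ∧
        p ≤ Real.exp (Real.log N ^ (1 - ρ)))) X).card : ℝ) ≤ C * X * Real.log N ^ (2 * ρ - 1) := by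
  have hev : ∀ᶠ N : ℝ in Filter.atTop, Real.log N ^ A ≤ N ^ ((1 : ℝ) / 4) := by
    have := (isLittleO_log_rpow_rpow_atTop A (s := (1 : ℝ) / 4) (by norm_num)).bound
      (c := 1) one_pos
    filter_upwards [this, Filter.eventually_ge_atTop 1] with N hN hN1
    rw [one_mul, Real.norm_of_nonneg (Real.rpow_nonneg (Real.log_nonneg hN1) _),
      Real.norm_of_nonneg (Real.rpow_nonneg (by linarith) _)] at hN
    exact hN
  obtain ⟨N₀, hN₀⟩ := Filter.eventually_atTop.1 hev
  have hM : 3 ≤ max N₀ 3 := le_max_right _ _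
  have hlM : 1 < Real.log (max N₀ 3) :=
    lt_of_lt_of_le (by rw [Real.lt_log_iff_exp_lt (by norm_num)]; exact Real.exp_one_lt_three)
      (Real.log_le_log (by norm_num) hM)
  refine ⟨max ((Real.log 4 + 5) * 180) (Real.log (max N₀ 3)), lt_max_of_lt_right (by linarith),
    fun N hN X hX => ?_⟩
  have hL1 : 1 < Real.log N :=
    lt_of_lt_of_le (by rw [Real.lt_log_iff_exp_lt (by norm_num)]; exact Real.exp_one_lt_three)
      (Real.log_le_log (by norm_num) hN)
  set L := Real.log N with hL
  have hL0 : 0 < L := by linarith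
  have hN0 : 0 < N := by linarith
  have hpow : 0 < L ^ (2 * ρ - 1) := Real.rpow_pos_of_pos hL0 _
  set Q : ℕ → Prop := fun p => ¬ (Real.exp (L ^ ρ) < p ∧ p ≤ Real.exp (L ^ (1 - ρ)))
  have hcardX : ((sifted Q X).card : ℝ) ≤ X := by
    have : (sifted Q X).card ≤ (Finset.Ioc 0 X).card :=
      Finset.card_le_card fun n hn => Finset.mem_Ioc.2 (mem_sifted.1 hn).1
    rw [Nat.card_Ioc, Nat.sub_zero] at this
    exact_mod_cast this
  by_cases hcase : N₀ ≤ N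
  · have h1 := hN₀ N hcase
    have hXlow : N ^ ((1 : ℝ) / 4) ≤ X := by
      refine le_trans ?_ hX
      rw [Real.rpow_neg hL0.le, ← div_eq_mul_inv, le_div_iff₀ (Real.rpow_pos_of_pos hL0 _)]
      calc N ^ ((1 : ℝ) / 4) * L ^ A ≤ N ^ ((1 : ℝ) / 4) * N ^ ((1 : ℝ) / 4) :=
            mul_le_mul_of_nonneg_left h1 (by positivity)
        _ = N ^ ((1 : ℝ) / 2) := by rw [← Real.rpow_add hN0]; norm_num
    have hX0 : (0 : ℝ) < X := lt_of_lt_of_le (by positivity) hXlow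
    have hlogX : L / 4 ≤ Real.log X := by
      have := Real.log_le_log (by positivity) hXlow
      rw [Real.log_rpow hN0] at this
      linarith
    have hXn : X ≠ 0 := by rintro rfl; simp at hX0
    have hz1 : 1 ≤ L ^ ρ := Real.one_le_rpow hL1.le hρ0.le
    have hy1 : 1 ≤ L ^ (1 - ρ) := Real.one_le_rpow hL1.le (by linarith)
    have hyL : L ^ (1 - ρ) ≤ L := by
      conv_rhs => rw [← Real.rpow_one L]
      exact Real.rpow_le_rpow_of_exponent_le hL1.le (by linarith)
    have h2 := siftedHarmonic_gap_mul_log_le (z := Real.exp (L ^ ρ)) (y := Real.exp (L ^ (1 - ρ)))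
      (by linarith [Real.add_one_le_exp (L ^ ρ)]) (Real.one_le_exp (by linarith)) hXn
    rw [Real.log_exp, Real.log_exp] at h2
    have h3 := card_sifted_mul_log_le Q X
    have h4 : siftedHarmonic Q X ≤ 180 * Real.log X * L ^ (2 * ρ - 1) := by
      have h5 : L ^ (2 * ρ - 1) * L ^ (1 - ρ) = L ^ ρ := by
        rw [← Real.rpow_add hL0]; ring_nf
      refine le_of_mul_le_mul_right ?_ (by linarith : 0 < L ^ (1 - ρ))
      calc siftedHarmonic Q X * L ^ (1 - ρ)
          ≤ 20 * L ^ ρ * (1 + Real.log X + L ^ (1 - ρ)) := h2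
        _ ≤ 20 * L ^ ρ * (9 * Real.log X) := by gcongr; linarith
        _ = 180 * Real.log X * (L ^ (2 * ρ - 1) * L ^ (1 - ρ)) := by rw [h5]; ring
        _ = _ := by ring
    have hlogXpos : 0 < Real.log X := by linarith
    have h6 : ((sifted Q X).card : ℝ) ≤ (Real.log 4 + 5) * 180 * X * L ^ (2 * ρ - 1) := by
      refine le_of_mul_le_mul_right ?_ hlogXpos
      have hl4 : 0 ≤ Real.log 4 := Real.log_nonneg (by norm_num)
      calc ((sifted Q X).card : ℝ) * Real.log X ≤ (Real.log 4 + 5) * X * siftedHarmonic Q X := h3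
        _ ≤ (Real.log 4 + 5) * X * (180 * Real.log X * L ^ (2 * ρ - 1)) := by gcongr
        _ = _ := by ring
    refine h6.trans ?_
    gcongr
    exact le_max_left _ _
  · have hLM : L ≤ Real.log (max N₀ 3) :=
      Real.log_le_log hN0 (le_max_of_le_left (not_le.1 hcase).le)
    have h7 : 1 ≤ Real.log (max N₀ 3) * L ^ (2 * ρ - 1) := by
      calc (1 : ℝ) ≤ L ^ (2 * ρ) := Real.one_le_rpow hL1.le (by linarith)
        _ = L * L ^ (2 * ρ - 1) := by rw [Real.rpow_sub_one hL0.ne']; field_simp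
        _ ≤ _ := by gcongr
    calc ((sifted Q X).card : ℝ) ≤ X * 1 := by rw [mul_one]; exact hcardX
      _ ≤ X * (Real.log (max N₀ 3) * L ^ (2 * ρ - 1)) := by gcongr
      _ = Real.log (max N₀ 3) * X * L ^ (2 * ρ - 1) := by ring
      _ ≤ _ := by gcongr; exact le_max_right _ _

theorem sum_inv_Ico_le {a b : ℕ} (ha : 0 < a) (hab : a ≤ b) :
    ∑ n ∈ Finset.Ico a b, (n : ℝ)⁻¹ ≤ 2 * (Real.log b - Real.log a) := by
  induction b, hab using Nat.le_induction with
  | base => simp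
  | succ n hn ih =>
    rw [Finset.sum_Ico_succ_top hn]
    have hn1 : (1 : ℝ) ≤ n := by exact_mod_cast ha.trans_le hn
    have h1 := Real.one_sub_inv_le_log_of_pos (x := ((n : ℝ) + 1) / n) (by positivity)
    rw [Real.log_div (by positivity) (by positivity)] at h1
    have h2 : (n : ℝ)⁻¹ ≤ 2 * (1 - (((n : ℝ) + 1) / n)⁻¹) := by
      rw [inv_div, one_sub_div (by positivity), ← sub_nonneg]
      have : 2 * (((n : ℝ) + 1 - n) / (n + 1)) - (n : ℝ)⁻¹ = (n - 1) / (n * (n + 1)) := by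
        field_simp
        ring
      rw [this]
      exact div_nonneg (by linarith) (by positivity)
    push_cast
    linarith

theorem measurableSet_setOf_linear_le {u w c : ℝ} :
    MeasurableSet {x : ℝ | 0 ≤ x * u - w ∧ x * u - w ≤ c} := by
  have h : Measurable fun x : ℝ => x * u - w := by fun_prop
  exact (measurableSet_le measurable_const h).inter (measurableSet_le h measurable_const)

theorem volume_setOf_linear_le {u w c : ℝ} (hu : u ≠ 0) :
    volume {x : ℝ | 0 ≤ x * u - w ∧ x * u - w ≤ c} ≤ ENNReal.ofReal (c / |u|) := by
  rcases lt_or_gt_of_ne hu with h | h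
  · refine (measure_mono (t := Set.Icc ((w + c) / u) (w / u)) fun x hx => ?_).trans ?_
    · exact ⟨by rw [div_le_iff_of_neg h]; linarith [hx.2], by
        rw [le_div_iff_of_neg h]; linarith [hx.1]⟩
    · rw [Real.volume_Icc, abs_of_neg h]
      refine ENNReal.ofReal_le_ofReal (le_of_eq ?_)
      rw [div_neg]
      ring
  · refine (measure_mono (t := Set.Icc (w / u) ((w + c) / u)) fun x hx => ?_).trans ?_
    · exact ⟨by rw [div_le_iff₀ h]; linarith [hx.1], by
        rw [le_div_iff₀ h]; linarith [hx.2]⟩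
    · rw [Real.volume_Icc, abs_of_pos h]
      refine ENNReal.ofReal_le_ofReal (le_of_eq ?_)
      ring

open Classical in
/-- Markov's inequality for the number of sets `I j` containing a point. -/
theorem Rmeasure_le_of_card {ι : Type*} {J : Finset ι} {I : ι → Set ℝ} {v : ι → ℝ}
    {E : Set ℝ} {a τ : ℝ} (ha : 0 < a) (hτ : 0 < τ) (hEa : ∀ x ∈ E, a ≤ x)
    (hI : ∀ j ∈ J, MeasurableSet (I j)) (hv0 : ∀ j ∈ J, 0 ≤ v j)
    (hv : ∀ j ∈ J, volume (I j) ≤ ENNReal.ofReal (v j))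
    (hE : ∀ x ∈ E, τ ≤ (({j ∈ J | x ∈ I j}).card : ℝ)) :
    Rmeasure E ≤ ENNReal.ofReal (a⁻¹ * ((∑ j ∈ J, v j) / τ)) := by
  set f : ℝ → ENNReal := fun x => ∑ j ∈ J, (I j).indicator 1 x with hf
  have hfm : Measurable f :=
    Finset.measurable_fun_sum _ fun j hj => measurable_one.indicator (hI j hj)
  have hf' : ∀ x, f x = (({j ∈ J | x ∈ I j}).card : ENNReal) := by
    intro x
    simp [hf, Set.indicator_apply, Finset.sum_boole]
  set G : Set ℝ := Set.Ici a ∩ {x | ENNReal.ofReal τ ≤ f x} with hG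
  have hGm : MeasurableSet G := measurableSet_Ici.inter (measurableSet_le measurable_const hfm)
  have hEG : E ⊆ G := fun x hx => ⟨hEa x hx, by
    change ENNReal.ofReal τ ≤ f x
    rw [hf', ← ENNReal.ofReal_natCast]
    exact ENNReal.ofReal_le_ofReal (hE x hx)⟩
  have h1 : Rmeasure G ≤ ENNReal.ofReal a⁻¹ * volume G := by
    rw [Rmeasure, withDensity_apply _ hGm, ← setLIntegral_const]
    refine setLIntegral_mono measurable_const fun x hx => ENNReal.ofReal_le_ofReal ?_
    rw [one_div]
    exact inv_anti₀ ha hx.1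
  have h2 : ∫⁻ x, f x ≤ ENNReal.ofReal (∑ j ∈ J, v j) := by
    rw [hf, lintegral_finsetSum' _ fun j hj => (measurable_one.indicator (hI j hj)).aemeasurable,
      ENNReal.ofReal_sum_of_nonneg hv0]
    refine Finset.sum_le_sum fun j hj => ?_
    rw [lintegral_indicator_one (hI j hj)]
    exact hv j hj
  have hτ' : ENNReal.ofReal τ ≠ 0 := by simpa using hτ
  have h3 : volume G ≤ ENNReal.ofReal ((∑ j ∈ J, v j) / τ) := by
    refine (measure_mono Set.inter_subset_right).trans
      ((meas_ge_le_lintegral_div hfm.aemeasurable hτ' ENNReal.ofReal_ne_top).trans ?_)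
    rw [ENNReal.ofReal_div_of_pos hτ]
    gcongr
  calc Rmeasure E ≤ Rmeasure G := measure_mono hEG
    _ ≤ ENNReal.ofReal a⁻¹ * volume G := h1
    _ ≤ ENNReal.ofReal a⁻¹ * ENNReal.ofReal ((∑ j ∈ J, v j) / τ) := by gcongr
    _ = _ := (ENNReal.ofReal_mul (by positivity)).symm

theorem exists_subset_Icc_of_isCompact {R : Set ℝ} (hc : IsCompact R) (hR : R ⊆ Set.Ioi 0) :
    ∃ a b : ℝ, 0 < a ∧ 0 < b ∧ R ⊆ Set.Icc a b := by
  rcases R.eq_empty_or_nonempty with rfl | hne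
  · exact ⟨1, 1, one_pos, one_pos, Set.empty_subset _⟩
  · obtain ⟨a, ha⟩ := hc.exists_isLeast hne
    obtain ⟨b, hb⟩ := hc.exists_isGreatest hne
    exact ⟨a, b, hR ha.1, hR hb.1, fun x hx => ⟨ha.2 hx, hb.2 hx⟩⟩

/-- The primes outside the interval defining `memS`. -/
def outsideGap (ρ N : ℝ) (p : ℕ) : Prop :=
  ¬ (Real.exp (Real.log N ^ ρ) < p ∧ p ≤ Real.exp (Real.log N ^ (1 - ρ)))

theorem natAbs_mem_sifted {ρ N : ℝ} {t : ℤ} {M : ℕ} (h0 : t ≠ 0) (hM : t.natAbs ≤ M)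
    (hS : ¬ memS ρ N t) : t.natAbs ∈ sifted (outsideGap ρ N) M :=
  mem_sifted.2 ⟨⟨Int.natAbs_pos.2 h0, hM⟩, fun p hp hd h =>
    hS ⟨p, hp, Int.natCast_dvd.2 hd, h.1, h.2⟩⟩

open Classical in
/-- Pairs of signs together with the absolute values `(|t₁|, |t₂|, |t₄|, |t₃|)` of the quadruples
that may be counted by `T2set`, where `|t₃||t₄| ≤ B|t₁||t₂|`. -/
noncomputable def quadIndex (ρ N U B : ℝ) (M : ℕ) : Finset ((ℤ × ℤ) × ℕ × ℕ × ℕ × ℕ) :=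
  (({1, -1} : Finset ℤ) ×ˢ ({1, -1} : Finset ℤ)) ×ˢ
    {q ∈ sifted (outsideGap ρ N) M ×ˢ sifted (outsideGap ρ N) M ×ˢ
        {n ∈ Finset.Ioc 0 M | U ≤ ((n : ℕ) : ℝ)} ×ˢ sifted (outsideGap ρ N) M |
      U ≤ (q.2.2.2 : ℝ) ∧ (q.2.2.2 : ℝ) * q.2.2.1 ≤ B * q.1 * q.2.1}

/-- The quadruple with the given signs and absolute values. -/
def quadOfIndex (j : (ℤ × ℤ) × ℕ × ℕ × ℕ × ℕ) : Fin 4 → ℤ :=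
  ![j.1.1 * j.2.1, j.2.2.1, j.1.2 * j.2.2.2.2, j.2.2.2.1]

open Classical in
theorem sum_quadIndex_le {ρ N U B c D : ℝ} {M : ℕ} (hB : 0 ≤ B) (hc : 0 ≤ c) (hD : 0 ≤ D)
    (hcard : ∀ X : ℕ, U ≤ X → ((sifted (outsideGap ρ N) X).card : ℝ) ≤ D * X) :
    ∑ j ∈ quadIndex ρ N U B M, c / ((j.2.1 : ℝ) * j.2.2.1) ≤
      4 * (((sifted (outsideGap ρ N) M).card : ℝ) ^ 2 *
        (c * D * B * ∑ n ∈ Finset.Ioc 0 M with U ≤ ((n : ℕ) : ℝ), (n : ℝ)⁻¹)) := by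
  set S := sifted (outsideGap ρ N) M with hS
  rw [quadIndex, Finset.sum_product]
  have hinner : ∀ n₁ ∈ S, ∀ n₂ ∈ S, ∀ n₄ ∈ {n ∈ Finset.Ioc 0 M | U ≤ ((n : ℕ) : ℝ)},
      (∑ n₃ ∈ S, if U ≤ (n₃ : ℝ) ∧ (n₃ : ℝ) * n₄ ≤ B * n₁ * n₂ then c / ((n₁ : ℝ) * n₂) else 0) ≤
        c * D * B * (n₄ : ℝ)⁻¹ := by
    intro n₁ h₁ n₂ h₂ n₄ h₄
    rw [hS, mem_sifted] at h₁ h₂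
    rw [Finset.mem_filter, Finset.mem_Ioc] at h₄
    have h1 : (0 : ℝ) < n₁ := by exact_mod_cast h₁.1.1
    have h2 : (0 : ℝ) < n₂ := by exact_mod_cast h₂.1.1
    have h4 : (0 : ℝ) < n₄ := by exact_mod_cast h₄.1.1
    rw [← Finset.sum_filter, Finset.sum_const, nsmul_eq_mul]
    set F := S.filter (fun n₃ : ℕ => U ≤ (n₃ : ℝ) ∧ (n₃ : ℝ) * n₄ ≤ B * n₁ * n₂) with hF
    set x : ℝ := B * n₁ * n₂ / n₄ with hx
    have hx0 : 0 ≤ x := by positivity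
    have hFx : ((F.card : ℕ) : ℝ) ≤ D * x := by
      rcases F.eq_empty_or_nonempty with h | ⟨m, hm⟩
      · rw [h, Finset.card_empty, Nat.cast_zero]
        positivity
      · have hsub : F ⊆ sifted (outsideGap ρ N) ⌊x⌋₊ := by
          intro n hn
          rw [hF, Finset.mem_filter, hS, mem_sifted] at hn
          rw [mem_sifted]
          exact ⟨⟨hn.1.1.1, Nat.le_floor ((le_div_iff₀ h4).2 hn.2.2)⟩, hn.1.2⟩
        have hUx : U ≤ (⌊x⌋₊ : ℝ) := by
          have hm' := (mem_sifted.1 (hsub hm)).1.2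
          rw [hF, Finset.mem_filter] at hm
          exact hm.2.1.trans (by exact_mod_cast hm')
        calc ((F.card : ℕ) : ℝ) ≤ ((sifted (outsideGap ρ N) ⌊x⌋₊).card : ℝ) := by
              exact_mod_cast Finset.card_le_card hsub
          _ ≤ D * ⌊x⌋₊ := hcard _ hUx
          _ ≤ D * x := mul_le_mul_of_nonneg_left (Nat.floor_le hx0) hD
    calc (F.card : ℝ) * (c / (n₁ * n₂)) ≤ D * x * (c / (n₁ * n₂)) := by gcongr
      _ = c * D * B * (n₄ : ℝ)⁻¹ := by rw [hx]; field_simp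
  have hsum : ∑ q ∈ S ×ˢ S ×ˢ {n ∈ Finset.Ioc 0 M | U ≤ ((n : ℕ) : ℝ)} ×ˢ S with
      U ≤ (q.2.2.2 : ℝ) ∧ (q.2.2.2 : ℝ) * q.2.2.1 ≤ B * q.1 * q.2.1,
        c / ((q.1 : ℝ) * q.2.1) ≤ (S.card : ℝ) ^ 2 *
          (c * D * B * ∑ n ∈ Finset.Ioc 0 M with U ≤ ((n : ℕ) : ℝ), (n : ℝ)⁻¹) := by
    rw [Finset.sum_filter, Finset.sum_product]
    simp only [Finset.sum_product]
    calc _ ≤ ∑ n₁ ∈ S, ∑ n₂ ∈ S, ∑ n ∈ Finset.Ioc 0 M with U ≤ ((n : ℕ) : ℝ),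
          c * D * B * (n : ℝ)⁻¹ :=
        Finset.sum_le_sum fun n₁ h₁ => Finset.sum_le_sum fun n₂ h₂ =>
          Finset.sum_le_sum fun n₄ h₄ => hinner n₁ h₁ n₂ h₂ n₄ h₄
      _ = _ := by
        simp only [Finset.sum_const, nsmul_eq_mul, ← Finset.mul_sum]
        ring
  dsimp only
  rw [Finset.sum_const, nsmul_eq_mul]
  refine le_trans (le_of_eq ?_) (mul_le_mul_of_nonneg_left hsum (by norm_num : (0 : ℝ) ≤ 4))
  congr 1

open Classical in
theorem ncard_T2set_le {Cc ρ A α N Δ a b Cd K B : ℝ} (ha : 0 < a) (haα : a ≤ α) (hαb : α ≤ b)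
    (hN : 3 ≤ N) (hCc : 1 ≤ Cc) (hΔ : Δ ≤ Cd) (hK0 : 0 ≤ K)
    (hK : 4 * Cc ≤ K ^ 2) (hKa : 4 * Cc ≤ a * K ^ 2) (hCd : 0 < Cd) (hB : b + Cc * Cd ≤ B) :
    (T2set Cc ρ A α N Δ).ncard ≤
      ({j ∈ quadIndex ρ N (N ^ ((1 : ℝ) / 2) * Real.log N ^ (-A)) B ⌊K * N ^ ((1 : ℝ) / 2)⌋₊ |
        α ∈ {x : ℝ | 0 ≤ x * ((quadOfIndex j 0 : ℝ) * quadOfIndex j 1) -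
              (quadOfIndex j 2 : ℝ) * quadOfIndex j 3 ∧
            x * ((quadOfIndex j 0 : ℝ) * quadOfIndex j 1) -
              (quadOfIndex j 2 : ℝ) * quadOfIndex j 3 ≤ Cc * Δ}}).card := by
  set U := N ^ ((1 : ℝ) / 2) * Real.log N ^ (-A) with hU
  have hN0 : 0 < N := by linarith
  have hL0 : 0 < Real.log N := Real.log_pos (by linarith)
  have hU0 : 0 < U := mul_pos (Real.rpow_pos_of_pos hN0 _) (Real.rpow_pos_of_pos hL0 _)
  have hsq : (K * N ^ ((1 : ℝ) / 2)) ^ 2 = K ^ 2 * N := by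
    rw [mul_pow, ← Real.sqrt_eq_rpow, Real.sq_sqrt hN0.le]
  have hα : 0 < α := ha.trans_le haα
  refine le_trans ?_ (Finset.card_image_le (f := quadOfIndex))
  rw [← Set.ncard_coe_finset]
  refine Set.ncard_le_ncard ?_ (Finset.finite_toSet _)
  rintro t ⟨-, h01, h23, hp, hm, hlo, hhi, hbig, hs0, hs1, hs2⟩
  have hne : ∀ i, t i ≠ 0 := fun i h => by
    have := hbig i
    rw [h, Int.cast_zero, abs_zero] at this
    linarith
  have hone : ∀ i, (1 : ℝ) ≤ |(t i : ℝ)| := fun i => by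
    rw [← Int.cast_abs]
    exact_mod_cast Int.one_le_abs (hne i)
  have habs : ∀ i, ((t i).natAbs : ℝ) = |(t i : ℝ)| := fun i => by
    rw [Nat.cast_natAbs, Int.cast_abs]
  have hsmall : ∀ i, (t i : ℝ) ^ 2 ≤ K ^ 2 * N := by
    have h1 : α * (t 0 : ℝ) ^ 2 + α * (t 1 : ℝ) ^ 2 + (t 2 : ℝ) ^ 2 + (t 3 : ℝ) ^ 2 ≤
        4 * Cc * N := by nlinarith
    have e : ∀ i, 0 ≤ (t i : ℝ) ^ 2 := fun i => sq_nonneg _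
    have e' : ∀ i, 0 ≤ α * (t i : ℝ) ^ 2 := fun i => mul_nonneg hα.le (e i)
    have e'' : ∀ i, a * (t i : ℝ) ^ 2 ≤ α * (t i : ℝ) ^ 2 := fun i =>
      mul_le_mul_of_nonneg_right haα (e i)
    have h2 : 4 * Cc * N ≤ K ^ 2 * N := mul_le_mul_of_nonneg_right hK hN0.le
    have h3 : 4 * Cc * N ≤ a * K ^ 2 * N := mul_le_mul_of_nonneg_right hKa hN0.le
    have e0 := e 0; have e1 := e 1; have e2 := e 2; have e3 := e 3
    have e0' := e' 0; have e1' := e' 1; have e0'' := e'' 0; have e1'' := e'' 1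
    intro i
    fin_cases i
    · exact le_of_mul_le_mul_left (by simp only [Fin.zero_eta]; linarith) ha
    · exact le_of_mul_le_mul_left (by simp only [Fin.mk_one]; linarith) ha
    · simp only [Fin.reduceFinMk]; linarith
    · simp only [Fin.reduceFinMk]; linarith
  have hM : ∀ i, (t i).natAbs ≤ ⌊K * N ^ ((1 : ℝ) / 2)⌋₊ := fun i => by
    refine Nat.le_floor ?_
    rw [habs]
    refine abs_le_of_sq_le_sq' ?_ (by positivity) |> abs_le.2
    rw [hsq]
    exact hsmall i
  have h1pos : 0 < t 1 := (abs_nonneg _).trans_lt h01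
  have h3pos : 0 < t 3 := lt_of_le_of_ne ((abs_nonneg _).trans h23) (hne 3).symm
  have hprod : |(t 2 : ℝ)| * |(t 3 : ℝ)| ≤ B * |(t 0 : ℝ)| * |(t 1 : ℝ)| := by
    have h4 : |(t 2 : ℝ) * t 3| ≤ α * |(t 0 : ℝ) * t 1| + Cc * Δ := by
      have h5 : (t 2 : ℝ) * t 3 = α * ((t 0 : ℝ) * t 1) - (α * t 0 * t 1 - t 2 * t 3) := by ring
      rw [h5]
      refine (abs_sub _ _).trans ?_
      rw [abs_mul α, abs_of_pos hα, abs_of_nonneg hlo]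
      gcongr
    rw [abs_mul, abs_mul] at h4
    have h6 : 1 ≤ |(t 0 : ℝ)| * |(t 1 : ℝ)| := one_le_mul_of_one_le_of_one_le (hone 0) (hone 1)
    have h7 : Cc * Δ ≤ Cc * Cd := mul_le_mul_of_nonneg_left hΔ (by linarith)
    have h8 : 0 < Cc * Cd := by positivity
    calc |(t 2 : ℝ)| * |(t 3 : ℝ)| ≤ α * (|(t 0 : ℝ)| * |(t 1 : ℝ)|) + Cc * Δ := h4
      _ ≤ b * (|(t 0 : ℝ)| * |(t 1 : ℝ)|) + Cc * Cd * (|(t 0 : ℝ)| * |(t 1 : ℝ)|) :=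
        add_le_add (by gcongr) (h7.trans (le_mul_of_one_le_right h8.le h6))
      _ = (b + Cc * Cd) * (|(t 0 : ℝ)| * |(t 1 : ℝ)|) := by ring
      _ ≤ B * (|(t 0 : ℝ)| * |(t 1 : ℝ)|) := by gcongr
      _ = _ := by ring
  set j : (ℤ × ℤ) × ℕ × ℕ × ℕ × ℕ := (((t 0).sign, (t 2).sign), (t 0).natAbs, (t 1).natAbs,
    (t 3).natAbs, (t 2).natAbs) with hj
  have hjt : quadOfIndex j = t := by
    funext i
    fin_cases i
    · simpa [quadOfIndex, hj] using Int.sign_mul_abs (t 0)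
    · simpa [quadOfIndex, hj] using h1pos.le
    · simpa [quadOfIndex, hj] using Int.sign_mul_abs (t 2)
    · simpa [quadOfIndex, hj] using h3pos.le
  have hsign : ∀ i, (t i).sign = 1 ∨ (t i).sign = -1 := fun i => by
    rcases lt_or_gt_of_ne (hne i) with h | h
    · exact Or.inr (Int.sign_eq_neg_one_of_neg h)
    · exact Or.inl (Int.sign_eq_one_of_pos h)
  refine Finset.mem_coe.2 (Finset.mem_image.2 ⟨j, Finset.mem_filter.2 ⟨?_, ?_⟩, hjt⟩)
  · simp only [quadIndex, hj, Finset.mem_product, Finset.mem_insert, Finset.mem_singleton,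
      Finset.mem_filter, Finset.mem_Ioc, habs]
    exact ⟨⟨hsign 0, hsign 2⟩, ⟨natAbs_mem_sifted (hne 0) (hM 0) hs0,
      natAbs_mem_sifted (hne 1) (hM 1) hs1, ⟨⟨Int.natAbs_pos.2 (hne 3), hM 3⟩, hbig 3⟩,
      natAbs_mem_sifted (hne 2) (hM 2) hs2⟩, hbig 2, hprod⟩
  · rw [hjt]
    refine ⟨?_, ?_⟩
    · rw [← mul_assoc]; exact hlo
    · rw [← mul_assoc]; exact hhi

theorem volume_quadOfIndex_le {ρ N U B c : ℝ} {M : ℕ} {j : (ℤ × ℤ) × ℕ × ℕ × ℕ × ℕ}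
    (hj : j ∈ quadIndex ρ N U B M) :
    volume {x : ℝ | 0 ≤ x * ((quadOfIndex j 0 : ℝ) * quadOfIndex j 1) -
          (quadOfIndex j 2 : ℝ) * quadOfIndex j 3 ∧
        x * ((quadOfIndex j 0 : ℝ) * quadOfIndex j 1) -
          (quadOfIndex j 2 : ℝ) * quadOfIndex j 3 ≤ c} ≤
      ENNReal.ofReal (c / ((j.2.1 : ℝ) * j.2.2.1)) := by
  obtain ⟨⟨s₁, s₃⟩, n₁, n₂, n₄, n₃⟩ := j
  simp only [quadIndex, Finset.mem_product, Finset.mem_insert, Finset.mem_singleton,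
    Finset.mem_filter, mem_sifted] at hj
  obtain ⟨⟨hs, -⟩, ⟨h1, h2, -⟩, -⟩ := hj
  have h1 : (0 : ℝ) < n₁ := by exact_mod_cast h1.1.1
  have h2 : (0 : ℝ) < n₂ := by exact_mod_cast h2.1.1
  have habs : |((quadOfIndex ((s₁, s₃), n₁, n₂, n₄, n₃) 0 : ℝ) *
      quadOfIndex ((s₁, s₃), n₁, n₂, n₄, n₃) 1)| = (n₁ : ℝ) * n₂ := by
    rcases hs with rfl | rfl <;> simp [quadOfIndex]
  rw [← habs]
  refine volume_setOf_linear_le fun h => ?_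
  rw [h, abs_zero] at habs
  exact (mul_pos h1 h2).ne habs

theorem sum_inv_filter_le {A K N : ℝ} (hA : 0 ≤ A) (hK : 1 ≤ K) (hN : 3 ≤ N) :
    ∑ n ∈ Finset.Ioc 0 ⌊K * N ^ ((1 : ℝ) / 2)⌋₊ with
      N ^ ((1 : ℝ) / 2) * Real.log N ^ (-A) ≤ ((n : ℕ) : ℝ), (n : ℝ)⁻¹ ≤
        2 * (Real.log (2 * K) + A * Real.log (Real.log N)) := by
  have hN0 : 0 < N := by linarith
  have hL1 : 1 < Real.log N :=
    lt_of_lt_of_le (by rw [Real.lt_log_iff_exp_lt (by norm_num)]; exact Real.exp_one_lt_three)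
      (Real.log_le_log (by norm_num) hN)
  have hL0 : 0 < Real.log N := by linarith
  set s := N ^ ((1 : ℝ) / 2) with hs
  have hs1 : 1 ≤ s := Real.one_le_rpow (by linarith) (by norm_num)
  have hLA : 0 < Real.log N ^ (-A) := Real.rpow_pos_of_pos hL0 _
  have hLA1 : Real.log N ^ (-A) ≤ 1 := Real.rpow_le_one_of_one_le_of_nonpos hL1.le (by linarith)
  set U := s * Real.log N ^ (-A) with hU
  have hU0 : 0 < U := by positivity
  have hsK : s ≤ K * s := by nlinarith
  have hUK : U ≤ ((⌊K * s⌋₊ + 1 : ℕ) : ℝ) := by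
    have : K * s < ⌊K * s⌋₊ + 1 := Nat.lt_floor_add_one _
    push_cast
    nlinarith
  have hceil : 0 < ⌈U⌉₊ := Nat.ceil_pos.2 hU0
  have h1 : ∑ n ∈ Finset.Ioc 0 ⌊K * s⌋₊ with U ≤ ((n : ℕ) : ℝ), (n : ℝ)⁻¹ ≤
      ∑ n ∈ Finset.Ico ⌈U⌉₊ (⌊K * s⌋₊ + 1), (n : ℝ)⁻¹ := by
    refine Finset.sum_le_sum_of_subset_of_nonneg (fun n hn => ?_) fun _ _ _ => by positivity
    rw [Finset.mem_filter, Finset.mem_Ioc] at hn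
    exact Finset.mem_Ico.2 ⟨Nat.ceil_le.2 hn.2, Nat.lt_succ_of_le hn.1.2⟩
  refine h1.trans ((sum_inv_Ico_le hceil (Nat.ceil_le.2 hUK)).trans ?_)
  have h2 : Real.log ((⌊K * s⌋₊ + 1 : ℕ) : ℝ) ≤ Real.log (2 * K) + Real.log s := by
    rw [← Real.log_mul (by positivity) (by positivity)]
    refine Real.log_le_log (by positivity) ?_
    have : (⌊K * s⌋₊ : ℝ) ≤ K * s := Nat.floor_le (by positivity)
    push_cast
    nlinarith
  have h3 : Real.log s - A * Real.log (Real.log N) ≤ Real.log ⌈U⌉₊ := by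
    calc Real.log s - A * Real.log (Real.log N) = Real.log U := by
          rw [hU, Real.log_mul (by positivity) hLA.ne', Real.log_rpow hL0]
          ring
      _ ≤ _ := Real.log_le_log hU0 (Nat.le_ceil U)
  linarith

/-- **Bound on the count `𝒯₂` of quadruples avoiding `S_ρ(N)`.** For `A > 10`,
`0 < ρ < 1/20`, compact `ℛ₀ ⊂ ℝ_{>0}`, uniformly for `N^{-1+η} ≤ Δ ≪ 1`, the measure of
the set of `α ∈ ℛ₀` with `𝒯₂(α) > ΔN/2` is `≪ (log log N)⁴ (log N)^{6ρ-3}`. -/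
theorem T2_measure_bound (A ρ η Cc Cd : ℝ) (hA : 10 < A) (hρ0 : 0 < ρ) (hρ : ρ < 1 / 20)
    (hη : 0 < η) (hCc : 1 ≤ Cc) (hCd : 0 < Cd)
    (R₀ : Set ℝ) (hR₀c : IsCompact R₀) (hR₀ : R₀ ⊆ Set.Ioi 0) :
    ∃ C : ℝ, 0 < C ∧ ∀ N Δ : ℝ, 3 ≤ N → N ^ (-1 + η) ≤ Δ → Δ ≤ Cd →
      Rmeasure {α ∈ R₀ | Δ * N / 2 < ((T2set Cc ρ A α N Δ).ncard : ℝ)}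
        ≤ ENNReal.ofReal (C * Real.log (Real.log N) ^ 4 * Real.log N ^ (6 * ρ - 3)) := by
  obtain ⟨a, b, ha, hb, hab⟩ := exists_subset_Icc_of_isCompact hR₀c hR₀
  obtain ⟨C₁, hC₁, hcard⟩ := exists_card_sifted_le A ρ hρ0 hρ
  have hCc0 : 0 < Cc := by linarith
  have ha' : 0 < a⁻¹ := by positivity
  obtain ⟨K, hKdef⟩ : ∃ K : ℝ, K = 4 * Cc * (1 + a⁻¹) := ⟨_, rfl⟩
  have hK4 : 4 * Cc ≤ K := by rw [hKdef]; nlinarith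
  have hK1 : 1 ≤ K := by linarith
  have hKsq : K ≤ K ^ 2 := by nlinarith
  have hKa : 4 * Cc ≤ a * K ^ 2 := by
    calc 4 * Cc ≤ 4 * Cc * (a + 1) := by nlinarith
      _ = a * K := by rw [hKdef]; field_simp
      _ ≤ a * K ^ 2 := by gcongr
  obtain ⟨B, hBdef⟩ : ∃ B : ℝ, B = b + Cc * Cd := ⟨_, rfl⟩
  have hB0 : 0 < B := by rw [hBdef]; positivity
  obtain ⟨ε, hεdef⟩ : ∃ ε : ℝ, ε = Real.log (Real.log 3) := ⟨_, rfl⟩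
  have hl3 : 1 < Real.log 3 := by
    rw [Real.lt_log_iff_exp_lt (by norm_num)]; exact Real.exp_one_lt_three
  have hε : 0 < ε := by rw [hεdef]; exact Real.log_pos hl3
  have hlogK : 0 ≤ Real.log (2 * K) := Real.log_nonneg (by linarith)
  refine ⟨a⁻¹ * 16 * C₁ ^ 3 * K ^ 2 * B * Cc * ((Real.log (2 * K) / ε + A) / ε ^ 3),
    by positivity, fun N Δ hN hΔN hΔ => ?_⟩
  have hN0 : 0 < N := by linarith
  have hΔ0 : 0 < Δ := (Real.rpow_pos_of_pos hN0 _).trans_le hΔN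
  have hlN : Real.log 3 ≤ Real.log N := Real.log_le_log (by norm_num) hN
  have hL0 : 0 < Real.log N := by linarith
  have hεℓ : ε ≤ Real.log (Real.log N) := by
    rw [hεdef]; exact Real.log_le_log (by linarith) hlN
  have hcardN := hcard N hN
  set L := Real.log N with hL
  set ℓ := Real.log L with hℓ
  set s := N ^ ((1 : ℝ) / 2) with hs
  have hs0 : 0 < s := Real.rpow_pos_of_pos hN0 _
  have hs1 : 1 ≤ s := Real.one_le_rpow (by linarith) (by norm_num)
  have hss : s ^ 2 = N := by rw [hs, ← Real.sqrt_eq_rpow, Real.sq_sqrt hN0.le]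
  set P := L ^ (2 * ρ - 1) with hP
  have hP0 : 0 < P := Real.rpow_pos_of_pos hL0 _
  have hP3 : L ^ (6 * ρ - 3) = P ^ 3 := by
    rw [hP, ← Real.rpow_natCast, ← Real.rpow_mul hL0.le]
    congr 1
    push_cast
    ring
  have hLA : L ^ (-A) ≤ 1 := Real.rpow_le_one_of_one_le_of_nonpos (by linarith) (by linarith)
  have hU0 : 0 < s * L ^ (-A) := mul_pos hs0 (Real.rpow_pos_of_pos hL0 _)
  set M := ⌊K * s⌋₊ with hM
  have hUM : s * L ^ (-A) ≤ M := by
    have h1 : K * s < M + 1 := Nat.lt_floor_add_one _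
    have h2 : s * L ^ (-A) ≤ s := by nlinarith
    nlinarith
  have hMK : (M : ℝ) ≤ K * s := Nat.floor_le (by positivity)
  have hcM : ((sifted (outsideGap ρ N) M).card : ℝ) ≤ C₁ * (K * s) * P :=
    (hcardN M hUM).trans (by gcongr)
  have hsumT := sum_inv_filter_le (A := A) (by linarith) hK1 hN
  have hsum := sum_quadIndex_le (ρ := ρ) (N := N) (c := Cc * Δ) (D := C₁ * P) (M := M) hB0.le
    (by positivity) (by positivity) fun X hX => (hcardN X hX).trans (le_of_eq (by ring))
  have hfirst : Real.log (2 * K) + A * ℓ ≤ (Real.log (2 * K) / ε + A) / ε ^ 3 * ℓ ^ 4 := by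
    have h1 : Real.log (2 * K) ≤ Real.log (2 * K) / ε * ℓ := by
      rw [div_mul_eq_mul_div, le_div_iff₀ hε]
      gcongr
    have h2 : ε ^ 3 ≤ ℓ ^ 3 := by gcongr
    have hℓ0 : 0 < ℓ := by linarith
    calc Real.log (2 * K) + A * ℓ ≤ (Real.log (2 * K) / ε + A) * ℓ := by linarith
      _ = (Real.log (2 * K) / ε + A) / ε ^ 3 * (ε ^ 3 * ℓ) := by field_simp
      _ ≤ (Real.log (2 * K) / ε + A) / ε ^ 3 * (ℓ ^ 3 * ℓ) := by gcongr
      _ = _ := by ring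
  refine (Rmeasure_le_of_card (J := quadIndex ρ N (s * L ^ (-A)) B M)
    (I := fun j => {x : ℝ | 0 ≤ x * ((quadOfIndex j 0 : ℝ) * quadOfIndex j 1) -
          (quadOfIndex j 2 : ℝ) * quadOfIndex j 3 ∧
        x * ((quadOfIndex j 0 : ℝ) * quadOfIndex j 1) -
          (quadOfIndex j 2 : ℝ) * quadOfIndex j 3 ≤ Cc * Δ})
    (v := fun j => Cc * Δ / ((j.2.1 : ℝ) * j.2.2.1)) (τ := Δ * N / 2) ha (by positivity)
    (fun x hx => (hab hx.1).1) (fun j _ => ?_) (fun j _ => by positivity)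
    (fun j hj => volume_quadOfIndex_le hj) (fun x hx => ?_)).trans (ENNReal.ofReal_le_ofReal ?_)
  · exact measurableSet_setOf_linear_le
  · refine hx.2.le.trans ?_
    exact_mod_cast ncard_T2set_le ha (hab hx.1).1 (hab hx.1).2 hN hCc hΔ (by linarith)
      (hK4.trans hKsq) hKa hCd hBdef.ge
  · have hfinal : ∑ j ∈ quadIndex ρ N (s * L ^ (-A)) B M, Cc * Δ / ((j.2.1 : ℝ) * j.2.2.1) ≤
        4 * ((C₁ * (K * s) * P) ^ 2 * (Cc * Δ * (C₁ * P) * B *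
          (2 * ((Real.log (2 * K) / ε + A) / ε ^ 3 * ℓ ^ 4)))) := by
      refine hsum.trans ?_
      gcongr
      linarith
    calc a⁻¹ * ((∑ j ∈ quadIndex ρ N (s * L ^ (-A)) B M,
          Cc * Δ / ((j.2.1 : ℝ) * j.2.2.1)) / (Δ * N / 2))
        ≤ a⁻¹ * (4 * ((C₁ * (K * s) * P) ^ 2 * (Cc * Δ * (C₁ * P) * B *
          (2 * ((Real.log (2 * K) / ε + A) / ε ^ 3 * ℓ ^ 4)))) / (Δ * N / 2)) := by gcongr
      _ = _ := by
        rw [hP3, ← hss]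
        field_simp
        ring
end
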